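/- arXiv:1506.03806 — 2 statements merged into one kernel-verified Lean document; each statement's English description precedes it below -/
import Mathlib

section
/- Let ≅ be an equivalence relation on the 2-sphere S² that is topologically closed (its graph {(x,y) ∈ S² × S² : x ≅ y} is a closed subset of S² × S²), such that each equivalence class is a connected set and no equivalence class equals all of S². Then the quotient topological space S²/≅ is homeomorphic to S² if and only if no equivalence class separates S², i.e., if and only if for every x ∈ S² the complement of the equivalence class of x is a connected subset of S². -/
open Set Filter Topology Metric

/-- The unit sphere in Euclidean three-space. -/
abbrev TwoSphere : Type := Metric.sphere (0 : EuclideanSpace ℝ (Fin 3)) 1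

/-- `f` is a continuous branch of the logarithm of `u` on `s`. -/
def IsLogOn {T : Type*} [TopologicalSpace T] (u f : T → ℂ) (s : Set T) : Prop :=
  ContinuousOn f s ∧ ∀ z ∈ s, Complex.exp (f z) = u z

section Log

variable {T : Type*} [TopologicalSpace T]

theorem IsLogOn.mono {u f : T → ℂ} {s t : Set T} (h : IsLogOn u f s) (hts : t ⊆ s) :
    IsLogOn u f t :=
  ⟨h.1.mono hts, fun z hz => h.2 z (hts hz)⟩

theorem IsPreconnected.exists_int_of_forall {s : Set T} (hs : IsPreconnected s) {h : T → ℝ}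
    (hc : ContinuousOn h s) (hZ : ∀ z ∈ s, ∃ n : ℤ, h z = n) {a b : T} (ha : a ∈ s)
    (hb : b ∈ s) : h a = h b := by
  have hT : DiscreteTopology (AddSubgroup.zmultiples (1 : ℝ)) := inferInstance
  refine hs.constant_of_mapsTo (T := (AddSubgroup.zmultiples (1 : ℝ) : Set ℝ)) ⟨hT⟩ hc ?_ ha hb
  intro z hz
  obtain ⟨n, hn⟩ := hZ z hz
  exact ⟨n, by simp [hn]⟩

theorem IsLogOn.sub_eq_sub {u f g : T → ℂ} {s : Set T} (hf : IsLogOn u f s) (hg : IsLogOn u g s)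
    (hs : IsPreconnected s) {a b : T} (ha : a ∈ s) (hb : b ∈ s) : f a - g a = f b - g b := by
  have key : ∀ z ∈ s, ∃ n : ℤ, f z = g z + n * (2 * Real.pi * Complex.I) := fun z hz =>
    Complex.exp_eq_exp_iff_exists_int.1 ((hf.2 z hz).trans (hg.2 z hz).symm)
  have hpi : (2 * Real.pi : ℝ) ≠ 0 := by positivity
  have h := hs.exists_int_of_forall (h := fun z => (f z - g z).im / (2 * Real.pi))
    ((Complex.continuous_im.comp_continuousOn (hf.1.sub hg.1)).div_const _) (by
      intro z hz
      obtain ⟨n, hn⟩ := key z hz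
      refine ⟨n, ?_⟩
      rw [hn]
      simp) ha hb
  obtain ⟨n, hn⟩ := key a ha
  obtain ⟨m, hm⟩ := key b hb
  have h' : (f a - g a).im = (f b - g b).im := by
    field_simp at h
    exact h
  rw [hn, hm] at h' ⊢
  simp at h'
  simp [h']

/-- Branches of the logarithm on two closed sets with preconnected intersection glue. -/
theorem IsLogOn.exists_union {u f g : T → ℂ} {s t : Set T} (hf : IsLogOn u f s)
    (hg : IsLogOn u g t) (hs : IsClosed s) (ht : IsClosed t) (hst : IsPreconnected (s ∩ t)) :
    ∃ k, IsLogOn u k (s ∪ t) := by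
  classical
  obtain ⟨c, hc, hce⟩ : ∃ c : ℂ, (∀ z ∈ s ∩ t, f z = g z + c) ∧ (Complex.exp c = 1) := by
    rcases (s ∩ t).eq_empty_or_nonempty with h | ⟨a, ha⟩
    · exact ⟨0, by simp [h], by simp⟩
    · refine ⟨f a - g a, fun z hz => ?_, ?_⟩
      · have := (hf.mono inter_subset_left).sub_eq_sub (hg.mono inter_subset_right) hst hz ha
        rw [← this]; ring
      · rw [Complex.exp_sub, hf.2 a ha.1, hg.2 a ha.2, div_self]
        rw [← hf.2 a ha.1]
        exact Complex.exp_ne_zero _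
  refine ⟨s.piecewise f (fun z => g z + c), ?_, ?_⟩
  · refine ContinuousOn.union_of_isClosed ?_ ?_ hs ht
    · exact hf.1.congr (fun z hz => by simp [hz])
    · refine (hg.1.add (continuousOn_const (c := c))).congr fun z hz => ?_
      by_cases hzs : z ∈ s
      · simp [hzs, hc z ⟨hzs, hz⟩]
      · simp [hzs]
  · rintro z hz
    by_cases hzs : z ∈ s
    · simp [hzs, hf.2 z hzs]
    · simp [hzs, Complex.exp_add, hce, hg.2 z (hz.resolve_left hzs)]

end Log

theorem exists_isLogOn_univ {g : ℂ → ℂ} (hg : Continuous g) (h0 : ∀ z, g z ≠ 0) :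
    ∃ f, Continuous f ∧ ∀ z, Complex.exp (f z) = g z := by
  obtain ⟨f, hf, hfg⟩ := Complex.exists_continuousOn_eqOn_exp_comp (U := (univ : Set ℂ))
    (by
      have := (Homeomorph.Set.univ ℂ).contractibleSpace
      exact (inferInstance : SimplyConnectedSpace (univ : Set ℂ))) isOpen_univ hg.continuousOn
    (by rintro ⟨z, -, hz⟩; exact h0 z hz)
  exact ⟨f, continuousOn_univ.1 hf, fun z => hfg (mem_univ z)⟩

theorem not_exists_nonvanishing_extension {g : ℂ → ℂ} (hg : Continuous g) (h0 : ∀ z, g z ≠ 0)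
    (p : ℂ) (R : ℝ) (hR : ∀ z, R < ‖z‖ → g z = z - p) : False := by
  obtain ⟨f, hf, hfg⟩ := exists_isLogOn_univ hg h0
  set ρ : ℝ := |R| + ‖p‖ + 1 with hρ
  have hρ0 : 0 < ρ := by positivity
  let c : ℝ → ℂ := fun θ => p + ρ * Complex.exp (θ * Complex.I)
  have hcc : Continuous c := by fun_prop
  have hlarge : ∀ θ, R < ‖c θ‖ := by
    intro θ
    have h1 : ‖(ρ : ℂ) * Complex.exp (θ * Complex.I)‖ = ρ := by
      simp [Complex.norm_exp_ofReal_mul_I, abs_of_pos hρ0]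
    have h2 : ρ ≤ ‖c θ‖ + ‖p‖ := by
      rw [← h1]
      calc _ = ‖c θ - p‖ := by simp [c]
        _ ≤ _ := norm_sub_le _ _
    have := le_abs_self R
    linarith
  have h1 : IsLogOn (fun θ : ℝ => g (c θ)) (fun θ => f (c θ)) univ :=
    ⟨(hf.comp hcc).continuousOn, fun θ _ => hfg _⟩
  have h2 : IsLogOn (fun θ : ℝ => g (c θ)) (fun θ => Complex.log ρ + θ * Complex.I) univ := by
    refine ⟨by fun_prop, fun θ _ => ?_⟩
    beta_reduce
    rw [hR _ (hlarge θ), Complex.exp_add, Complex.exp_log (by exact_mod_cast hρ0.ne')]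
    simp [c]
  have h3 := h1.sub_eq_sub h2 isPreconnected_univ (mem_univ 0) (mem_univ (2 * Real.pi))
  have h4 : c (2 * Real.pi) = c 0 := by
    simp [c, Complex.exp_two_pi_mul_I]
  simp only [h4] at h3
  have h5 : (2 * Real.pi : ℂ) * Complex.I = 0 := by
    have := sub_right_inj.1 h3
    simpa using this.symm
  simp [Real.pi_ne_zero] at h5

section Eilenberg

variable {T : Type*} [TopologicalSpace T] {y : T} {e : T → ℂ} {σ : ℂ → T}

theorem exists_isLogOn_of_norm_lt {e : T → ℂ} {K : Set T} (he : ContinuousOn e K) {q : ℂ}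
    (hq : ∀ z ∈ K, ‖e z‖ < ‖q‖) : ∃ f, IsLogOn (fun z => e z - q) f K := by
  rcases eq_or_ne q 0 with rfl | hq0
  · refine ⟨0, continuousOn_const, fun z hz => ?_⟩
    have := hq z hz
    simp at this
    exact absurd this (norm_nonneg (e z)).not_gt
  have hslit : ∀ z ∈ K, 1 - e z / q ∈ Complex.slitPlane := fun z hz => by
    rw [sub_eq_add_neg]
    apply Complex.mem_slitPlane_of_norm_lt_one
    rw [norm_neg, norm_div, div_lt_one (norm_pos_iff.2 hq0)]
    exact hq z hz
  refine ⟨fun z => Complex.log (1 - e z / q) + Complex.log (-q), ?_, fun z hz => ?_⟩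
  · refine ContinuousOn.add (ContinuousOn.clog ?_ hslit) continuousOn_const
    exact continuousOn_const.sub (he.div_const _)
  · beta_reduce
    rw [Complex.exp_add, Complex.exp_log (Complex.slitPlane_ne_zero (hslit z hz)),
      Complex.exp_log (neg_ne_zero.2 hq0)]
    field_simp
    ring

theorem exists_isLogOn_div {e : T → ℂ} {K : Set T} (he : ContinuousOn e K) {q q' : ℂ} {δ : ℝ}
    (hδ : ∀ z ∈ K, δ ≤ ‖e z - q‖) (hqq : ‖q - q'‖ < δ) {f : T → ℂ}
    (hf : IsLogOn (fun z => e z - q) f K) : ∃ f', IsLogOn (fun z => e z - q') f' K := by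
  have hne : ∀ z ∈ K, e z - q ≠ 0 := fun z hz h0 => by
    have := hδ z hz
    rw [h0, norm_zero] at this
    exact absurd (hqq.trans_le this) (norm_nonneg _).not_gt
  have hslit : ∀ z ∈ K, 1 + (q - q') / (e z - q) ∈ Complex.slitPlane := fun z hz => by
    apply Complex.mem_slitPlane_of_norm_lt_one
    rw [norm_div, div_lt_one (norm_pos_iff.2 (hne z hz))]
    exact hqq.trans_le (hδ z hz)
  refine ⟨fun z => Complex.log (1 + (q - q') / (e z - q)) + f z, ?_, fun z hz => ?_⟩
  · refine ContinuousOn.add (ContinuousOn.clog ?_ hslit) hf.1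
    exact continuousOn_const.add (continuousOn_const.div (he.sub continuousOn_const) hne)
  · beta_reduce
    rw [Complex.exp_add, Complex.exp_log (Complex.slitPlane_ne_zero (hslit z hz)), hf.2 z hz]
    have := hne z hz
    field_simp
    ring

/-- A planar chart of a compact space punctured at `y`. -/
structure IsPuncturedChart (y : T) (e : T → ℂ) (σ : ℂ → T) : Prop where
  cont : Continuous σ
  contOn : ContinuousOn e {y}ᶜ
  left_inv : ∀ z, e (σ z) = z
  ne : ∀ z, σ z ≠ y
  right_inv : ∀ w, w ≠ y → σ (e w) = w

variable [CompactSpace T] [T2Space T]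

theorem IsPuncturedChart.eventually_log (h : IsPuncturedChart y e σ) {F : Set T}
    (hF : IsClosed F) (hy : y ∉ F) :
    ∀ᶠ x in 𝓝 y, x ≠ y → ∃ f, IsLogOn (fun z => e z - e x) f F := by
  have heF : ContinuousOn e F := h.contOn.mono (fun z hz hzy => hy (hzy ▸ hz))
  obtain ⟨R, hR⟩ := (hF.isCompact.image_of_continuousOn heF).isBounded.exists_norm_le
  have hC : IsClosed (σ '' closedBall 0 R) :=
    ((isCompact_closedBall 0 R).image h.cont).isClosed
  have hyC : y ∉ σ '' closedBall 0 R := by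
    rintro ⟨z, -, hz⟩
    exact h.ne z hz
  filter_upwards [hC.isOpen_compl.mem_nhds hyC] with x hx hxy
  refine exists_isLogOn_of_norm_lt heF fun z hz => (hR _ (mem_image_of_mem e hz)).trans_lt ?_
  by_contra hlt
  exact hx ⟨e x, by simpa using not_lt.1 hlt, h.right_inv x hxy⟩

theorem IsPuncturedChart.eventually_log_iff (h : IsPuncturedChart y e σ) {F : Set T}
    (hF : IsClosed F) (hy : y ∉ F) {x : T} (hx : x ∉ F) (hxy : x ≠ y) :
    ∀ᶠ x' in 𝓝 x, ((∃ f, IsLogOn (fun z => e z - e x) f F) ↔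
      ∃ f, IsLogOn (fun z => e z - e x') f F) := by
  have heF : ContinuousOn e F := h.contOn.mono (fun z hz hzy => hy (hzy ▸ hz))
  have hK : IsClosed (e '' F) := (hF.isCompact.image_of_continuousOn heF).isClosed
  have hxK : e x ∉ e '' F := by
    rintro ⟨z, hz, hzx⟩
    have : z = x := by
      rw [← h.right_inv x hxy, ← hzx, h.right_inv z (fun hzy => hy (hzy ▸ hz))]
    exact hx (this ▸ hz)
  obtain ⟨δ, hδ, hball⟩ := Metric.isOpen_iff.1 hK.isOpen_compl _ hxK
  have hce : ContinuousAt e x := h.contOn.continuousAt (isOpen_compl_singleton.mem_nhds hxy)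
  have hd : ∀ z ∈ F, δ ≤ ‖e z - e x‖ := fun z hz => by
    by_contra hlt
    exact hball (by simpa [dist_eq_norm] using hlt) (mem_image_of_mem e hz)
  filter_upwards [hce (Metric.ball_mem_nhds _ (half_pos hδ))] with x' hx'
  have hx'' : ‖e x' - e x‖ < δ / 2 := by simpa [dist_eq_norm] using hx'
  constructor
  · rintro ⟨f, hf⟩
    exact exists_isLogOn_div heF hd (by rw [norm_sub_rev]; linarith) hf
  · rintro ⟨f, hf⟩
    refine exists_isLogOn_div (δ := δ / 2) heF (fun z hz => ?_) hx'' hf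
    have h1 := hd z hz
    have h2 : ‖e z - e x‖ ≤ ‖e z - e x'‖ + ‖e x' - e x‖ := by
      simpa using norm_add_le (e z - e x') (e x' - e x)
    linarith

theorem IsPuncturedChart.exists_isLogOn_of_joinedIn (h : IsPuncturedChart y e σ) {F : Set T}
    (hF : IsClosed F) {x : T} (hxy : x ≠ y) (hj : JoinedIn Fᶜ x y) :
    ∃ f, IsLogOn (fun z => e z - e x) f F := by
  have hy : y ∉ F := hj.target_mem
  obtain ⟨γ, hγ⟩ := hj
  let P : T → Prop := fun x => x = y ∨ ∃ f, IsLogOn (fun z => e z - e x) f F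
  have hP : ∀ x ∉ F, ∀ᶠ x' in 𝓝 x, (P x' ↔ P x) := by
    intro x hx
    by_cases hxy : x = y
    · subst hxy
      filter_upwards [h.eventually_log hF hy] with x' hx'
      simp only [P, true_or, iff_true]
      exact or_iff_not_imp_left.2 hx'
    · filter_upwards [h.eventually_log_iff hF hy hx hxy, isOpen_compl_singleton.mem_nhds hxy]
        with x' hx' hx'y
      simp only [P, hxy, false_or, show x' ≠ y from hx'y, hx']
  have hloc : IsLocallyConstant (fun t => P (γ t)) := by
    rw [IsLocallyConstant.iff_eventually_eq]
    intro t
    filter_upwards [γ.continuous.continuousAt (hP _ (hγ t))] with s hs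
    exact propext hs
  have := hloc.apply_eq_of_preconnectedSpace 0 1
  simp only [γ.source, γ.target, P, hxy, true_or, false_or, eq_iff_iff, iff_true] at this
  exact this

theorem IsPuncturedChart.joinedIn_of_isLogOn [LocallyPathConnectedSpace T]
    (h : IsPuncturedChart y e σ) {F : Set T} (hF : IsClosed F) {x : T} (hxy : x ≠ y)
    (hx : x ∉ F) (hy : y ∉ F) {f : T → ℂ} (hf : IsLogOn (fun z => e z - e x) f F) :
    JoinedIn Fᶜ x y := by
  classical
  by_contra hj
  set C := pathComponentIn Fᶜ x with hC
  have hCo : IsOpen C := hF.isOpen_compl.pathComponentIn x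
  have hCF : IsClosed (C ∪ F) := by
    rw [← isOpen_compl_iff, isOpen_iff_mem_nhds]
    intro w hw
    have hwF : w ∉ F := fun h => hw (Or.inr h)
    filter_upwards [(hF.isOpen_compl.pathComponentIn w).mem_nhds (mem_pathComponentIn_self hwF)]
      with v hv
    rintro (hvC | hvF)
    · exact hw (Or.inl (JoinedIn.trans hvC hv.symm))
    · exact hv.target_mem hvF
  have hyCF : y ∉ C ∪ F := by
    rintro (hyC | hyF)
    · exact hj hyC
    · exact hy hyF
  have heCF : ContinuousOn e (C ∪ F) := h.contOn.mono (fun z hz hzy => hyCF (hzy ▸ hz))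
  obtain ⟨R, hR⟩ := (hCF.isCompact.image_of_continuousOn heCF).isBounded.exists_norm_le
  have hF' : IsClosed (σ ⁻¹' F) := hF.preimage h.cont
  have hfσ : ContinuousOn (f ∘ σ) (σ ⁻¹' F) := hf.1.comp h.cont.continuousOn (fun _ => id)
  obtain ⟨k, hk⟩ := ContinuousMap.exists_restrict_eq hF'
    ⟨(σ ⁻¹' F).domRestrict (f ∘ σ), continuousOn_iff_continuous_domRestrict.1 hfσ⟩
  have hk' : ∀ z, σ z ∈ F → k z = f (σ z) := fun z hz => congr($hk ⟨z, hz⟩)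
  let g : ℂ → ℂ := (σ ⁻¹' C).piecewise (fun z => Complex.exp (k z)) (fun z => z - e x)
  refine not_exists_nonvanishing_extension (g := g) ?_ ?_ (e x) R ?_
  · refine Continuous.piecewise ?_ (Complex.continuous_exp.comp k.continuous) (by fun_prop)
    intro a ha
    have ha' : σ a ∈ F := by
      rw [(hCo.preimage h.cont).frontier_eq] at ha
      have : a ∈ σ ⁻¹' (C ∪ F) :=
        closure_minimal (preimage_mono subset_union_left) (hCF.preimage h.cont) ha.1
      exact this.resolve_left ha.2
    rw [hk' a ha', hf.2 _ ha']
    simp [h.left_inv]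
  · intro z
    by_cases hz : z ∈ σ ⁻¹' C
    · simp [g, hz]
    · simp only [g, hz, not_false_eq_true, piecewise_eq_of_notMem]
      intro h0
      apply hz
      rw [sub_eq_zero.1 h0, mem_preimage, h.right_inv x hxy]
      exact mem_pathComponentIn_self hx
  · intro z hz
    have : z ∉ σ ⁻¹' C := fun hzC => by
      have := hR _ (mem_image_of_mem e (Or.inl hzC : σ z ∈ C ∪ F))
      rw [h.left_inv] at this
      exact absurd hz this.not_gt
    simp [g, this]

end Eilenberg

theorem exists_isPuncturedChart (y : TwoSphere) :
    ∃ (e : TwoSphere → ℂ) (σ : ℂ → TwoSphere), IsPuncturedChart y e σ := by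
  have : Fact (Module.finrank ℝ (EuclideanSpace ℝ (Fin 3)) = 2 + 1) := ⟨by simp⟩
  let s := stereographic' 2 y
  have hs : s.source = {y}ᶜ := stereographic'_source y
  have ht : s.target = univ := stereographic'_target y
  let ι := Complex.orthonormalBasisOneI.repr.toHomeomorph
  refine ⟨fun z => ι.symm (s z), fun z => s.symm (ι z), ?_, ?_, ?_, ?_, ?_⟩
  · have : Continuous s.symm := by
      have := s.continuousOn_symm
      rwa [ht, ← continuousOn_univ.symm] at this
    exact this.comp ι.continuous
  · rw [← hs]
    exact ι.symm.continuous.comp_continuousOn s.continuousOn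
  · intro z
    simp [s.right_inv (show ι z ∈ s.target by rw [ht]; trivial)]
  · intro z
    have := s.map_target (show ι z ∈ s.target by rw [ht]; trivial)
    rw [hs] at this
    exact this
  · intro w hw
    simp [s.left_inv (show w ∈ s.source by rw [hs]; exact hw)]

instance : LocallyPathConnectedSpace TwoSphere := by
  have : Fact (Module.finrank ℝ (EuclideanSpace ℝ (Fin 3)) = 2 + 1) := ⟨by simp⟩
  exact ChartedSpace.locallyPathConnectedSpace (EuclideanSpace ℝ (Fin 2)) TwoSphere

/-- A compact metric space which is the image of the two-sphere under a monotone map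
whose fibres do not separate. -/
class MooreSpace (X : Type*) [MetricSpace X] : Prop extends
    CompactSpace X, LocallyPathConnectedSpace X, Nontrivial X where
  exists_map : ∃ π : TwoSphere → X, Continuous π ∧ Function.Surjective π ∧
    (∀ x, IsConnected (π ⁻¹' {x})) ∧ ∀ x, IsConnected (π ⁻¹' {x})ᶜ

theorem IsClosedMap.isPreconnected_preimage {T X : Type*} [TopologicalSpace T]
    [TopologicalSpace X] {π : T → X} (hcl : IsClosedMap π) (hc : Continuous π)
    (hs : Function.Surjective π) (hf : ∀ x, IsConnected (π ⁻¹' {x})) {Q : Set X}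
    (hQ : IsPreconnected Q) : IsPreconnected (π ⁻¹' Q) := by
  rcases Q.eq_empty_or_nonempty with rfl | hne
  · simpa using isPreconnected_empty
  have hq : IsQuotientMap (Q.restrictPreimage π) :=
    (hcl.restrictPreimage Q).isQuotientMap (hc.restrictPreimage)
      (by
        rintro ⟨x, hx⟩
        obtain ⟨s, rfl⟩ := hs x
        exact ⟨⟨s, hx⟩, rfl⟩)
  have hfib : ∀ x : Q, IsConnected (Q.restrictPreimage π ⁻¹' {x}) := by
    intro x
    have : (fun s : π ⁻¹' Q => (s : T)) '' (Q.restrictPreimage π ⁻¹' {x}) = π ⁻¹' {x.1} := by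
      ext s
      constructor
      · rintro ⟨s, hs, rfl⟩
        exact congr_arg Subtype.val hs
      · intro hs'
        exact ⟨⟨s, by rw [mem_preimage, show π s = x from hs']; exact x.2⟩,
          Subtype.ext hs', rfl⟩
    have h1 := hf x
    rw [← this] at h1
    refine ⟨h1.1.of_image, ?_⟩
    exact (IsInducing.subtypeVal.isPreconnected_image).1 h1.2
  have := IsCoinducing.isConnected_preimage_of_isClosed hfib hq.isCoinducing isClosed_univ
    (connectedSpace_iff_univ.1 (isConnected_iff_connectedSpace.1 ⟨hne, hQ⟩))
  rw [preimage_univ, ← connectedSpace_iff_univ] at this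
  exact (isConnected_iff_connectedSpace.2 this).2

namespace MooreSpace

variable {X : Type*} [MetricSpace X] [MooreSpace X]

/-- Two points are joined in the complement of a closed set if and only if a suitable function
has a continuous logarithm over that set. -/
theorem exists_log_criterion {x y : X} (hxy : x ≠ y) :
    ∃ (π : TwoSphere → X) (u : TwoSphere → ℂ), Continuous π ∧ Function.Surjective π ∧
      (∀ Q, IsPreconnected Q → IsPreconnected (π ⁻¹' Q)) ∧
      ∀ F : Set X, IsClosed F → x ∉ F → y ∉ F →
        ((∃ f, IsLogOn u f (π ⁻¹' F)) ↔ JoinedIn Fᶜ x y) := by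
  obtain ⟨π, hπ, hs, hf, -⟩ := MooreSpace.exists_map (X := X)
  have hpre : ∀ Q, IsPreconnected Q → IsPreconnected (π ⁻¹' Q) := fun Q hQ =>
    (hπ.isClosedMap).isPreconnected_preimage hπ hs hf hQ
  obtain ⟨x', rfl⟩ := hs x
  obtain ⟨y', rfl⟩ := hs y
  obtain ⟨e, σ, he⟩ := exists_isPuncturedChart y'
  have hxy' : x' ≠ y' := fun h => hxy (h ▸ rfl)
  refine ⟨π, fun z => e z - e x', hπ, hs, hpre, fun F hF hx hy => ?_⟩
  have hF' := hF.preimage hπ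
  constructor
  · rintro ⟨f, hf⟩
    obtain ⟨γ, hγ⟩ := he.joinedIn_of_isLogOn hF' hxy' hx hy hf
    exact ⟨γ.map hπ, hγ⟩
  · intro hj
    apply he.exists_isLogOn_of_joinedIn hF' hxy'
    set U := pathComponentIn Fᶜ (π x')
    have hU : IsOpen U := hF.isOpen_compl.pathComponentIn _
    have hU' : IsConnected (π ⁻¹' U) :=
      ⟨⟨x', mem_pathComponentIn_self hx⟩,
        hpre _ (isPathConnected_pathComponentIn hx).isConnected.isPreconnected⟩
    refine (((hU.preimage hπ).isConnected_iff_isPathConnected.1 hU').joinedIn x'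
      (mem_pathComponentIn_self hx) y' hj).mono ?_
    exact preimage_mono pathComponentIn_subset

/-- Janiszewski's theorem. -/
theorem joinedIn_compl_union {A B : Set X} (hA : IsClosed A) (hB : IsClosed B)
    (hAB : IsPreconnected (A ∩ B)) {x y : X} (hxA : JoinedIn Aᶜ x y) (hxB : JoinedIn Bᶜ x y) :
    JoinedIn (A ∪ B)ᶜ x y := by
  have hx : x ∉ A ∪ B := fun h => h.elim hxA.source_mem hxB.source_mem
  have hy : y ∉ A ∪ B := fun h => h.elim hxA.target_mem hxB.target_mem
  rcases eq_or_ne x y with rfl | hxy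
  · exact JoinedIn.refl hx
  obtain ⟨π, u, hπ, -, hpre, hcr⟩ := exists_log_criterion hxy
  obtain ⟨f, hf⟩ := (hcr A hA hxA.source_mem hxA.target_mem).2 hxA
  obtain ⟨g, hg⟩ := (hcr B hB hxB.source_mem hxB.target_mem).2 hxB
  exact (hcr _ (hA.union hB) hx hy).1
    (hf.exists_union hg (hA.preimage hπ) (hB.preimage hπ) (hpre _ hAB))

theorem isPathConnected_compl_singleton (p : X) : IsPathConnected ({p}ᶜ : Set X) := by
  obtain ⟨π, hπ, hs, -, hf⟩ := MooreSpace.exists_map (X := X)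
  have h := (hf p).image π hπ.continuousOn
  rw [← preimage_compl, image_preimage_eq _ hs] at h
  exact isOpen_compl_singleton.isConnected_iff_isPathConnected.1 h

end MooreSpace

section Connected

variable {X : Type*} [TopologicalSpace X]

theorem IsPreconnected.joinedIn_of_subset [LocallyPathConnectedSpace X] {Q U : Set X}
    (hQ : IsPreconnected Q) (hU : IsOpen U) (hQU : Q ⊆ U) {x y : X} (hx : x ∈ Q) (hy : y ∈ Q) :
    JoinedIn U x y := by
  have hP : IsOpen (pathComponentIn U x) := hU.pathComponentIn x
  have hcl : ∀ w ∈ Q, w ∈ closure (pathComponentIn U x) → w ∈ pathComponentIn U x := by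
    intro w hw hwc
    obtain ⟨v, hv, hv'⟩ := mem_closure_iff.1 hwc _ (hU.pathComponentIn w)
      (mem_pathComponentIn_self (hQU hw))
    exact JoinedIn.trans hv' (JoinedIn.symm hv)
  by_contra hj
  obtain ⟨w, hw, hw1, hw2⟩ := hQ (pathComponentIn U x) (closure (pathComponentIn U x))ᶜ hP
    isClosed_closure.isOpen_compl
    (fun w hw => or_iff_not_imp_right.2 fun h => hcl w hw (not_not.1 h))
    ⟨x, hx, mem_pathComponentIn_self (hQU hx)⟩ ⟨y, hy, fun h => hj (hcl y hy h)⟩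
  exact hw2 (subset_closure hw1)

theorem exists_isOpen_isPathConnected_subset [LocallyPathConnectedSpace X] {N : Set X} {p : X}
    (hN : IsOpen N) (hp : p ∈ N) : ∃ M, IsOpen M ∧ IsPathConnected M ∧ p ∈ M ∧ M ⊆ N :=
  ⟨pathComponentIn N p, hN.pathComponentIn p, isPathConnected_pathComponentIn hp,
    mem_pathComponentIn_self hp, pathComponentIn_subset⟩

end Connected

section Metric

variable {X : Type*} [MetricSpace X] [CompactSpace X] [LocallyPathConnectedSpace X]

theorem IsCompact.exists_isConnected_superset {K U : Set X} (hK : IsCompact K) (hU : IsOpen U)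
    (hUc : IsPathConnected U) (hKU : K ⊆ U) :
    ∃ K', IsCompact K' ∧ IsConnected K' ∧ K ⊆ K' ∧ K' ⊆ U := by
  obtain ⟨u, hu, hju⟩ := hUc
  obtain ⟨K', h1, h2, h3, h4, h5⟩ : ∃ K', IsCompact K' ∧ IsPreconnected K' ∧ K ⊆ K' ∧ K' ⊆ U ∧
      u ∈ K' := by
    refine hK.induction_on (p := fun K => ∃ K', IsCompact K' ∧ IsPreconnected K' ∧ K ⊆ K' ∧
      K' ⊆ U ∧ u ∈ K') ?_ ?_ ?_ ?_
    · exact ⟨{u}, isCompact_singleton, isPreconnected_singleton, empty_subset _,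
        singleton_subset_iff.2 hu, rfl⟩
    · rintro s t hst ⟨K', h1, h2, h3, h4⟩
      exact ⟨K', h1, h2, hst.trans h3, h4⟩
    · rintro s t ⟨K₁, h1, h2, h3, h4, h5⟩ ⟨K₂, h1', h2', h3', h4', h5'⟩
      exact ⟨K₁ ∪ K₂, h1.union h1', h2.union u h5 h5' h2', union_subset_union h3 h3',
        union_subset h4 h4', Or.inl h5⟩
    · intro x hx
      obtain ⟨ε, hε, hball⟩ := Metric.nhds_basis_closedBall.mem_iff.1 (hU.mem_nhds (hKU hx))
      obtain ⟨M, hM, hMc, hxM, hMs⟩ :=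
        exists_isOpen_isPathConnected_subset isOpen_ball (mem_ball_self hε : x ∈ ball x ε)
      obtain ⟨γ, hγ⟩ := hju (hKU hx)
      refine ⟨M, mem_nhdsWithin_of_mem_nhds (hM.mem_nhds hxM), range γ ∪ closure M,
        (isCompact_range γ.continuous).union isClosed_closure.isCompact,
        (isPreconnected_range γ.continuous).union x ⟨1, γ.target⟩ (subset_closure hxM)
          hMc.isConnected.isPreconnected.closure, subset_closure.trans subset_union_right,
        union_subset (range_subset_iff.2 hγ) ?_, Or.inl ⟨0, γ.source⟩⟩
      exact ((closure_mono hMs).trans closure_ball_subset_closedBall).trans hball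
  exact ⟨K', h1, ⟨⟨u, h5⟩, h2⟩, h3, h4⟩

end Metric

namespace MooreSpace

variable {X : Type*} [MetricSpace X] [MooreSpace X]

/-- Small closed balls do not separate points that are far away. -/
theorem exists_closedBall_not_separating (X : Type*) [MetricSpace X] [MooreSpace X] {ε : ℝ}
    (hε : 0 < ε) : ∃ δ > 0, ∀ v x y : X, ε ≤ dist x v → ε ≤ dist y v →
      JoinedIn (closedBall v δ)ᶜ x y := by
  suffices h : ∃ δ > 0, ∀ v ∈ (univ : Set X), ∀ x y : X, ε ≤ dist x v → ε ≤ dist y v →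
      JoinedIn (closedBall v δ)ᶜ x y by
    simpa using h
  refine isCompact_univ.induction_on (p := fun s => ∃ δ > 0, ∀ v ∈ s, ∀ x y : X, ε ≤ dist x v →
    ε ≤ dist y v → JoinedIn (closedBall v δ)ᶜ x y) ?_ ?_ ?_ ?_
  · exact ⟨1, one_pos, by simp⟩
  · rintro s t hst ⟨δ, hδ, h⟩
    exact ⟨δ, hδ, fun v hv => h v (hst hv)⟩
  · rintro s t ⟨δ, hδ, h⟩ ⟨δ', hδ', h'⟩
    refine ⟨min δ δ', lt_min hδ hδ', fun v hv x y hx hy => ?_⟩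
    rcases hv with hv | hv
    · exact (h v hv x y hx hy).mono
        (compl_subset_compl.2 (closedBall_subset_closedBall (min_le_left _ _)))
    · exact (h' v hv x y hx hy).mono
        (compl_subset_compl.2 (closedBall_subset_closedBall (min_le_right _ _)))
  · intro p _
    have hK : IsClosed {z : X | ε / 2 ≤ dist z p} :=
      isClosed_le continuous_const (continuous_id.dist continuous_const)
    obtain ⟨K', h1, h2, h3, h4⟩ := hK.isCompact.exists_isConnected_superset
      isOpen_compl_singleton (isPathConnected_compl_singleton p) (by
        rintro z hz rfl
        simp at hz
        linarith)
    have hp : p ∈ K'ᶜ := fun h => h4 h rfl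
    obtain ⟨δ, hδ, hball⟩ := Metric.isOpen_iff.1 h1.isClosed.isOpen_compl p hp
    set μ := min (δ / 3) (ε / 2) with hμ
    have hμ0 : 0 < μ := lt_min (by linarith) (by linarith)
    refine ⟨ball p μ, mem_nhdsWithin_of_mem_nhds (ball_mem_nhds p hμ0), μ, hμ0,
      fun v hv x y hx hy => ?_⟩
    have hv' : dist v p < μ := hv
    have hμ1 : μ ≤ δ / 3 := min_le_left _ _
    have hμ2 : μ ≤ ε / 2 := min_le_right _ _
    have hmem : ∀ x, ε ≤ dist x v → x ∈ K' := fun x hx => h3 (by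
      have := dist_triangle_right x v p
      rw [mem_ofPred_eq]
      linarith)
    refine h2.isPreconnected.joinedIn_of_subset isClosed_closedBall.isOpen_compl ?_
      (hmem x hx) (hmem y hy)
    intro z hz hzv
    refine hball ?_ hz
    have := dist_triangle z v p
    rw [mem_closedBall] at hzv
    rw [mem_ball]
    linarith

end MooreSpace

section Seq

variable {X : Type*} [TopologicalSpace X]

/-- Infinitely many paths converging to a point can be concatenated. -/
theorem joinedIn_of_seq {C : Set X} {p : X} {N : ℕ → Set X} (hN : (𝓝 p).HasAntitoneBasis N)
    {x : ℕ → X} (hx : ∀ k, JoinedIn (C ∩ N k) (x k) (x (k + 1))) :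
    JoinedIn (insert p C) (x 0) p := by
  choose γ hγ using hx
  let g : ℝ → X := fun t => (γ ⌊t⌋₊).extend (t - ⌊t⌋₊)
  have hfl : ∀ t n, ⌊t⌋₊ = n → g t = (γ n).extend (t - n) := by
    rintro t _ rfl
    rfl
  have hgmem : ∀ t, g t ∈ C ∩ N ⌊t⌋₊ := fun t => by
    have : g t ∈ range (γ ⌊t⌋₊) := by
      rw [← Path.extend_range]; exact mem_range_self _
    exact (range_subset_iff.2 (hγ _)) this
  have hseg : ∀ n : ℕ, EqOn g (fun t => (γ n).extend (t - n)) (Icc (n : ℝ) (n + 1)) := by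
    intro n t ht
    rcases ht.2.eq_or_lt with h | h
    · have : ⌊t⌋₊ = n + 1 := by
        rw [h]
        exact_mod_cast Nat.floor_natCast (R := ℝ) (n + 1)
      rw [hfl t _ this, h]
      simp
    · have : ⌊t⌋₊ = n := (Nat.floor_eq_iff (n.cast_nonneg.trans ht.1)).2 ⟨ht.1, h⟩
      exact hfl t _ this
  have hcont : ∀ n : ℕ, ContinuousOn g (Iic ((n : ℝ) + 1)) := by
    intro n
    induction n with
    | zero =>
      refine ((γ 0).continuous_extend.comp (continuous_id)).continuousOn.congr fun t ht => ?_
      rcases le_total 0 t with h | h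
      · simpa using hseg 0 ⟨by simpa using h, ht⟩
      · have : ⌊t⌋₊ = 0 := Nat.floor_of_nonpos h
        simp [hfl t _ this]
    | succ n ih =>
      have : Iic (((n + 1 : ℕ) : ℝ) + 1) = Iic ((n : ℝ) + 1) ∪
          Icc ((n + 1 : ℕ) : ℝ) (((n + 1 : ℕ) : ℝ) + 1) := by
        push_cast
        rw [Iic_union_Icc_eq_Iic]
        linarith
      rw [this]
      refine ih.union_of_isClosed ?_ isClosed_Iic isClosed_Icc
      exact ((γ (n + 1)).continuous_extend.comp (by fun_prop)).continuousOn.congr (hseg (n + 1))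
  have hg : Continuous g := continuous_iff_continuousAt.2 fun t => by
    obtain ⟨n, hn⟩ := exists_nat_gt t
    exact (hcont n).continuousAt (Iic_mem_nhds (by linarith))
  let F : ℝ → X := fun s => if s < 1 then g (s / (1 - s)) else p
  have hF1 : ∀ s ≤ 1, ContinuousAt F s := by
    intro s hs
    rcases hs.lt_or_eq with h | rfl
    · have : F =ᶠ[𝓝 s] fun s => g (s / (1 - s)) := by
        filter_upwards [Iio_mem_nhds h] with r hr
        simp [F, show r < 1 from hr]
      refine ContinuousAt.congr ?_ this.symm
      refine hg.continuousAt.comp (f := fun s : ℝ => s / (1 - s)) ?_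
      exact continuousAt_id.div (continuousAt_const.sub continuousAt_id)
        (by linarith)
    · have hFp : F 1 = p := by simp [F]
      rw [ContinuousAt, hFp, hN.1.tendsto_right_iff]
      intro k _
      have : Ioi ((k : ℝ) / (k + 1)) ∈ 𝓝 (1 : ℝ) :=
        Ioi_mem_nhds ((div_lt_one (by positivity)).2 (by linarith))
      filter_upwards [this] with r hr
      by_cases h : r < 1
      · simp only [F, h, if_true]
        have hr' : (k : ℝ) / (k + 1) < r := hr
        have h1 : 0 < 1 - r := by linarith
        refine hN.2 ?_ (hgmem _).2
        refine Nat.le_floor ?_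
        rw [le_div_iff₀ h1]
        rw [div_lt_iff₀ (by positivity)] at hr'
        linarith
      · simp only [F, h, if_false]
        exact mem_of_mem_nhds (hN.1.mem_of_mem trivial)
  refine JoinedIn.ofLine (f := F) (fun s hs => (hF1 s hs.2).continuousWithinAt) ?_ (by simp [F]) ?_
  · have : F 0 = g 0 := by simp [F]
    rw [this]
    simp [g]
  · rintro _ ⟨s, hs, rfl⟩
    by_cases h : s < 1
    · simp only [F, h, if_true]
      exact Or.inr (hgmem _).1
    · simp [F, h]

end Seq

theorem Path.isPathConnected_range {X : Type*} [TopologicalSpace X] {x y : X} (γ : Path x y) :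
    IsPathConnected (range γ) := by
  have h : IsPathConnected (unitInterval : Set ℝ) := (convex_Icc 0 1).isPathConnected ⟨0, by simp⟩
  have := isPathConnected_iff_pathConnectedSpace.1 h
  exact _root_.isPathConnected_range γ.continuous

/-- `C` is a path component of the complement of `H`. -/
def IsFace {X : Type*} [TopologicalSpace X] (H C : Set X) : Prop :=
  ∃ x ∉ H, C = pathComponentIn Hᶜ x

namespace IsFace

variable {X : Type*} [TopologicalSpace X] {H C D : Set X}

theorem isPathConnected (h : IsFace H C) : IsPathConnected C := by
  obtain ⟨x, hx, rfl⟩ := h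
  exact isPathConnected_pathComponentIn hx

theorem subset_compl (h : IsFace H C) : C ⊆ Hᶜ := by
  obtain ⟨x, -, rfl⟩ := h
  exact pathComponentIn_subset

theorem eq_pathComponentIn (h : IsFace H C) {c : X} (hc : c ∈ C) : C = pathComponentIn Hᶜ c := by
  obtain ⟨x, -, rfl⟩ := h
  ext y
  exact ⟨fun hy => JoinedIn.trans (JoinedIn.symm hc) hy, fun hy => JoinedIn.trans hc hy⟩

theorem mem_iff (h : IsFace H C) {c y : X} (hc : c ∈ C) : y ∈ C ↔ JoinedIn Hᶜ c y := by
  conv_lhs => rw [h.eq_pathComponentIn hc]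
  rfl

theorem isOpen [LocallyPathConnectedSpace X] (hH : IsClosed H) (h : IsFace H C) : IsOpen C := by
  obtain ⟨x, -, rfl⟩ := h
  exact hH.isOpen_compl.pathComponentIn x

theorem eq_of_mem (hC : IsFace H C) (hD : IsFace H D) {x : X} (hxC : x ∈ C) (hxD : x ∈ D) :
    C = D := by
  rw [hC.eq_pathComponentIn hxC, hD.eq_pathComponentIn hxD]

theorem disjoint (hC : IsFace H C) (hD : IsFace H D) (h : C ≠ D) : Disjoint C D :=
  Set.disjoint_left.2 fun _ hxC hxD => h (hC.eq_of_mem hD hxC hxD)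

theorem closure_subset [LocallyPathConnectedSpace X] (hH : IsClosed H) (h : IsFace H C) :
    closure C ⊆ C ∪ H := by
  intro w hw
  by_contra hw'
  rw [mem_union, not_or] at hw'
  obtain ⟨v, hv, hv'⟩ := mem_closure_iff.1 hw _ (hH.isOpen_compl.pathComponentIn w)
    (mem_pathComponentIn_self hw'.2)
  exact hw'.1 ((h.mem_iff hv').2 (JoinedIn.symm hv))

theorem frontier_subset [LocallyPathConnectedSpace X] (hH : IsClosed H) (h : IsFace H C) :
    frontier C ⊆ H := by
  intro w hw
  rw [(h.isOpen hH).frontier_eq] at hw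
  exact (h.closure_subset hH hw.1).resolve_left hw.2

theorem joinedIn (h : IsFace H C) {c : X} (hc : c ∈ C) {y : X} {N : Set X}
    (hN : JoinedIn (N \ H) c y) : JoinedIn (C ∩ N) c y := by
  obtain ⟨γ, hγ⟩ := hN
  refine ⟨γ, fun t => ⟨(h.mem_iff hc).2 ?_, (hγ t).1⟩⟩
  refine (γ.isPathConnected_range.joinedIn c ⟨0, γ.source⟩ _
    (mem_range_self t)).mono ?_
  rintro _ ⟨s, rfl⟩
  exact (hγ s).2

end IsFace

/-- `p` behaves like an end point of `H`: arbitrarily small neighbourhoods of `p` in `H` have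
connected complement in `H`. -/
def EndLike {X : Type*} [TopologicalSpace X] (H : Set X) (p : X) : Prop :=
  ∀ N, IsOpen N → p ∈ N → ∃ β ⊆ H, IsClosed β ∧ IsPreconnected β ∧ p ∉ β ∧ H ⊆ β ∪ N

namespace MooreSpace

variable {X : Type*} [MetricSpace X] [MooreSpace X]

theorem exists_joinedIn_diff_of_endLike {H : Set X} {p : X} (hH : IsClosed H) (hp : EndLike H p)
    {N : Set X} (hN : IsOpen N) (hpN : p ∈ N) : ∃ M ⊆ N, IsOpen M ∧ p ∈ M ∧
      ∀ x ∈ M, ∀ y ∈ M, JoinedIn Hᶜ x y → JoinedIn (N \ H) x y := by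
  obtain ⟨β, hβH, hβ, hβc, hpβ, hHβ⟩ := hp N hN hpN
  obtain ⟨M, hM, hMc, hpM, hMN⟩ := exists_isOpen_isPathConnected_subset
    (hN.inter hβ.isOpen_compl) ⟨hpN, hpβ⟩
  refine ⟨M, hMN.trans inter_subset_left, hM, hpM, fun x hx y hy hxy => ?_⟩
  have hAB : H ∩ (β ∪ Nᶜ) = β := by
    ext z
    constructor
    · rintro ⟨hz, hz' | hz'⟩
      · exact hz'
      · exact (hHβ hz).resolve_right hz'
    · exact fun hz => ⟨hβH hz, Or.inl hz⟩
  have := joinedIn_compl_union hH (hβ.union hN.isClosed_compl) (by rwa [hAB]) hxy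
    ((hMc.joinedIn x hx y hy).mono fun z hz h => h.elim (hMN hz).2 fun h' => h' (hMN hz).1)
  refine this.mono fun z hz => ?_
  simp only [mem_compl_iff, mem_union, not_or, not_not] at hz
  exact ⟨hz.2.2, hz.1⟩

theorem joinedIn_insert_of_endLike {H C : Set X} (hH : IsClosed H) (hC : IsFace H C) {p c : X}
    (hp : EndLike H p) (hpC : p ∈ closure C) (hc : c ∈ C) : JoinedIn (insert p C) c p := by
  have hb : ∀ k : ℕ, ∃ M ⊆ ball p (1 / (k + 1)), IsOpen M ∧ p ∈ M ∧
      ∀ x ∈ M, ∀ y ∈ M, JoinedIn Hᶜ x y → JoinedIn (ball p (1 / (k + 1)) \ H) x y := fun k =>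
    exists_joinedIn_diff_of_endLike hH hp isOpen_ball (mem_ball_self (by positivity))
  choose M hMb hMo hpM hM using hb
  have hx : ∀ k, ∃ x ∈ C, x ∈ M k ∩ M (k - 1) := fun k => by
    obtain ⟨x, hx, hxC⟩ := mem_closure_iff.1 hpC _ ((hMo k).inter (hMo (k - 1)))
      ⟨hpM k, hpM (k - 1)⟩
    exact ⟨x, hxC, hx⟩
  choose x hxC hxM using hx
  have hN : (𝓝 p).HasAntitoneBasis fun k : ℕ => ball p (1 / ((k : ℝ) + 1)) := by
    refine ⟨Metric.nhds_basis_ball_inv_nat_succ, ?_⟩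
    intro i j hij
    refine ball_subset_ball (one_div_le_one_div_of_le (by positivity) ?_)
    simpa using hij
  have h1 : JoinedIn (insert p C) (x 0) p := by
    refine joinedIn_of_seq hN fun k => ?_
    have hj : JoinedIn Hᶜ (x k) (x (k + 1)) := (hC.mem_iff (hxC k)).1 (hxC (k + 1))
    exact hC.joinedIn (hxC k) (hM k _ (hxM k).1 _ (hxM (k + 1)).2 hj)
  exact ((hC.isPathConnected.joinedIn c hc _ (hxC 0)).mono (subset_insert p C)).trans h1

end MooreSpace

/-- `A` is an arc from `a` to `b`. -/
def IsArc {X : Type*} [TopologicalSpace X] (A : Set X) (a b : X) : Prop :=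
  ∃ γ : ℝ → X, ContinuousOn γ (Icc 0 1) ∧ InjOn γ (Icc 0 1) ∧ γ 0 = a ∧ γ 1 = b ∧
    γ '' Icc 0 1 = A

theorem isArc_image_Icc {X : Type*} [TopologicalSpace X] {γ : ℝ → X} {c d : ℝ} (hcd : c < d)
    (hγ : ContinuousOn γ (Icc c d)) (hinj : InjOn γ (Icc c d)) :
    IsArc (γ '' Icc c d) (γ c) (γ d) := by
  have himg : (fun t : ℝ => c + t * (d - c)) '' Icc 0 1 = Icc c d := by
    have := image_affine_Icc' (a := d - c) (sub_pos.2 hcd) c 0 1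
    simp only [mul_zero, zero_add, mul_one, sub_add_cancel] at this
    rw [← this]
    exact image_congr fun t _ => by ring
  have hmaps : MapsTo (fun t : ℝ => c + t * (d - c)) (Icc 0 1) (Icc c d) := by
    rw [← himg]; exact mapsTo_image _ _
  refine ⟨γ ∘ fun t => c + t * (d - c), hγ.comp (by fun_prop) hmaps, hinj.comp ?_ hmaps,
    by simp, by simp, by rw [image_comp, himg]⟩
  intro s _ t _ h
  simpa [(sub_pos.2 hcd).ne'] using h

namespace ArcOfPath

variable {X : Type*} [MetricSpace X]

/-- Closed sets of parameters containing the end points and such that the values at the two ends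
of every gap agree. -/
def Admissible (γ : ℝ → X) (C : Set ℝ) : Prop :=
  C ⊆ Icc 0 1 ∧ IsClosed C ∧ (0 : ℝ) ∈ C ∧ (1 : ℝ) ∈ C ∧
    ∀ s ∈ C, ∀ t ∈ C, s < t → Disjoint (Ioo s t) C → γ s = γ t

theorem exists_gap {C : Set ℝ} (hC : IsClosed C) {s t p q : ℝ} (hs : s ∈ C) (ht : t ∈ C)
    (hsp : s ≤ p) (hqt : q ≤ t) (hd : Disjoint (Icc p q) C) :
    ∃ s' ∈ C ∩ Icc s p, ∃ t' ∈ C ∩ Icc q t, Disjoint (Ioo s' t') C := by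
  obtain ⟨s', hs', hs'm⟩ := (isCompact_Icc.inter_left hC).exists_isMaxOn
    (⟨s, hs, le_rfl, hsp⟩ : (C ∩ Icc s p).Nonempty) continuousOn_id
  obtain ⟨t', ht', ht'm⟩ := (isCompact_Icc.inter_left hC).exists_isMinOn
    (⟨t, ht, hqt, le_rfl⟩ : (C ∩ Icc q t).Nonempty) continuousOn_id
  refine ⟨s', hs', t', ht', Set.disjoint_left.2 fun u hu huC => ?_⟩
  rcases le_or_gt u p with h | h
  · exact hu.1.not_ge (hs'm ⟨huC, (hs'.2.1.trans hu.1.le), h⟩)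
  rcases le_or_gt q u with h' | h'
  · exact hu.2.not_ge (ht'm ⟨huC, h', hu.2.le.trans ht'.2.2⟩)
  · exact Set.disjoint_left.1 hd ⟨h.le, h'.le⟩ huC

theorem admissible_sInter {γ : ℝ → X} (hγ : ContinuousOn γ (Icc 0 1)) {c : Set (Set ℝ)}
    (hc : ∀ C ∈ c, Admissible γ C) (hch : IsChain (· ⊆ ·) c) (hne : c.Nonempty) :
    Admissible γ (⋂₀ c) := by
  obtain ⟨C₀, hC₀⟩ := hne
  refine ⟨(sInter_subset_of_mem hC₀).trans (hc _ hC₀).1, isClosed_sInter fun C hC => (hc C hC).2.1,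
    fun C hC => (hc C hC).2.2.1, fun C hC => (hc C hC).2.2.2.1, ?_⟩
  intro s hs t ht hst hd
  have hs01 := (hc _ hC₀).1 (hs _ hC₀)
  have ht01 := (hc _ hC₀).1 (ht _ hC₀)
  by_contra hne
  have hpos : 0 < dist (γ s) (γ t) := dist_pos.2 hne
  obtain ⟨δ₁, hδ₁, h₁⟩ := Metric.continuousOn_iff.1 hγ s hs01 _ (half_pos hpos)
  obtain ⟨δ₂, hδ₂, h₂⟩ := Metric.continuousOn_iff.1 hγ t ht01 _ (half_pos hpos)
  obtain ⟨η, hη, hη1, hη2, hη3⟩ : ∃ η > 0, η < δ₁ ∧ η < δ₂ ∧ s + η < t - η := by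
    refine ⟨min (min δ₁ δ₂) (t - s) / 3, ?_, ?_, ?_, ?_⟩ <;>
    · have h1 : min (min δ₁ δ₂) (t - s) ≤ δ₁ := (min_le_left _ _).trans (min_le_left _ _)
      have h2 : min (min δ₁ δ₂) (t - s) ≤ δ₂ := (min_le_left _ _).trans (min_le_right _ _)
      have h3 : min (min δ₁ δ₂) (t - s) ≤ t - s := min_le_right _ _
      have h4 : 0 < min (min δ₁ δ₂) (t - s) := lt_min (lt_min hδ₁ hδ₂) (by linarith)
      linarith
  obtain ⟨C, hC, hCd⟩ : ∃ C ∈ c, Disjoint (Icc (s + η) (t - η)) C := by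
    by_contra hcon
    push Not at hcon
    have : (⋂ C : c, Icc (s + η) (t - η) ∩ C).Nonempty := by
      have : Nonempty c := ⟨⟨C₀, hC₀⟩⟩
      refine IsCompact.nonempty_iInter_of_directed_nonempty_isCompact_isClosed _ ?_ ?_ ?_ ?_
      · intro C D
        rcases hch.total C.2 D.2 with h | h
        · exact ⟨C, subset_rfl, inter_subset_inter_right _ h⟩
        · exact ⟨D, inter_subset_inter_right _ h, subset_rfl⟩
      · exact fun C => Set.not_disjoint_iff_nonempty_inter.1 (hcon C C.2)
      · exact fun C => isCompact_Icc.inter_right (hc C C.2).2.1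
      · exact fun C => isClosed_Icc.inter (hc C C.2).2.1
    obtain ⟨u, hu⟩ := this
    rw [mem_iInter] at hu
    have hu0 := (hu ⟨C₀, hC₀⟩).1
    exact Set.disjoint_left.1 hd ⟨by linarith [hu0.1], by linarith [hu0.2]⟩
      fun C hC => (hu ⟨C, hC⟩).2
  obtain ⟨s', hs', t', ht', hd'⟩ := exists_gap (hc C hC).2.1 (hs C hC) (ht C hC)
    (by linarith) (by linarith) hCd
  have heq := (hc C hC).2.2.2.2 s' hs'.1 t' ht'.1 (by linarith [hs'.2.2, ht'.2.1]) hd'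
  have d1 := h₁ s' ((hc C hC).1 hs'.1)
    (by rw [Real.dist_eq, abs_of_nonneg (by linarith [hs'.2.1])]; linarith [hs'.2.2])
  have d2 := h₂ t' ((hc C hC).1 ht'.1)
    (by rw [Real.dist_eq, abs_of_nonpos (by linarith [ht'.2.2])]; linarith [ht'.2.1])
  rw [heq] at d1
  have := dist_triangle_left (γ s) (γ t) (γ t')
  linarith

theorem exists_minimal {γ : ℝ → X} (hγ : ContinuousOn γ (Icc 0 1)) :
    ∃ C, Admissible γ C ∧ ∀ s ∈ C, ∀ t ∈ C, s < t → γ s = γ t → Disjoint (Ioo s t) C := by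
  obtain ⟨C, hC⟩ := zorn_superset {C | Admissible γ C} (by
    intro c hc hch
    rcases c.eq_empty_or_nonempty with rfl | hne
    · refine ⟨Icc 0 1, ⟨subset_rfl, isClosed_Icc, by simp, by simp, ?_⟩, by simp⟩
      intro s hs t ht hst hd
      exact absurd ⟨by linarith [hs.1], by linarith [ht.2]⟩ (Set.disjoint_left.1 hd
        (⟨by linarith, by linarith⟩ : (s + t) / 2 ∈ Ioo s t))
    · exact ⟨⋂₀ c, admissible_sInter hγ (fun C hC => hc hC) hch hne,
        fun C hC => sInter_subset_of_mem hC⟩)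
  refine ⟨C, hC.prop, fun s hs t ht hst hγst => ?_⟩
  obtain ⟨h1, h2, h3, h4, h5⟩ := hC.prop
  have hadm : Admissible γ (C \ Ioo s t) := by
    refine ⟨sdiff_subset.trans h1, h2.sdiff isOpen_Ioo, ⟨h3, fun h => ?_⟩, ⟨h4, fun h => ?_⟩, ?_⟩
    · exact h.1.not_ge (h1 hs).1
    · exact h.2.not_ge (h1 ht).2
    · intro s' hs' t' ht' hst' hd
      by_cases hdC : Disjoint (Ioo s' t') C
      · exact h5 s' hs'.1 t' ht'.1 hst' hdC
      · obtain ⟨u, hu, huC⟩ := Set.not_disjoint_iff.1 hdC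
        have hust : u ∈ Ioo s t := by
          by_contra h
          exact Set.disjoint_left.1 hd hu ⟨huC, h⟩
        have hs's : s' ≤ s := by
          by_contra! h
          exact hs'.2 ⟨h, hu.1.trans hust.2⟩
        have htt' : t ≤ t' := by
          by_contra! h
          exact ht'.2 ⟨hust.1.trans hu.2, h⟩
        have e1 : s' = s := by
          refine hs's.eq_of_not_lt fun h => Set.disjoint_left.1 hd (⟨h, ?_⟩ : s ∈ Ioo s' t')
            ⟨hs, fun h => lt_irrefl _ h.1⟩
          exact hst.trans_le htt'
        have e2 : t = t' := by
          refine htt'.eq_of_not_lt fun h => Set.disjoint_left.1 hd (⟨?_, h⟩ : t ∈ Ioo s' t')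
            ⟨ht, fun h => lt_irrefl _ h.2⟩
          exact hs's.trans_lt hst
        rw [e1, ← e2, hγst]
  have := hC.le_of_le hadm sdiff_subset
  exact Set.disjoint_right.2 fun u huC hu => (this huC).2 hu

/-- A real function on the parameters, separating exactly the values of `γ`. -/
noncomputable def height (γ : ℝ → X) (C : Set ℝ) (x : ℕ → X) (u : ℝ) : ℝ :=
  ∑' n, (1 / 2 : ℝ) ^ n * infDist (x n) (γ '' (C ∩ Icc 0 u))

variable {γ : ℝ → X} {C : Set ℝ}

theorem Admissible.image_nonempty (hC : Admissible γ C) {u : ℝ} (hu : u ∈ C) :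
    (γ '' (C ∩ Icc 0 u)).Nonempty :=
  ⟨γ u, u, ⟨hu, (hC.1 hu).1, le_rfl⟩, rfl⟩

theorem Admissible.notMem_image (hmin : ∀ s ∈ C, ∀ t ∈ C, s < t → γ s = γ t → Disjoint (Ioo s t) C)
    {u v : ℝ} (hu : u ∈ C) (hv : v ∈ C) (huv : u < v)
    (hne : γ u ≠ γ v) : γ v ∉ γ '' (C ∩ Icc 0 u) := by
  rintro ⟨w, ⟨hw, hw'⟩, hwv⟩
  have := hmin w hw v hv (hw'.2.trans_lt huv) hwv
  rcases hw'.2.lt_or_eq with h | h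
  · exact Set.disjoint_left.1 this ⟨h, huv⟩ hu
  · exact hne (h ▸ hwv)

theorem Admissible.image_eq (hC : Admissible γ C)
    (hmin : ∀ s ∈ C, ∀ t ∈ C, s < t → γ s = γ t → Disjoint (Ioo s t) C)
    {u v : ℝ} (hu : u ∈ C) (hv : v ∈ C) (huv : u < v) (he : γ u = γ v) :
    γ '' (C ∩ Icc 0 u) = γ '' (C ∩ Icc 0 v) := by
  refine subset_antisymm (image_mono fun w hw => ⟨hw.1, hw.2.1, hw.2.2.trans huv.le⟩) ?_
  rintro _ ⟨w, ⟨hw, hw'⟩, rfl⟩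
  rcases le_or_gt w u with h | h
  · exact ⟨w, ⟨hw, hw'.1, h⟩, rfl⟩
  · rcases hw'.2.lt_or_eq with h' | rfl
    · exact absurd hw (Set.disjoint_left.1 (hmin u hu v hv huv he) ⟨h, h'⟩)
    · exact ⟨u, ⟨hu, (hC.1 hu).1, le_rfl⟩, he⟩

theorem Admissible.summable [CompactSpace X] (hC : Admissible γ C) (x : ℕ → X) {u : ℝ}
    (hu : u ∈ C) : Summable fun n => (1 / 2 : ℝ) ^ n * infDist (x n) (γ '' (C ∩ Icc 0 u)) := by
  refine Summable.of_nonneg_of_le (fun n => mul_nonneg (by positivity) infDist_nonneg)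
    (fun n => mul_le_mul_of_nonneg_left ?_ (by positivity))
    (summable_geometric_two.mul_right (diam (univ : Set X)))
  obtain ⟨z, hz⟩ := hC.image_nonempty hu
  exact (infDist_le_dist_of_mem hz).trans
    (dist_le_diam_of_mem isCompact_univ.isBounded trivial trivial)

theorem Admissible.height_lt [CompactSpace X] (hC : Admissible γ C)
    (hγ : ContinuousOn γ (Icc 0 1))
    (hmin : ∀ s ∈ C, ∀ t ∈ C, s < t → γ s = γ t → Disjoint (Ioo s t) C)
    {x : ℕ → X} (hx : DenseRange x) {u v : ℝ} (hu : u ∈ C) (hv : v ∈ C) (huv : u < v)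
    (hne : γ u ≠ γ v) : height γ C x v < height γ C x u := by
  have hK : IsClosed (γ '' (C ∩ Icc 0 u)) :=
    ((isCompact_Icc.inter_left hC.2.1).image_of_continuousOn
      (hγ.mono fun w hw => hC.1 hw.1)).isClosed
  have hpos : 0 < infDist (γ v) (γ '' (C ∩ Icc 0 u)) :=
    (hK.notMem_iff_infDist_pos (hC.image_nonempty hu)).1 (notMem_image hmin hu hv huv hne)
  obtain ⟨n, hn⟩ := hx.exists_dist_lt (γ v) (half_pos hpos)
  have hmono : γ '' (C ∩ Icc 0 u) ⊆ γ '' (C ∩ Icc 0 v) :=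
    image_mono fun w hw => ⟨hw.1, hw.2.1, hw.2.2.trans huv.le⟩
  refine Summable.tsum_lt_tsum (i := n) (fun m => ?_) ?_ (hC.summable x hv) (hC.summable x hu)
  · exact mul_le_mul_of_nonneg_left (infDist_le_infDist_of_subset hmono (hC.image_nonempty hu))
      (by positivity)
  · refine mul_lt_mul_of_pos_left ?_ (by positivity)
    have h1 : infDist (x n) (γ '' (C ∩ Icc 0 v)) ≤ dist (x n) (γ v) :=
      infDist_le_dist_of_mem ⟨v, ⟨hv, (hC.1 hv).1, le_rfl⟩, rfl⟩
    have h2 := infDist_le_infDist_add_dist (s := γ '' (C ∩ Icc 0 u)) (x := γ v) (y := x n)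
    rw [dist_comm] at h1
    linarith

theorem Admissible.continuousOn_height [CompactSpace X] (hC : Admissible γ C)
    (hγ : ContinuousOn γ (Icc 0 1)) (x : ℕ → X) : ContinuousOn (height γ C x) C := by
  have key : ∀ ε > 0, ∃ δ > 0, ∀ u ∈ C, ∀ v ∈ C, u ≤ v → dist u v < δ → ∀ z : X,
      infDist z (γ '' (C ∩ Icc 0 v)) ≤ infDist z (γ '' (C ∩ Icc 0 u)) ∧
      infDist z (γ '' (C ∩ Icc 0 u)) ≤ infDist z (γ '' (C ∩ Icc 0 v)) + ε := by
    intro ε hε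
    obtain ⟨δ, hδ, h⟩ := Metric.uniformContinuousOn_iff.1
      (isCompact_Icc.uniformContinuousOn_of_continuous hγ) ε hε
    refine ⟨δ, hδ, fun u hu v hv huv huvδ z => ⟨?_, ?_⟩⟩
    · exact infDist_le_infDist_of_subset
        (image_mono fun w hw => ⟨hw.1, hw.2.1, hw.2.2.trans huv⟩) (hC.image_nonempty hu)
    · rw [← sub_le_iff_le_add]
      refine (le_infDist (hC.image_nonempty hv)).2 ?_
      rintro _ ⟨w, ⟨hw, hw'⟩, rfl⟩
      rw [sub_le_iff_le_add]
      rcases le_total w u with hwu | hwu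
      · have h1 : infDist z (γ '' (C ∩ Icc 0 u)) ≤ dist z (γ w) :=
          infDist_le_dist_of_mem ⟨w, ⟨hw, hw'.1, hwu⟩, rfl⟩
        linarith
      · have h1 : infDist z (γ '' (C ∩ Icc 0 u)) ≤ dist z (γ u) :=
          infDist_le_dist_of_mem ⟨u, ⟨hu, (hC.1 hu).1, le_rfl⟩, rfl⟩
        have h2 : dist (γ w) (γ u) < ε := by
          refine h w (hC.1 hw) u (hC.1 hu) ?_
          rw [Real.dist_eq, abs_of_nonneg (by linarith)]
          rw [Real.dist_eq, abs_of_nonpos (by linarith)] at huvδ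
          linarith [hw'.2]
        linarith [dist_triangle z (γ w) (γ u)]
  refine continuousOn_tsum (u := fun n => (1 / 2 : ℝ) ^ n * diam (univ : Set X)) (fun n => ?_)
    (summable_geometric_two.mul_right _) fun n u hu => ?_
  · refine continuousOn_const.mul (Metric.continuousOn_iff.2 fun u hu ε hε => ?_)
    obtain ⟨δ, hδ, h⟩ := key (ε / 2) (half_pos hε)
    refine ⟨δ, hδ, fun v hv hvu => ?_⟩
    rw [Real.dist_eq, abs_lt]
    rcases le_total u v with huv | huv
    · obtain ⟨h1, h2⟩ := h u hu v hv huv (by rwa [dist_comm]) (x n)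
      constructor <;> linarith
    · obtain ⟨h1, h2⟩ := h v hv u hu huv hvu (x n)
      constructor <;> linarith
  · rw [Real.norm_of_nonneg (mul_nonneg (by positivity) infDist_nonneg)]
    obtain ⟨z, hz⟩ := hC.image_nonempty hu
    exact mul_le_mul_of_nonneg_left ((infDist_le_dist_of_mem hz).trans
      (dist_le_diam_of_mem isCompact_univ.isBounded trivial trivial)) (by positivity)

theorem Admissible.exists_isArc [CompactSpace X] (hC : Admissible γ C)
    (hγ : ContinuousOn γ (Icc 0 1)) (hne : γ 0 ≠ γ 1)
    (hmin : ∀ s ∈ C, ∀ t ∈ C, s < t → γ s = γ t → Disjoint (Ioo s t) C) :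
    ∃ A ⊆ γ '' Icc 0 1, IsArc A (γ 1) (γ 0) := by
  have : Nonempty X := ⟨γ 0⟩
  set x := TopologicalSpace.denseSeq X
  have hx : DenseRange x := TopologicalSpace.denseRange_denseSeq X
  set h := height γ C x with hh
  have hcont : ContinuousOn h C := hC.continuousOn_height hγ x
  have h0 := hC.2.2.1
  have h1 := hC.2.2.2.1
  have hCc : IsCompact C := isCompact_Icc.of_isClosed_subset hC.2.1 hC.1
  have hlt : ∀ u ∈ C, ∀ v ∈ C, u < v → γ u ≠ γ v → h v < h u := fun u hu v hv huv hne =>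
    hC.height_lt hγ hmin hx hu hv huv hne
  have heq : ∀ u ∈ C, ∀ v ∈ C, γ u = γ v → h u = h v := by
    have : ∀ u ∈ C, ∀ v ∈ C, u < v → γ u = γ v → h u = h v := fun u hu v hv huv he => by
      simp only [hh, height, hC.image_eq hmin hu hv huv he]
    intro u hu v hv he
    rcases lt_trichotomy u v with h | rfl | h
    · exact this u hu v hv h he
    · rfl
    · exact (this v hv u hu h he.symm).symm
  have hle : ∀ u ∈ C, ∀ v ∈ C, u ≤ v → h v ≤ h u := fun u hu v hv huv => by
    rcases huv.eq_or_lt with rfl | huv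
    · rfl
    by_cases he : γ u = γ v
    · exact (heq u hu v hv he).ge
    · exact (hlt u hu v hv huv he).le
  have hinj : ∀ u ∈ C, ∀ v ∈ C, h u = h v → γ u = γ v := by
    intro u hu v hv he
    by_contra hne
    rcases lt_trichotomy u v with h | rfl | h
    · exact (hlt u hu v hv h hne).ne' he
    · exact hne rfl
    · exact (hlt v hv u hu h (Ne.symm hne)).ne he
  have himg : h '' C = Icc (h 1) (h 0) := by
    refine subset_antisymm ?_ fun m hm => ?_
    · rintro _ ⟨u, hu, rfl⟩
      exact ⟨hle u hu 1 h1 (hC.1 hu).2, hle 0 h0 u hu (hC.1 hu).1⟩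
    · by_contra hmC
      have hmne : ∀ u ∈ C, h u ≠ m := fun u hu he => hmC ⟨u, hu, he⟩
      have hS : IsCompact (C ∩ h ⁻¹' Ici m) :=
        hCc.of_isClosed_subset (hcont.preimage_isClosed_of_isClosed hC.2.1 isClosed_Ici)
          inter_subset_left
      have hS' : IsCompact (C ∩ h ⁻¹' Iic m) :=
        hCc.of_isClosed_subset (hcont.preimage_isClosed_of_isClosed hC.2.1 isClosed_Iic)
          inter_subset_left
      obtain ⟨s, hs, hsm⟩ := hS.exists_isMaxOn ⟨0, h0, hm.2⟩ continuousOn_id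
      obtain ⟨t, ht, htm⟩ := hS'.exists_isMinOn ⟨1, h1, hm.1⟩ continuousOn_id
      have hs' : m < h s := lt_of_le_of_ne hs.2 (hmne s hs.1).symm
      have ht' : h t < m := lt_of_le_of_ne ht.2 (hmne t ht.1)
      have hst : s < t := by
        by_contra! hts
        exact absurd (hle t ht.1 s hs.1 hts) (by linarith)
      have hd : Disjoint (Ioo s t) C := Set.disjoint_left.2 fun u hu huC => by
        rcases le_total m (h u) with hmu | hmu
        · exact hu.1.not_ge (hsm ⟨huC, hmu⟩)
        · exact hu.2.not_ge (htm ⟨huC, hmu⟩)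
      have := heq s hs.1 t ht.1 (hC.2.2.2.2 s hs.1 t ht.1 hst hd)
      linarith
  have hex : ∀ m, ∃ u, m ∈ h '' C → u ∈ C ∧ h u = m := fun m => by
    by_cases hm : m ∈ h '' C
    · obtain ⟨u, hu, hum⟩ := hm
      exact ⟨u, fun _ => ⟨hu, hum⟩⟩
    · exact ⟨0, fun h => absurd h hm⟩
  choose ρ hρ using hex
  have hδ : ∀ u ∈ C, γ (ρ (h u)) = γ u := fun u hu =>
    hinj _ (hρ _ ⟨u, hu, rfl⟩).1 _ hu (hρ _ ⟨u, hu, rfl⟩).2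
  have hδc : ContinuousOn (γ ∘ ρ) (h '' C) := by
    rw [continuousOn_iff_isClosed]
    intro Z hZ
    have hcl : IsClosed (C ∩ γ ⁻¹' Z) :=
      (hγ.mono hC.1).preimage_isClosed_of_isClosed hC.2.1 hZ
    refine ⟨h '' (C ∩ γ ⁻¹' Z),
      ((hCc.of_isClosed_subset hcl inter_subset_left).image_of_continuousOn
      (hcont.mono inter_subset_left)).isClosed, ?_⟩
    ext m
    constructor
    · rintro ⟨hm, hmC⟩
      exact ⟨⟨ρ m, ⟨(hρ m hmC).1, hm⟩, (hρ m hmC).2⟩, hmC⟩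
    · rintro ⟨⟨u, ⟨hu, huZ⟩, rfl⟩, hmC⟩
      refine ⟨?_, hmC⟩
      rw [mem_preimage, Function.comp_apply, hδ u hu]
      exact huZ
  have hδi : InjOn (γ ∘ ρ) (h '' C) := by
    rintro _ ⟨u, hu, rfl⟩ _ ⟨v, hv, rfl⟩ huv
    simp only [Function.comp_apply, hδ u hu, hδ v hv] at huv
    exact heq u hu v hv huv
  have harc := isArc_image_Icc (hlt 0 h0 1 h1 one_pos hne) (himg ▸ hδc) (himg ▸ hδi)
  simp only [Function.comp_apply, hδ 0 h0, hδ 1 h1] at harc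
  refine ⟨_, ?_, harc⟩
  rw [← himg]
  rintro _ ⟨_, ⟨u, hu, rfl⟩, rfl⟩
  exact ⟨u, hC.1 hu, (hδ u hu).symm⟩

end ArcOfPath

theorem interval_induction {P : ℝ → ℝ → Prop}
    (htrans : ∀ s t u, 0 ≤ s → s ≤ t → t ≤ u → u ≤ 1 → P s t → P t u → P s u)
    (hloc : ∀ t ∈ Icc (0 : ℝ) 1, ∃ V, IsOpen V ∧ t ∈ V ∧
      ∀ s u, 0 ≤ s → s ≤ u → u ≤ 1 → Icc s u ⊆ V → P s u) : P 0 1 := by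
  choose! V hVo hV hP using hloc
  obtain ⟨t, ht0, htm, ⟨m, hm⟩, ht⟩ := exists_monotone_Icc_subset_open_cover_Icc
    (zero_le_one (α := ℝ)) (c := fun x : Icc (0 : ℝ) 1 => Subtype.val ⁻¹' V x)
    (fun x => (hVo x x.2).preimage continuous_subtype_val)
    (fun x _ => mem_iUnion.2 ⟨x, hV x x.2⟩)
  have hstep : ∀ n, P (t n) (t (n + 1)) := fun n => by
    obtain ⟨i, hi⟩ := ht n
    refine hP i i.2 _ _ (t n).2.1 (htm (Nat.le_succ n)) (t (n + 1)).2.2 fun x hx => ?_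
    exact hi (show (⟨x, (t n).2.1.trans hx.1, hx.2.trans (t (n + 1)).2.2⟩ : Icc (0 : ℝ) 1) ∈
      Icc (t n) (t (n + 1)) from hx)
  have hind : ∀ n, P (t 0) (t (n + 1)) := fun n => by
    induction n with
    | zero => exact hstep 0
    | succ n ih =>
      exact htrans _ _ _ (t 0).2.1 (htm (Nat.zero_le _)) (htm (Nat.le_succ _)) (t _).2.2 ih
        (hstep _)
  have := hind m
  rwa [ht0, hm (m + 1) (Nat.le_succ m)] at this

namespace IsArc

variable {X : Type*} [TopologicalSpace X] {A B : Set X} {a b c p q : X}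

theorem ne (h : IsArc A a b) : a ≠ b := by
  obtain ⟨γ, -, hi, rfl, rfl, -⟩ := h
  intro h
  simpa using hi (by simp) (by simp) h

theorem left_mem (h : IsArc A a b) : a ∈ A := by
  obtain ⟨γ, -, -, rfl, -, rfl⟩ := h
  exact ⟨0, by simp, rfl⟩

theorem right_mem (h : IsArc A a b) : b ∈ A := by
  obtain ⟨γ, -, -, -, rfl, rfl⟩ := h
  exact ⟨1, by simp, rfl⟩

theorem isCompact (h : IsArc A a b) : IsCompact A := by
  obtain ⟨γ, hγ, -, -, -, rfl⟩ := h
  exact isCompact_Icc.image_of_continuousOn hγ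

theorem isClosed [T2Space X] (h : IsArc A a b) : IsClosed A := h.isCompact.isClosed

theorem isPathConnected (h : IsArc A a b) : IsPathConnected A := by
  obtain ⟨γ, hγ, -, -, -, rfl⟩ := h
  exact ((convex_Icc (0 : ℝ) 1).isPathConnected ⟨0, by simp⟩).image' hγ

theorem isPreconnected (h : IsArc A a b) : IsPreconnected A :=
  h.isPathConnected.isConnected.isPreconnected

theorem symm (h : IsArc A a b) : IsArc A b a := by
  obtain ⟨γ, hγ, hi, rfl, rfl, rfl⟩ := h
  have hm : MapsTo (fun t : ℝ => 1 - t) (Icc 0 1) (Icc 0 1) := fun t ht =>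
    ⟨by linarith [ht.2], by linarith [ht.1]⟩
  refine ⟨fun t => γ (1 - t), hγ.comp (by fun_prop) hm, hi.comp (by intro s _ t _ h; simpa using h)
    hm, by simp, by simp, ?_⟩
  ext x
  constructor
  · rintro ⟨t, ht, rfl⟩
    exact ⟨_, hm ht, rfl⟩
  · rintro ⟨t, ht, rfl⟩
    exact ⟨_, hm ht, by simp⟩

theorem map {Y : Type*} [TopologicalSpace Y] {φ : X → Y} (h : IsArc A a b)
    (hφ : ContinuousOn φ A) (hi : InjOn φ A) : IsArc (φ '' A) (φ a) (φ b) := by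
  obtain ⟨γ, hγ, hγi, rfl, rfl, rfl⟩ := h
  exact ⟨φ ∘ γ, hφ.comp hγ (mapsTo_image _ _), hi.comp hγi (mapsTo_image _ _), rfl, rfl,
    image_comp _ _ _⟩

theorem concat (hA : IsArc A a b) (hB : IsArc B b c) (hAB : A ∩ B ⊆ {b}) :
    IsArc (A ∪ B) a c := by
  obtain ⟨α, hα, hαi, rfl, h1, rfl⟩ := hA
  obtain ⟨β, hβ, hβi, h2, rfl, rfl⟩ := hB
  have hm : MapsTo (fun t : ℝ => t - 1) (Icc 1 2) (Icc 0 1) := fun t ht =>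
    ⟨by linarith [ht.1], by linarith [ht.2]⟩
  let δ : ℝ → X := fun t => if t ≤ 1 then α t else β (t - 1)
  have e1 : EqOn δ α (Icc 0 1) := fun t ht => by simp [δ, ht.2]
  have e2 : EqOn δ (fun t => β (t - 1)) (Icc 1 2) := fun t ht => by
    rcases ht.1.eq_or_lt with rfl | h
    · simp [δ, h1, h2]
    · simp [δ, h.not_ge]
  have hU : Icc (0 : ℝ) 2 = Icc 0 1 ∪ Icc 1 2 := (Icc_union_Icc_eq_Icc (by simp) (by simp)).symm
  have hc : ContinuousOn δ (Icc 0 2) := by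
    rw [hU]
    exact (hα.congr e1).union_of_isClosed ((hβ.comp (by fun_prop) hm).congr e2)
      isClosed_Icc isClosed_Icc
  have hcross : ∀ s ∈ Icc (0 : ℝ) 1, ∀ t ∈ Icc (1 : ℝ) 2, δ s = δ t → s = t := by
    intro s hs t ht hst
    rw [e1 hs, e2 ht] at hst
    have : α s ∈ ({b} : Set X) := hAB ⟨⟨s, hs, rfl⟩, ⟨t - 1, hm ht, hst.symm⟩⟩
    have hs1 : s = 1 := hαi hs (by simp) (this.trans h1.symm)
    have ht1 : t - 1 = 0 := hβi (hm ht) (by simp) (by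
      rw [h2]
      exact hst.symm.trans this)
    linarith
  have hi : InjOn δ (Icc 0 2) := by
    rw [hU]
    rintro s (hs | hs) t (ht | ht) hst
    · rw [e1 hs, e1 ht] at hst
      exact hαi hs ht hst
    · exact hcross s hs t ht hst
    · exact (hcross t ht s hs hst.symm).symm
    · rw [e2 hs, e2 ht] at hst
      have := hβi (hm hs) (hm ht) hst
      linarith
  have := isArc_image_Icc two_pos hc hi
  rw [e1 (by simp), e2 (by simp), hU, image_union, e1.image_eq, e2.image_eq] at this
  have h3 : (fun t : ℝ => β (t - 1)) '' Icc 1 2 = β '' Icc 0 1 := by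
    ext x
    constructor
    · rintro ⟨t, ht, rfl⟩
      exact ⟨_, hm ht, rfl⟩
    · rintro ⟨t, ht, rfl⟩
      exact ⟨t + 1, ⟨by linarith [ht.1], by linarith [ht.2]⟩, by simp⟩
  rw [h3] at this
  norm_num at this
  exact this

theorem exists_split (h : IsArc A a b) (hp : p ∈ A) (hpa : p ≠ a) (hpb : p ≠ b) :
    ∃ A₁ A₂, IsArc A₁ a p ∧ IsArc A₂ p b ∧ A₁ ∪ A₂ = A ∧ A₁ ∩ A₂ = {p} := by
  obtain ⟨γ, hγ, hi, rfl, rfl, rfl⟩ := h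
  obtain ⟨t, ht, rfl⟩ := hp
  have ht0 : 0 < t := ht.1.lt_of_ne (by rintro rfl; exact hpa rfl)
  have ht1 : t < 1 := ht.2.lt_of_ne (by rintro rfl; exact hpb rfl)
  have s1 : Icc 0 t ⊆ Icc (0 : ℝ) 1 := Icc_subset_Icc_right ht1.le
  have s2 : Icc t 1 ⊆ Icc (0 : ℝ) 1 := Icc_subset_Icc_left ht0.le
  refine ⟨γ '' Icc 0 t, γ '' Icc t 1, isArc_image_Icc ht0 (hγ.mono s1) (hi.mono s1),
    isArc_image_Icc ht1 (hγ.mono s2) (hi.mono s2), ?_, ?_⟩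
  · rw [← image_union, Icc_union_Icc_eq_Icc ht0.le ht1.le]
  · rw [← hi.image_inter s1 s2, Icc_inter_Icc_eq_singleton ht0.le ht1.le, image_singleton]

theorem exists_interior_mem (h : IsArc A a b) : ∃ e ∈ A, e ≠ a ∧ e ≠ b := by
  obtain ⟨γ, hγ, hi, rfl, rfl, rfl⟩ := h
  refine ⟨γ (1 / 2), ⟨1 / 2, by norm_num, rfl⟩, fun h => ?_, fun h => ?_⟩
  · have := hi (by norm_num) (by norm_num) h
    norm_num at this
  · have := hi (by norm_num) (by norm_num) h
    norm_num at this

/-- An arc can be shortened slightly at its first end point. -/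
theorem exists_trim (h : IsArc A a b) {N : Set X} (hN : IsOpen N) (haN : a ∈ N) :
    ∃ c ∈ A, ∃ B ⊆ A, IsArc B c b ∧ a ∉ B ∧ A ⊆ B ∪ N := by
  obtain ⟨γ, hγ, hi, rfl, rfl, rfl⟩ := h
  obtain ⟨U, hU, hUe⟩ := (_root_.continuousOn_iff'.1 hγ) N hN
  have h0 : (0 : ℝ) ∈ U := (hUe.subset ⟨haN, by simp⟩).1
  obtain ⟨δ, hδ, hball⟩ := Metric.isOpen_iff.1 hU 0 h0
  set t := min (δ / 2) (1 / 2) with ht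
  have ht0 : 0 < t := lt_min (by linarith) (by norm_num)
  have ht1 : t ≤ 1 / 2 := min_le_right _ _
  have htδ : t ≤ δ / 2 := min_le_left _ _
  have hsub : Icc t 1 ⊆ Icc 0 1 := Icc_subset_Icc_left ht0.le
  refine ⟨γ t, ⟨t, ⟨ht0.le, by linarith⟩, rfl⟩, γ '' Icc t 1, image_mono hsub,
    isArc_image_Icc (by linarith) (hγ.mono hsub) (hi.mono hsub), ?_, ?_⟩
  · rintro ⟨s, hs, hs0⟩
    have := hi (hsub hs) (by simp) hs0
    linarith [hs.1]
  · rintro _ ⟨s, hs, rfl⟩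
    rcases le_or_gt t s with h | h
    · exact Or.inl ⟨s, ⟨h, hs.2⟩, rfl⟩
    · refine Or.inr (hUe.superset ⟨hball ?_, hs⟩).1
      rw [mem_ball_zero_iff, Real.norm_of_nonneg hs.1]
      linarith

theorem endLike_left [T2Space X] (h : IsArc A a b) : EndLike A a := by
  intro N hN haN
  obtain ⟨c, -, B, hBA, hB, haB, hAB⟩ := h.exists_trim hN haN
  exact ⟨B, hBA, hB.isClosed, hB.isPreconnected, haB, hAB⟩

end IsArc

theorem JoinedIn.exists_isArc {X : Type*} [MetricSpace X] [CompactSpace X] {S : Set X} {a b : X}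
    (h : JoinedIn S a b) (hab : a ≠ b) : ∃ A ⊆ S, IsArc A a b := by
  obtain ⟨γ, hγ⟩ := h
  have hc := γ.continuous_extend.continuousOn (s := Icc 0 1)
  obtain ⟨C, hC, hmin⟩ := ArcOfPath.exists_minimal hc
  obtain ⟨A, hA, hAa⟩ := hC.exists_isArc hc (by simpa using hab) hmin
  rw [γ.extend_one, γ.extend_zero] at hAa
  refine ⟨A, hA.trans ?_, hAa.symm⟩
  rw [Path.image_extend_of_subset _ subset_rfl]
  exact range_subset_iff.2 hγ

namespace MooreSpace

variable {X : Type*} [MetricSpace X] [MooreSpace X]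

/-- Arcs do not separate. -/
theorem joinedIn_compl_of_isArc {A : Set X} {a b x y : X} (h : IsArc A a b) (hx : x ∉ A)
    (hy : y ∉ A) : JoinedIn Aᶜ x y := by
  obtain ⟨γ, hγ, hi, rfl, rfl, rfl⟩ := h
  have hcl : ∀ s u, 0 ≤ s → u ≤ 1 → IsClosed (γ '' Icc s u) := fun s u hs hu =>
    (isCompact_Icc.image_of_continuousOn (hγ.mono (Icc_subset_Icc hs hu))).isClosed
  refine interval_induction (P := fun s u => JoinedIn (γ '' Icc s u)ᶜ x y) ?_ ?_
  · intro s t u hs hst htu hu h1 h2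
    have := joinedIn_compl_union (hcl s t hs (htu.trans hu)) (hcl t u (hs.trans hst) hu) (by
      rw [← hi.image_inter (Icc_subset_Icc hs (htu.trans hu)) (Icc_subset_Icc (hs.trans hst) hu),
        Icc_inter_Icc_eq_singleton hst htu, image_singleton]
      exact isPreconnected_singleton) h1 h2
    rwa [← image_union, Icc_union_Icc_eq_Icc hst htu] at this
  · intro t ht
    obtain ⟨ω, hω⟩ := (isPathConnected_compl_singleton (γ t)).joinedIn x
      (fun h => hx (h ▸ mem_image_of_mem γ ht)) y (fun h => hy (h ▸ mem_image_of_mem γ ht))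
    have hK : IsClosed (range ω) := (isCompact_range ω.continuous).isClosed
    obtain ⟨V, hV, hVe⟩ := (_root_.continuousOn_iff'.1 hγ) _ hK.isOpen_compl
    refine ⟨V, hV, (hVe.subset ⟨?_, ht⟩).1, fun s u hs hsu hu hsub => ⟨ω, fun r hr => ?_⟩⟩
    · rintro ⟨r, hr⟩
      exact hω r hr
    · obtain ⟨v, hv, hvr⟩ := hr
      exact (hVe.superset ⟨hsub hv, hs.trans hv.1, hv.2.trans hu⟩).1 ⟨r, hvr.symm⟩

theorem dense_compl_of_isArc {A : Set X} {a b : X} (h : IsArc A a b) : Dense Aᶜ := by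
  rw [← interior_eq_empty_iff_dense_compl, ← Set.not_nonempty_iff_eq_empty]
  rintro ⟨_, hz⟩
  obtain ⟨γ, hγ, hi, rfl, rfl, rfl⟩ := h
  obtain ⟨m, hm, rfl⟩ := interior_subset hz
  set U := interior (γ '' Icc 0 1)
  obtain ⟨W, hW, hWe⟩ := (_root_.continuousOn_iff'.1 hγ) U isOpen_interior
  obtain ⟨δ, hδ, hball⟩ := Metric.isOpen_iff.1 hW m (hWe.subset ⟨hz, hm⟩).1
  obtain ⟨s, t, hst, hs, ht, hsub⟩ : ∃ s t, s < t ∧ 0 ≤ s ∧ t ≤ 1 ∧ Icc s t ⊆ ball m δ := by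
    refine ⟨max 0 (m - δ / 2), min 1 (m + δ / 2), ?_, le_max_left _ _, min_le_left _ _,
      fun x hx => ?_⟩
    · rw [max_lt_iff, lt_min_iff, lt_min_iff]
      exact ⟨⟨one_pos, by linarith [hm.1]⟩, by linarith [hm.2], by linarith⟩
    · rw [Real.ball_eq_Ioo]
      have h1 := (le_max_right 0 (m - δ / 2)).trans hx.1
      have h2 := hx.2.trans (min_le_right 1 (m + δ / 2))
      exact ⟨by linarith, by linarith⟩
  have hst01 : Icc s t ⊆ Icc 0 1 := Icc_subset_Icc hs ht
  set s' := s + (t - s) / 3 with hs'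
  set t' := s + (t - s) * 2 / 3 with ht'
  have hc1 : IsClosed (γ '' (Icc 0 1 \ Ioo s' t')) :=
    ((isCompact_Icc.diff isOpen_Ioo).image_of_continuousOn (hγ.mono sdiff_subset)).isClosed
  have hsub' : Icc s' t' ⊆ Icc s t := Icc_subset_Icc (by linarith) (by linarith)
  have hsub1 : Icc s' t' ⊆ Icc 0 1 := hsub'.trans hst01
  have hc2 : IsClosed (γ '' Icc s' t') :=
    (isCompact_Icc.image_of_continuousOn (hγ.mono hsub1)).isClosed
  have hO : γ '' Ioo s' t' = U \ γ '' (Icc 0 1 \ Ioo s' t') := by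
    ext x
    constructor
    · rintro ⟨v, hv, rfl⟩
      have hv1 := hsub1 (Ioo_subset_Icc_self hv)
      refine ⟨(hWe.superset ⟨hball (hsub (hsub' (Ioo_subset_Icc_self hv))), hv1⟩).1, ?_⟩
      rintro ⟨w, hw, hwv⟩
      exact hw.2 (hi hw.1 hv1 hwv ▸ hv)
    · rintro ⟨hx, hx'⟩
      obtain ⟨v, hv, rfl⟩ := interior_subset hx
      by_contra hv'
      exact hx' ⟨v, ⟨hv, fun h => hv' ⟨v, h, rfl⟩⟩, rfl⟩
  have hOo : IsOpen (γ '' Ioo s' t') := hO ▸ isOpen_interior.sdiff hc1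
  set x := γ (s + (t - s) / 2) with hx
  have hxm : s + (t - s) / 2 ∈ Ioo s' t' := ⟨by linarith, by linarith⟩
  have hinj : ∀ {v w : ℝ}, v ∈ Icc s t → w ∈ Icc s t → γ v = γ w → v = w := fun hv hw =>
    hi (hst01 hv) (hst01 hw)
  have ms : s ∈ Icc s t := ⟨le_rfl, hst.le⟩
  have ms' : s' ∈ Icc s t := ⟨by linarith, by linarith⟩
  have mt' : t' ∈ Icc s t := ⟨by linarith, by linarith⟩
  have mx : s + (t - s) / 2 ∈ Icc s t := ⟨by linarith, by linarith⟩
  have hp : ∀ w ∈ Icc s t, ∀ v₁ ∈ Icc s t, ∀ v₂ ∈ Icc s t, v₁ ≠ w → v₂ ≠ w →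
      JoinedIn ({γ w} : Set X)ᶜ (γ v₁) (γ v₂) := fun w hw v₁ h₁ v₂ h₂ hn₁ hn₂ =>
    (isPathConnected_compl_singleton (γ w)).joinedIn _ (fun h => hn₁ (hinj h₁ hw h)) _
      (fun h => hn₂ (hinj h₂ hw h))
  obtain ⟨ω, hω⟩ := joinedIn_compl_union (isClosed_singleton (x := γ s'))
    (isClosed_singleton (x := γ t')) (by
      exact (subsingleton_singleton.anti inter_subset_left).isPreconnected)
    (hp s' ms' _ mx s ms (by linarith) (by linarith))
    (hp t' mt' _ mx s ms (by linarith) (by linarith))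
  have hr : range ω ⊆ γ '' Ioo s' t' ∪ (γ '' Icc s' t')ᶜ := by
    rintro _ ⟨r, rfl⟩
    by_contra hcon
    rw [mem_union, not_or, notMem_compl_iff] at hcon
    obtain ⟨v, hv, hvr⟩ := hcon.2
    rcases hv.1.eq_or_lt with rfl | h1
    · exact hω r (Or.inl hvr.symm)
    rcases hv.2.eq_or_lt with rfl | h2
    · exact hω r (Or.inr hvr.symm)
    exact hcon.1 ⟨v, ⟨h1, h2⟩, hvr⟩
  obtain ⟨y, -, hy1, hy2⟩ := ω.isPathConnected_range.isConnected.isPreconnected _ _ hOo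
    hc2.isOpen_compl hr ⟨x, ⟨0, ω.source⟩, _, hxm, rfl⟩ ⟨γ s, ⟨1, ω.target⟩, by
      rintro ⟨v, hv, hvs⟩
      have := hinj (hsub' hv) ms hvs
      linarith [hv.1]⟩
  exact hy2 (image_mono Ioo_subset_Icc_self hy1)

end MooreSpace

/-- Two arcs with the same end points which meet only there. -/
structure IsArcPair {X : Type*} [TopologicalSpace X] (A B : Set X) (a b : X) : Prop where
  left : IsArc A a b
  right : IsArc B a b
  inter : A ∩ B ⊆ {a, b}

def IsJordanCurve {X : Type*} [TopologicalSpace X] (J : Set X) : Prop :=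
  ∃ A B a b, IsArcPair A B a b ∧ A ∪ B = J

namespace IsArcPair

variable {X : Type*} [TopologicalSpace X] {A B : Set X} {a b c : X}

theorem isJordanCurve (h : IsArcPair A B a b) : IsJordanCurve (A ∪ B) := ⟨A, B, a, b, h, rfl⟩

theorem flip (h : IsArcPair A B a b) : IsArcPair B A a b :=
  ⟨h.right, h.left, by rw [inter_comm]; exact h.inter⟩

theorem symm (h : IsArcPair A B a b) : IsArcPair A B b a :=
  ⟨h.left.symm, h.right.symm, by rw [pair_comm]; exact h.inter⟩

theorem inter_eq (h : IsArcPair A B a b) : A ∩ B = {a, b} :=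
  subset_antisymm h.inter (pair_subset ⟨h.left.left_mem, h.right.left_mem⟩
    ⟨h.left.right_mem, h.right.right_mem⟩)

theorem move_right (h : IsArcPair A B a b) (hc : c ∈ A ∪ B) (hca : c ≠ a) :
    ∃ A' B', IsArcPair A' B' a c ∧ A' ∪ B' = A ∪ B := by
  have key : ∀ {A B}, IsArcPair A B a b → c ∈ A → ∃ A' B', IsArcPair A' B' a c ∧
      A' ∪ B' = A ∪ B := by
    intro A B h hc
    rcases eq_or_ne c b with rfl | hcb
    · exact ⟨A, B, h, rfl⟩
    obtain ⟨A₁, A₂, h₁, h₂, hU, hI⟩ := h.left.exists_split hc hca hcb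
    have hI₁ : A₁ ∩ B ⊆ {a} := fun x hx => by
      rcases h.inter ⟨hU.subset (Or.inl hx.1), hx.2⟩ with rfl | rfl
      · rfl
      · exact absurd (hI.subset ⟨hx.1, h₂.right_mem⟩) hcb.symm
    have hI₂ : B ∩ A₂ ⊆ {b} := fun x hx => by
      rcases h.inter ⟨hU.subset (Or.inr hx.2), hx.1⟩ with rfl | rfl
      · exact absurd (hI.subset ⟨h₁.left_mem, hx.2⟩) hca.symm
      · rfl
    refine ⟨A₁, B ∪ A₂, ⟨h₁, h.right.concat h₂.symm hI₂, ?_⟩, ?_⟩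
    · rw [inter_union_distrib_left, hI]
      exact union_subset (hI₁.trans (by simp)) (by simp)
    · rw [union_comm B, ← union_assoc, hU]
  rcases hc with hc | hc
  · exact key h hc
  · obtain ⟨A', B', h', hU⟩ := key h.flip hc
    exact ⟨A', B', h', hU.trans (union_comm _ _)⟩

end IsArcPair

namespace IsJordanCurve

variable {X : Type*} [TopologicalSpace X] {J : Set X} {a b : X}

theorem exists_isArcPair (h : IsJordanCurve J) (ha : a ∈ J) (hb : b ∈ J) (hab : a ≠ b) :
    ∃ A B, IsArcPair A B a b ∧ A ∪ B = J := by
  obtain ⟨A, B, p, q, h, rfl⟩ := h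
  obtain ⟨A', B', c, h', hU⟩ : ∃ A' B' c, IsArcPair A' B' a c ∧ A' ∪ B' = A ∪ B := by
    by_cases hap : a = p
    · exact ⟨A, B, q, hap ▸ h, rfl⟩
    · obtain ⟨A', B', h', hU⟩ := h.move_right ha hap
      exact ⟨A', B', p, h'.symm, hU⟩
  rw [← hU] at hb ⊢
  exact h'.move_right hb hab.symm

theorem nontrivial (h : IsJordanCurve J) : J.Nontrivial := by
  obtain ⟨A, B, p, q, h, rfl⟩ := h
  exact ⟨p, Or.inl h.left.left_mem, q, Or.inl h.left.right_mem, h.left.ne⟩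

theorem exists_isArcPair_left (h : IsJordanCurve J) (ha : a ∈ J) :
    ∃ A B b, IsArcPair A B a b ∧ A ∪ B = J := by
  obtain ⟨b, hb, hba⟩ := h.nontrivial.exists_ne a
  obtain ⟨A, B, h'⟩ := h.exists_isArcPair ha hb hba.symm
  exact ⟨A, B, b, h'⟩

theorem isCompact (h : IsJordanCurve J) : IsCompact J := by
  obtain ⟨A, B, p, q, h, rfl⟩ := h
  exact h.left.isCompact.union h.right.isCompact

theorem isClosed [T2Space X] (h : IsJordanCurve J) : IsClosed J := h.isCompact.isClosed

theorem map {Y : Type*} [TopologicalSpace Y] {φ : X → Y} (h : IsJordanCurve J)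
    (hφ : ContinuousOn φ J) (hi : InjOn φ J) : IsJordanCurve (φ '' J) := by
  obtain ⟨A, B, p, q, h, rfl⟩ := h
  refine ⟨φ '' A, φ '' B, φ p, φ q, ⟨h.left.map (hφ.mono subset_union_left)
    (hi.mono subset_union_left), h.right.map (hφ.mono subset_union_right)
    (hi.mono subset_union_right), ?_⟩, (image_union _ _ _).symm⟩
  rw [← hi.image_inter subset_union_left subset_union_right, h.inter_eq, image_pair]

end IsJordanCurve

namespace MooreSpace

variable {X : Type*} [MetricSpace X] [MooreSpace X]

instance : PathConnectedSpace X := by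
  obtain ⟨π, hπ, hs, -⟩ := MooreSpace.exists_map (X := X)
  have h : IsPathConnected (sphere (0 : EuclideanSpace ℝ (Fin 3)) 1) :=
    isPathConnected_sphere (by rw [← Module.finrank_eq_rank, finrank_euclideanSpace_fin]; norm_num)
      _ zero_le_one
  have : PathConnectedSpace TwoSphere := isPathConnected_iff_pathConnectedSpace.1 h
  exact hs.pathConnectedSpace hπ

/-- A Jordan curve is covered by any neighbourhood of one of its points together with a connected
closed subset which does not separate. -/
theorem exists_trim_of_isJordanCurve {J : Set X} (hJ : IsJordanCurve J) {e : X} (he : e ∈ J)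
    {N : Set X}
    (hN : IsOpen N) (heN : e ∈ N) : ∃ β ⊆ J, IsClosed β ∧ IsPreconnected β ∧ e ∉ β ∧ J ⊆ β ∪ N ∧
      ∀ x ∉ β, ∀ y ∉ β, JoinedIn βᶜ x y := by
  obtain ⟨A, B, b, h, rfl⟩ := hJ.exists_isArcPair_left he
  obtain ⟨_, -, A', hA', hAa, heA, hAN⟩ := h.left.exists_trim hN heN
  obtain ⟨_, -, B', hB', hBa, heB, hBN⟩ := h.right.exists_trim hN heN
  have hI : A' ∩ B' ⊆ {b} := fun x hx => by
    rcases h.inter ⟨hA' hx.1, hB' hx.2⟩ with rfl | rfl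
    · exact absurd hx.1 heA
    · rfl
  refine ⟨A' ∪ B', union_subset_union hA' hB', hAa.isClosed.union hBa.isClosed,
    hAa.isPreconnected.union b hAa.right_mem hBa.right_mem hBa.isPreconnected,
    fun h => h.elim heA heB, union_subset (hAN.trans ?_) (hBN.trans ?_), fun x hx y hy => ?_⟩
  · exact union_subset_union_left _ subset_union_left
  · exact union_subset_union_left _ subset_union_right
  · rw [mem_union, not_or] at hx hy
    exact joinedIn_compl_union hAa.isClosed hBa.isClosed
      (subsingleton_singleton.anti hI).isPreconnected (joinedIn_compl_of_isArc hAa hx.1 hy.1)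
      (joinedIn_compl_of_isArc hBa hx.2 hy.2)

theorem endLike_of_isJordanCurve {J : Set X} (h : IsJordanCurve J) {e : X} (he : e ∈ J) :
    EndLike J e := by
  intro N hN heN
  obtain ⟨β, h1, h2, h3, h4, h5, -⟩ := exists_trim_of_isJordanCurve h he hN heN
  exact ⟨β, h1, h2, h3, h4, h5⟩

theorem exists_crosscut {H C : Set X} (hH : IsClosed H) (hC : IsFace H C) {p q : X}
    (hpq : p ≠ q) (hp : EndLike H p) (hpC : p ∈ closure C) (hq : EndLike H q)
    (hqC : q ∈ closure C) : ∃ A ⊆ C ∪ {p, q}, IsArc A p q := by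
  obtain ⟨c, hc⟩ := hC.isPathConnected.nonempty
  have h1 := (joinedIn_insert_of_endLike hH hC hp hpC hc).mono
    (insert_subset (by simp) subset_union_left : insert p C ⊆ C ∪ {p, q})
  have h2 := (joinedIn_insert_of_endLike hH hC hq hqC hc).mono
    (insert_subset (by simp) subset_union_left : insert q C ⊆ C ∪ {p, q})
  exact (h1.symm.trans h2).exists_isArc hpq

theorem isFace_compl_of_isArc {A : Set X} {a b : X} (h : IsArc A a b) : IsFace A Aᶜ := by
  obtain ⟨x, hx⟩ := (dense_compl_of_isArc h).nonempty_iff.2 ⟨a⟩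
  refine ⟨x, hx, subset_antisymm (fun y hy => ?_) pathComponentIn_subset⟩
  exact joinedIn_compl_of_isArc h hx hy

variable (X) in
theorem exists_isArcPair : ∃ (A B : Set X) (a b : X), IsArcPair A B a b := by
  obtain ⟨p, q, hpq⟩ := exists_pair_ne X
  obtain ⟨A, -, hA⟩ := (joinedIn_univ.2 (PathConnectedSpace.joined p q)).exists_isArc hpq
  have hd := dense_compl_of_isArc hA
  obtain ⟨B, hB, hBa⟩ := exists_crosscut hA.isClosed (isFace_compl_of_isArc hA) hpq
    hA.endLike_left (hd p) hA.symm.endLike_left (hd q)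
  exact ⟨A, B, p, q, hA, hBa, fun x hx => (hB hx.2).resolve_left (fun h => h hx.1)⟩

end MooreSpace

theorem JoinedIn.mem_of_frontier {X : Type*} [TopologicalSpace X] {U S : Set X} {x y : X}
    (hU : IsOpen U) (h : JoinedIn S x y) (hS : Disjoint S (frontier U)) (hx : x ∈ U) : y ∈ U := by
  obtain ⟨γ, hγ⟩ := h
  by_contra hy
  have hr : range γ ⊆ U ∪ (closure U)ᶜ := by
    rintro _ ⟨t, rfl⟩
    by_contra hcon
    rw [mem_union, not_or, notMem_compl_iff] at hcon
    refine Set.disjoint_left.1 hS (hγ t) ?_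
    rw [hU.frontier_eq]
    exact ⟨hcon.2, hcon.1⟩
  have hyc : y ∈ (closure U)ᶜ := (hr ⟨1, γ.target⟩).resolve_left hy
  obtain ⟨z, -, hz, hz'⟩ := γ.isPathConnected_range.isConnected.isPreconnected _ _ hU
    isClosed_closure.isOpen_compl hr ⟨x, ⟨0, γ.source⟩, hx⟩ ⟨y, ⟨1, γ.target⟩, hyc⟩
  exact hz' (subset_closure hz)

theorem isFace_frontier {X : Type*} [TopologicalSpace X] {U : Set X} (hU : IsOpen U)
    (hc : IsPathConnected U) : IsFace (frontier U) U := by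
  obtain ⟨x, hx⟩ := hc.nonempty
  have hd : Disjoint U (frontier U) := by
    rw [hU.frontier_eq]
    exact disjoint_sdiff_right
  refine ⟨x, Set.disjoint_left.1 hd hx, subset_antisymm (fun y hy => ?_) fun y hy => ?_⟩
  · exact (hc.joinedIn x hx y hy).mono (disjoint_left.1 hd)
  · exact JoinedIn.mem_of_frontier hU hy disjoint_compl_left hx

theorem joinedIn_of_mem_closure {X : Type*} [TopologicalSpace X] [LocallyPathConnectedSpace X]
    {U C D : Set X} {e x y : X} (hU : IsOpen U) (hC : IsPathConnected C) (hCU : C ⊆ U)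
    (hD : IsPathConnected D) (hDU : D ⊆ U) (he : e ∈ U) (heC : e ∈ closure C)
    (heD : e ∈ closure D) (hx : x ∈ C) (hy : y ∈ D) : JoinedIn U x y := by
  obtain ⟨M, hM, hMc, heM, hMU⟩ := exists_isOpen_isPathConnected_subset hU he
  obtain ⟨x', hx'M, hx'⟩ := mem_closure_iff.1 heC M hM heM
  obtain ⟨y', hy'M, hy'⟩ := mem_closure_iff.1 heD M hM heM
  exact (((hC.joinedIn x hx x' hx').mono hCU).trans
    ((hMc.joinedIn x' hx'M y' hy'M).mono hMU)).trans ((hD.joinedIn y' hy' y hy).mono hDU)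

theorem IsFace.notMem_crosscut {X : Type*} [TopologicalSpace X] {J C L : Set X} {a b : X}
    (hC : IsFace J C) (hL : L ⊆ C ∪ {a, b}) {e : X}
    (he : e ∈ J) (hea : e ≠ a) (heb : e ≠ b) : e ∉ L := fun h => by
  rcases hL h with h | rfl | rfl
  · exact hC.subset_compl h he
  · exact hea rfl
  · exact heb rfl

namespace MooreSpace

variable {X : Type*} [MetricSpace X] [MooreSpace X] {A B C D J L : Set X} {a b : X}

/-- A Jordan curve separates. -/
theorem exists_not_joinedIn_of_isJordanCurve (hJ : IsJordanCurve J) :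
    ∃ x ∉ J, ∃ y ∉ J, ¬JoinedIn Jᶜ x y := by
  obtain ⟨A, B, p, q, h, rfl⟩ := hJ
  by_contra! hcon
  have hpq := h.left.ne
  set r := dist p q / 2 with hr
  have hr0 : 0 < r := half_pos (dist_pos.2 hpq)
  let S : Set X := {z | r ≤ dist z p} ∩ {z | r ≤ dist z q}
  have hS : IsClosed S := (isClosed_le continuous_const (continuous_id.dist continuous_const)).inter
    (isClosed_le continuous_const (continuous_id.dist continuous_const))
  let S₁ : Set X := S ∩ {z | infDist z B ≤ infDist z A}
  let S₂ : Set X := S ∩ {z | infDist z A ≤ infDist z B}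
  have hS₁ : IsClosed S₁ := hS.inter
    (isClosed_le (continuous_infDist_pt B) (continuous_infDist_pt A))
  have hS₂ : IsClosed S₂ := hS.inter
    (isClosed_le (continuous_infDist_pt A) (continuous_infDist_pt B))
  have hSAB : ∀ z ∈ S, z ∈ A → z ∈ B → False := fun z hz hA hB => by
    rcases h.inter ⟨hA, hB⟩ with rfl | rfl
    · have : r ≤ dist _ _ := hz.1
      rw [dist_self] at this
      linarith
    · have : r ≤ dist _ _ := hz.2
      rw [dist_self] at this
      linarith
  have hmem : ∀ {z : X} {E F : Set X}, IsClosed F → F.Nonempty → z ∈ E →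
      infDist z F ≤ infDist z E → z ∈ F := fun {z E F} hF hne hE hle => by
    rw [infDist_zero_of_mem hE] at hle
    exact (hF.mem_iff_infDist_zero hne).2 (le_antisymm hle infDist_nonneg)
  have hAS₁ : Disjoint A S₁ := Set.disjoint_left.2 fun z hz hz' => hSAB z hz'.1 hz
    (hmem h.right.isClosed ⟨p, h.right.left_mem⟩ hz hz'.2)
  have hBS₂ : Disjoint B S₂ := Set.disjoint_left.2 fun z hz hz' => hSAB z hz'.1
    (hmem h.left.isClosed ⟨p, h.left.left_mem⟩ hz hz'.2) hz
  obtain ⟨K, hK, hKc, hSK, hKJ⟩ : ∃ K, IsClosed K ∧ IsPreconnected K ∧ S₁ ∩ S₂ ⊆ K ∧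
      Disjoint (A ∪ B) K := by
    rcases (S₁ ∩ S₂).eq_empty_or_nonempty with he | ⟨z, hz⟩
    · exact ⟨∅, isClosed_empty, isPreconnected_empty, he.subset, disjoint_bot_right⟩
    · have hsub : S₁ ∩ S₂ ⊆ (A ∪ B)ᶜ := fun w hw h => h.elim
        (fun h => Set.disjoint_left.1 hAS₁ h hw.1) (fun h => Set.disjoint_left.1 hBS₂ h hw.2)
      obtain ⟨K, h1, h2, h3, h4⟩ := (hS₁.inter hS₂).isCompact.exists_isConnected_superset
        (h.left.isClosed.union h.right.isClosed).isOpen_compl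
        ⟨z, hsub hz, fun {y} hy => hcon z (hsub hz) y hy⟩ hsub
      exact ⟨K, h1.isClosed, h2.isPreconnected, h3, disjoint_left.2 fun w hw hw' => h4 hw' hw⟩
  rw [disjoint_union_left] at hKJ
  have h1 : JoinedIn (S₁ ∪ K)ᶜ p q := (h.left.isPathConnected.joinedIn p h.left.left_mem q
    h.left.right_mem).mono (disjoint_left.1 (hAS₁.union_right hKJ.1))
  have h2 : JoinedIn (S₂ ∪ K)ᶜ p q := (h.right.isPathConnected.joinedIn p h.right.left_mem q
    h.right.right_mem).mono (disjoint_left.1 (hBS₂.union_right hKJ.2))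
  have h3 := joinedIn_compl_union (hS₁.union hK) (hS₂.union hK) (by
    rwa [← inter_union_distrib_right, union_eq_self_of_subset_left hSK]) h1 h2
  have h4 : JoinedIn Sᶜ p q := h3.mono (compl_subset_compl.2 fun z hz => by
    rcases le_total (infDist z A) (infDist z B) with h | h
    · exact Or.inr (Or.inl ⟨hz, h⟩)
    · exact Or.inl (Or.inl ⟨hz, h⟩))
  have h5 := h4.mem_of_frontier isOpen_ball (disjoint_left.2 fun z hz hz' => hz ?_)
    (mem_ball_self (x := p) hr0)
  · rw [mem_ball, dist_comm] at h5
    linarith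
  · have h6 := mem_sphere.1 (frontier_ball_subset_sphere hz')
    have h7 := dist_triangle_left p q z
    have h8 : r ≤ dist z q := by linarith
    exact ⟨h6.ge, h8⟩

theorem exists_isFace_ne (hJ : IsJordanCurve J) (C : Set X) : ∃ D, IsFace J D ∧ D ≠ C := by
  obtain ⟨x, hx, y, hy, hxy⟩ := exists_not_joinedIn_of_isJordanCurve hJ
  by_cases h : pathComponentIn Jᶜ x = C
  · refine ⟨pathComponentIn Jᶜ y, ⟨y, hy, rfl⟩, fun h' => hxy ?_⟩
    have : y ∈ pathComponentIn Jᶜ x := by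
      rw [h, ← h']
      exact mem_pathComponentIn_self hy
    exact this
  · exact ⟨_, ⟨x, hx, rfl⟩, h⟩

theorem frontier_eq_of_isFace (hJ : IsJordanCurve J) (hC : IsFace J C) : frontier C = J := by
  have hCo := hC.isOpen hJ.isClosed
  refine subset_antisymm (hC.frontier_subset hJ.isClosed) fun e he => ?_
  by_contra heC
  have heC' : e ∉ C := fun h => hC.subset_compl h he
  have hcl : e ∈ (closure C)ᶜ := fun h => heC (by
    rw [hCo.frontier_eq]
    exact ⟨h, heC'⟩)
  obtain ⟨β, hβJ, -, -, heβ, hJβ, hβ⟩ := exists_trim_of_isJordanCurve hJ he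
    isClosed_closure.isOpen_compl hcl
  obtain ⟨c, hc⟩ := hC.isPathConnected.nonempty
  refine heC' ((hβ c (fun h => hC.subset_compl hc (hβJ h)) e heβ).mem_of_frontier hCo
    (disjoint_left.2 fun z hz hz' => ?_) hc)
  rcases hJβ (hC.frontier_subset hJ.isClosed hz') with h | h
  · exact hz h
  · exact h (frontier_subset_closure hz')

theorem subset_closure_of_isFace (hJ : IsJordanCurve J) (hC : IsFace J C) : J ⊆ closure C := by
  conv_lhs => rw [← frontier_eq_of_isFace hJ hC]
  exact frontier_subset_closure

/-- Points of the complement of a Jordan curve with a crosscut, one of whose sides they can reach,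
reach each other when they can do so across either side. -/
theorem joinedIn_compl_of_crosscut (h : IsArcPair A B a b) (hL : IsArc L a b) {x y : X}
    (hA : JoinedIn (A ∪ L)ᶜ x y) (hB : JoinedIn (B ∪ L)ᶜ x y) :
    JoinedIn (A ∪ B)ᶜ x y := by
  have := joinedIn_compl_union (h.left.isClosed.union hL.isClosed)
    (h.right.isClosed.union hL.isClosed) (by
      rw [← inter_union_distrib_right, union_eq_self_of_subset_left (h.inter.trans
        (pair_subset hL.left_mem hL.right_mem))]
      exact hL.isPreconnected) hA hB
  refine this.mono (compl_subset_compl.2 (union_subset_union subset_union_left subset_union_left))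

theorem subset_compl_side (h : IsArcPair A B a b) (hC : IsFace (A ∪ B) C)
    (hLC : L ⊆ C ∪ {a, b}) (hD : IsFace (A ∪ B) D) (hDC : D ≠ C) : D ⊆ (A ∪ L)ᶜ := by
  rintro z hz (h' | h')
  · exact hD.subset_compl hz (Or.inl h')
  rcases hLC h' with h' | rfl | rfl
  · exact hDC (hD.eq_of_mem hC hz h')
  · exact hD.subset_compl hz (Or.inl h.left.left_mem)
  · exact hD.subset_compl hz (Or.inl h.left.right_mem)

theorem joinedIn_compl_side (h : IsArcPair A B a b) (hC : IsFace (A ∪ B) C) (hL : IsArc L a b)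
    (hLC : L ⊆ C ∪ {a, b}) {D E : Set X} (hD : IsFace (A ∪ B) D) (hDC : D ≠ C)
    (hE : IsPathConnected E) (hEAL : E ⊆ (A ∪ L)ᶜ) {e : X} (he : e ∈ B) (hea : e ≠ a)
    (heb : e ≠ b) (heE : e ∈ closure E) {x y : X} (hx : x ∈ D) (hy : y ∈ E) :
    JoinedIn (A ∪ L)ᶜ x y := by
  refine joinedIn_of_mem_closure (h.left.isClosed.union hL.isClosed).isOpen_compl
    hD.isPathConnected (subset_compl_side h hC hLC hD hDC) hE hEAL (e := e) ?_
    (subset_closure_of_isFace h.isJordanCurve hD (Or.inr he)) heE hx hy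
  rintro (h' | h')
  · exact (h.inter ⟨h', he⟩).elim hea heb
  · exact hC.notMem_crosscut hLC (Or.inr he) hea heb h'

/-- A Jordan curve has at most two faces. -/
theorem eq_or_eq_of_isFace (hJ : IsJordanCurve J) (hC : IsFace J C) (hD : IsFace J D)
    (hDC : D ≠ C) {E : Set X} (hE : IsFace J E) : E = C ∨ E = D := by
  by_contra! hcon
  obtain ⟨A, B, a, b, h, rfl⟩ := hJ
  have ha : a ∈ A ∪ B := Or.inl h.left.left_mem
  have hb : b ∈ A ∪ B := Or.inl h.left.right_mem
  obtain ⟨L, hLC, hL⟩ := exists_crosscut h.isJordanCurve.isClosed hC h.left.ne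
    (endLike_of_isJordanCurve h.isJordanCurve ha) (subset_closure_of_isFace h.isJordanCurve hC ha)
    (endLike_of_isJordanCurve h.isJordanCurve hb) (subset_closure_of_isFace h.isJordanCurve hC hb)
  obtain ⟨x, hx⟩ := hD.isPathConnected.nonempty
  obtain ⟨y, hy⟩ := hE.isPathConnected.nonempty
  have key : ∀ {A' B' : Set X}, IsArcPair A' B' a b → A' ∪ B' = A ∪ B →
      JoinedIn (A' ∪ L)ᶜ x y := by
    intro A' B' h' hU
    obtain ⟨e, he, hea, heb⟩ := h'.right.exists_interior_mem
    rw [← hU] at hC hD hE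
    exact joinedIn_compl_side h' hC hL hLC hD hDC hE.isPathConnected
      (subset_compl_side h' hC hLC hE hcon.1) he hea heb
      (subset_closure_of_isFace h'.isJordanCurve hE (Or.inr he)) hx hy
  exact hcon.2 (hE.eq_of_mem hD hy
    ((hD.mem_iff hx).2 (joinedIn_compl_of_crosscut h hL (key h rfl) (key h.flip (union_comm _ _)))))

/-- A crosscut together with one side of the curve is a Jordan curve. -/
theorem isArcPair_crosscut (h : IsArcPair A B a b) (hC : IsFace (A ∪ B) C) (hL : IsArc L a b)
    (hLC : L ⊆ C ∪ {a, b}) : IsArcPair A L a b :=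
  ⟨h.left, hL, fun _ hz => (hLC hz.2).resolve_left fun h => hC.subset_compl h (Or.inl hz.1)⟩

/-- A crosscut divides a face of a Jordan curve into two pieces, one for each of the two sides of
the curve. -/
theorem exists_faces_of_crosscut (h : IsArcPair A B a b) (hC : IsFace (A ∪ B) C)
    (hL : IsArc L a b) (hLC : L ⊆ C ∪ {a, b}) : ∃ E₁ E₂ : Set X, IsOpen E₁ ∧ IsOpen E₂ ∧
      IsPathConnected E₁ ∧ IsPathConnected E₂ ∧ frontier E₁ = A ∪ L ∧ frontier E₂ = B ∪ L ∧
      Disjoint E₁ E₂ ∧ E₁ ∪ E₂ = C \ L := by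
  obtain ⟨D, hD, hDC⟩ := exists_isFace_ne h.isJordanCurve C
  obtain ⟨d, hd⟩ := hD.isPathConnected.nonempty
  have key : ∀ {A' B' : Set X}, IsArcPair A' B' a b → A' ∪ B' = A ∪ B →
      ∃ E, IsFace (A' ∪ L) E ∧ frontier E = A' ∪ L ∧ E ⊆ C \ L ∧
      ∀ x ∈ C \ L, x ∉ E → JoinedIn (A' ∪ L)ᶜ d x := by
    intro A' B' h' hU
    rw [← hU] at hC hD
    have hJ := (isArcPair_crosscut h' hC hL hLC).isJordanCurve
    have hDAL := subset_compl_side h' hC hLC hD hDC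
    have hdAL := hDAL hd
    have hD' : IsFace (A' ∪ L) (pathComponentIn (A' ∪ L)ᶜ d) := ⟨d, hdAL, rfl⟩
    obtain ⟨E, hE, hED⟩ := exists_isFace_ne hJ (pathComponentIn (A' ∪ L)ᶜ d)
    have hEsub : ∀ z ∈ E, z ∉ A' ∪ B' := by
      rintro z hz (hzA | hzB)
      · exact hE.subset_compl hz (Or.inl hzA)
      · have hza : z ≠ a := by
          rintro rfl
          exact hE.subset_compl hz (Or.inl h'.left.left_mem)
        have hzb : z ≠ b := by
          rintro rfl
          exact hE.subset_compl hz (Or.inl h'.left.right_mem)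
        exact hED (hE.eq_of_mem hD' hz (joinedIn_compl_side h' hC hL hLC hD hDC
          hE.isPathConnected hE.subset_compl hzB hza hzb (subset_closure hz) hd hz))
    refine ⟨E, hE, frontier_eq_of_isFace hJ hE, fun z hz => ⟨?_, fun h => hE.subset_compl hz
      (Or.inr h)⟩, fun x hx hxE => ?_⟩
    · have hF : IsFace (A' ∪ B') (pathComponentIn (A' ∪ B')ᶜ z) := ⟨z, hEsub z hz, rfl⟩
      rcases eq_or_eq_of_isFace h'.isJordanCurve hC hD hDC hF with h | h
      · exact h ▸ mem_pathComponentIn_self (hEsub z hz)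
      · have hzD : z ∈ D := h ▸ mem_pathComponentIn_self (hEsub z hz)
        exact absurd (hE.eq_of_mem hD' hz ((hD.isPathConnected.joinedIn d hd z hzD).mono hDAL)) hED
    · have hxAL : x ∉ A' ∪ L := by
        rintro (h | h)
        · exact hC.subset_compl hx.1 (Or.inl h)
        · exact hx.2 h
      have hF : IsFace (A' ∪ L) (pathComponentIn (A' ∪ L)ᶜ x) := ⟨x, hxAL, rfl⟩
      rcases eq_or_eq_of_isFace hJ hD' hE hED hF with h | h
      · have : x ∈ pathComponentIn (A' ∪ L)ᶜ d := h ▸ mem_pathComponentIn_self hxAL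
        exact this
      · exact absurd (h ▸ mem_pathComponentIn_self hxAL) hxE
  obtain ⟨E₁, hE₁, hf₁, hs₁, hj₁⟩ := key h rfl
  obtain ⟨E₂, hE₂, hf₂, hs₂, hj₂⟩ := key h.flip (union_comm _ _)
  refine ⟨E₁, E₂, hE₁.isOpen (h.left.isClosed.union hL.isClosed),
    hE₂.isOpen (h.right.isClosed.union hL.isClosed), hE₁.isPathConnected, hE₂.isPathConnected,
    hf₁, hf₂, disjoint_left.2 fun z hz₁ hz₂ => ?_, subset_antisymm (union_subset hs₁ hs₂)
    fun x hx => ?_⟩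
  · have hEE : E₁ = E₂ := by
      have hsub : ∀ {A' : Set X}, A' ⊆ A ∪ B → C \ L ⊆ (A' ∪ L)ᶜ := fun hA' y hy hy' =>
        hy'.elim (fun h => hC.subset_compl hy.1 (hA' h)) hy.2
      refine subset_antisymm (fun y hy => (hE₂.mem_iff hz₂).2 ?_)
        fun y hy => (hE₁.mem_iff hz₁).2 ?_
      · exact (hE₁.isPathConnected.joinedIn z hz₁ y hy).mono (hs₁.trans (hsub subset_union_right))
      · exact (hE₂.isPathConnected.joinedIn z hz₂ y hy).mono (hs₂.trans (hsub subset_union_left))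
    obtain ⟨e, he, hea, heb⟩ := h.left.exists_interior_mem
    have : e ∈ B ∪ L := by
      rw [← hf₂, ← hEE, hf₁]
      exact Or.inl he
    rcases this with h' | h'
    · exact (h.inter ⟨he, h'⟩).elim hea heb
    · exact hC.notMem_crosscut hLC (Or.inl he) hea heb h'
  · by_contra hcon
    rw [mem_union, not_or] at hcon
    exact hDC (hD.eq_of_mem hC ((hD.mem_iff hd).2 (joinedIn_compl_of_crosscut h hL
      (hj₁ x hx hcon.1) (hj₂ x hx hcon.2))) hx.1)

/-- Every point of a face of a Jordan curve lies on a crosscut. -/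
theorem exists_crosscut_mem (hJ : IsJordanCurve J) (hC : IsFace J C) {p : X} (hp : p ∈ C) :
    ∃ L a b, IsArc L a b ∧ L ⊆ C ∪ {a, b} ∧ a ∈ J ∧ b ∈ J ∧ p ∈ L := by
  obtain ⟨a, ha, b, hb, hab⟩ := hJ.nontrivial
  have hCo := hC.isOpen hJ.isClosed
  have hpa : p ≠ a := by
    rintro rfl
    exact hC.subset_compl hp ha
  have hpb : p ≠ b := by
    rintro rfl
    exact hC.subset_compl hp hb
  obtain ⟨α, hαC, hα⟩ := (joinedIn_insert_of_endLike hJ.isClosed hC (endLike_of_isJordanCurve hJ ha)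
    (subset_closure_of_isFace hJ hC ha) hp).exists_isArc hpa
  have hJα : J ∩ α ⊆ {a} := fun z hz => (hαC hz.2).resolve_right fun h => hC.subset_compl h hz.1
  have hbα : b ∉ α := fun h => hab (hJα ⟨hb, h⟩).symm
  have hH : IsClosed (J ∪ α) := hJ.isClosed.union hα.isClosed
  have hcl : closure C ⊆ closure (C \ α) := by
    rw [sdiff_eq, inter_comm]
    exact closure_minimal ((dense_compl_of_isArc hα).open_subset_closure_inter hCo |>.trans
      (by rw [inter_comm])) isClosed_closure
  obtain ⟨c, hc⟩ := closure_nonempty_iff.1 ⟨p, hcl (subset_closure hp)⟩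
  have hF : IsFace (J ∪ α) (C \ α) := by
    refine ⟨c, fun h => h.elim (hC.subset_compl hc.1) hc.2, subset_antisymm (fun y hy => ?_)
      fun y hy => ⟨?_, ?_⟩⟩
    · exact joinedIn_compl_union hJ.isClosed hα.isClosed
        (subsingleton_singleton.anti hJα).isPreconnected ((hC.mem_iff hc.1).1 hy.1)
        (joinedIn_compl_of_isArc hα hc.2 hy.2)
    · exact (hC.mem_iff hc.1).2 (JoinedIn.mono hy (compl_subset_compl.2 subset_union_left))
    · exact fun h => hy.target_mem (Or.inr h)
  have hep : EndLike (J ∪ α) p := by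
    intro N hN hpN
    obtain ⟨c, -, β, hβα, hβ, hpβ, hαβ⟩ := hα.exists_trim hN hpN
    refine ⟨J ∪ β, union_subset_union_right _ hβα, hJ.isClosed.union hβ.isClosed, ?_,
      fun h => h.elim (hC.subset_compl hp) hpβ, ?_⟩
    · obtain ⟨A, B, a', b', h, rfl⟩ := hJ
      exact (h.left.isPreconnected.union a' h.left.left_mem h.right.left_mem
        h.right.isPreconnected).union a ha hβ.right_mem hβ.isPreconnected
    · rw [union_assoc]
      exact union_subset_union_right _ hαβ
  have heb : EndLike (J ∪ α) b := by
    intro N hN hbN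
    obtain ⟨β, hβJ, hβ, hβc, hbβ, hJβ, -⟩ := exists_trim_of_isJordanCurve hJ hb
      (hN.sdiff hα.isClosed) ⟨hbN, hbα⟩
    refine ⟨β ∪ α, union_subset_union_left _ hβJ, hβ.union hα.isClosed,
      hβc.union a ((hJβ ha).resolve_right fun h => h.2 hα.right_mem) hα.right_mem
      hα.isPreconnected, fun h => h.elim hbβ hbα, union_subset (hJβ.trans ?_) ?_⟩
    · exact union_subset_union subset_union_left sdiff_subset
    · exact subset_union_right.trans subset_union_left
  obtain ⟨α', hα'C, hα'⟩ := exists_crosscut hH hF hpb hep (hcl (subset_closure hp)) heb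
    (hcl (subset_closure_of_isFace hJ hC hb))
  refine ⟨α ∪ α', a, b, hα.symm.concat hα' fun z hz => ?_, union_subset (hαC.trans ?_)
    (hα'C.trans ?_), ha, hb, Or.inl hα.left_mem⟩
  · rcases hα'C hz.2 with h | rfl | rfl
    · exact absurd hz.1 h.2
    · rfl
    · exact absurd hz.1 hbα
  · exact insert_subset (by simp) subset_union_left
  · refine union_subset (sdiff_subset.trans subset_union_left) (pair_subset (Or.inl hp) (by simp))

end MooreSpace

section Glue

variable {X Y : Type*} [TopologicalSpace X] [TopologicalSpace Y]

theorem continuousOn_invFunOn [T2Space Y] [Nonempty X] {K : Set X} {f : X → Y} (hK : IsCompact K)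
    (hf : ContinuousOn f K) (hi : InjOn f K) : ContinuousOn (Function.invFunOn f K) (f '' K) := by
  refine continuousOn_iff_isClosed.2 fun C hC => ⟨f '' (K ∩ C),
    ((hK.inter_right hC).image_of_continuousOn (hf.mono inter_subset_left)).isClosed, ?_⟩
  ext y
  constructor
  · rintro ⟨hyC, x, hx, rfl⟩
    rw [mem_preimage, hi.leftInvOn_invFunOn hx] at hyC
    exact ⟨⟨x, ⟨hx, hyC⟩, rfl⟩, x, hx, rfl⟩
  · rintro ⟨⟨x, ⟨hx, hxC⟩, rfl⟩, -⟩
    refine ⟨?_, x, hx, rfl⟩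
    rwa [mem_preimage, hi.leftInvOn_invFunOn hx]

theorem IsArc.exists_map [T2Space X] {L : Set X} {L' : Set Y} {a b : X} {a' b' : Y}
    (h : IsArc L a b) (h' : IsArc L' a' b') : ∃ ψ : X → Y, ContinuousOn ψ L ∧ InjOn ψ L ∧
      ψ a = a' ∧ ψ b = b' ∧ ψ '' L = L' := by
  obtain ⟨γ, hγ, hi, rfl, rfl, rfl⟩ := h
  obtain ⟨δ, hδ, hj, rfl, rfl, rfl⟩ := h'
  have hl := hi.leftInvOn_invFunOn
  have hm : MapsTo (Function.invFunOn γ (Icc 0 1)) (γ '' Icc 0 1) (Icc 0 1) := by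
    rintro _ ⟨t, ht, rfl⟩
    rwa [hl ht]
  refine ⟨δ ∘ Function.invFunOn γ (Icc 0 1),
    hδ.comp (continuousOn_invFunOn isCompact_Icc hγ hi) hm, hj.comp ?_ hm, ?_, ?_, ?_⟩
  · rintro _ ⟨s, hs, rfl⟩ _ ⟨t, ht, rfl⟩ hst
    rw [hl hs, hl ht] at hst
    rw [hst]
  · rw [Function.comp_apply, hl (by simp)]
  · rw [Function.comp_apply, hl (by simp)]
  · rw [image_comp, hl.image_image]

theorem exists_glue {Γ L : Set X} (hΓ : IsClosed Γ) (hL : IsClosed L) {φ ψ : X → Y}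
    (hφ : ContinuousOn φ Γ) (hφi : InjOn φ Γ) (hψ : ContinuousOn ψ L) (hψi : InjOn ψ L)
    (he : EqOn φ ψ (Γ ∩ L)) (hd : φ '' Γ ∩ ψ '' L ⊆ φ '' (Γ ∩ L)) :
    ∃ χ : X → Y, ContinuousOn χ (Γ ∪ L) ∧ InjOn χ (Γ ∪ L) ∧ EqOn χ φ Γ ∧ EqOn χ ψ L := by
  classical
  let χ : X → Y := fun x => if x ∈ Γ then φ x else ψ x
  have h1 : EqOn χ φ Γ := fun x hx => if_pos hx
  have h2 : EqOn χ ψ L := fun x hx => by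
    by_cases h : x ∈ Γ
    · rw [h1 h, he ⟨h, hx⟩]
    · exact if_neg h
  have key : ∀ x ∈ Γ, ∀ y ∈ L, χ x = χ y → x = y := fun x hx y hy hxy => by
    rw [h1 hx, h2 hy] at hxy
    obtain ⟨w, hw, hwx⟩ := hd ⟨⟨x, hx, rfl⟩, y, hy, hxy.symm⟩
    rw [← hφi hw.1 hx hwx]
    exact hψi hw.2 hy (by rw [← he hw, hwx, hxy])
  refine ⟨χ, (hφ.congr h1).union_of_isClosed (hψ.congr h2) hΓ hL, ?_, h1, h2⟩
  rintro x (hx | hx) y (hy | hy) hxy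
  · exact hφi hx hy (by rwa [h1 hx, h1 hy] at hxy)
  · exact key x hx y hy hxy
  · exact (key y hy x hx hxy.symm).symm
  · exact hψi hx hy (by rwa [h2 hx, h2 hy] at hxy)

theorem exists_glue_arc [T2Space X] {Γ L : Set X} {L' : Set Y} {a b : X} (hΓ : IsClosed Γ)
    {φ : X → Y} (hφ : ContinuousOn φ Γ) (hφi : InjOn φ Γ) (hL : IsArc L a b)
    (hΓL : Γ ∩ L = {a, b}) (hL' : IsArc L' (φ a) (φ b)) (hΓL' : φ '' Γ ∩ L' ⊆ {φ a, φ b}) :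
    ∃ χ : X → Y, ContinuousOn χ (Γ ∪ L) ∧ InjOn χ (Γ ∪ L) ∧ EqOn χ φ Γ ∧ χ '' L = L' := by
  obtain ⟨ψ, hψ, hψi, ha, hb, hψL⟩ := hL.exists_map hL'
  obtain ⟨χ, h1, h2, h3, h4⟩ := exists_glue hΓ hL.isClosed hφ hφi hψ hψi (by
      rw [hΓL]
      rintro x (rfl | rfl)
      exacts [ha.symm, hb.symm]) (by rwa [hψL, hΓL, image_pair])
  exact ⟨χ, h1, h2, h3, h4.image_eq.trans hψL⟩

end Glue

/-- A pair of isomorphic cellular decompositions of two spaces. -/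
structure CellPair (X Y : Type*) [TopologicalSpace X] [TopologicalSpace Y] where
  skel : Set X
  map : X → Y
  faces : Set (Set X × Set Y)
  finite : faces.Finite
  continuousOn : ContinuousOn map skel
  injOn : InjOn map skel
  skel_eq : skel = ⋃ F ∈ faces, frontier F.1
  isOpen : ∀ F ∈ faces, IsOpen F.1 ∧ IsOpen F.2
  isPathConnected : ∀ F ∈ faces, IsPathConnected F.1 ∧ IsPathConnected F.2
  isJordanCurve : ∀ F ∈ faces, IsJordanCurve (frontier F.1)
  frontier_snd : ∀ F ∈ faces, frontier F.2 = map '' frontier F.1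
  compl_skel : skelᶜ = ⋃ F ∈ faces, F.1
  compl_image : (map '' skel)ᶜ = ⋃ F ∈ faces, F.2
  disjoint : ∀ F ∈ faces, ∀ G ∈ faces, F ≠ G → Disjoint F.1 G.1 ∧ Disjoint F.2 G.2

namespace CellPair

section Basic

variable {X Y : Type*} [TopologicalSpace X] [TopologicalSpace Y] (P : CellPair X Y)

theorem isCompact_skel : IsCompact P.skel := by
  rw [P.skel_eq]
  exact P.finite.isCompact_biUnion fun F hF => (P.isJordanCurve F hF).isCompact

theorem isClosed_skel [T2Space X] : IsClosed P.skel := P.isCompact_skel.isClosed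

variable {P}

theorem frontier_subset {F : Set X × Set Y} (hF : F ∈ P.faces) : frontier F.1 ⊆ P.skel := by
  rw [P.skel_eq]
  exact subset_biUnion_of_mem (u := fun F : Set X × Set Y => frontier F.1) hF

theorem isJordanCurve_snd {F : Set X × Set Y} (hF : F ∈ P.faces) :
    IsJordanCurve (frontier F.2) := by
  rw [P.frontier_snd F hF]
  exact (P.isJordanCurve F hF).map (P.continuousOn.mono (frontier_subset hF))
    (P.injOn.mono (frontier_subset hF))

theorem subset_compl_skel {F : Set X × Set Y} (hF : F ∈ P.faces) : F.1 ⊆ P.skelᶜ := by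
  rw [P.compl_skel]
  exact subset_biUnion_of_mem (u := fun F : Set X × Set Y => F.1) hF

theorem subset_compl_image {F : Set X × Set Y} (hF : F ∈ P.faces) :
    F.2 ⊆ (P.map '' P.skel)ᶜ := by
  rw [P.compl_image]
  exact subset_biUnion_of_mem (u := fun F : Set X × Set Y => F.2) hF

theorem isFace_fst {F : Set X × Set Y} (hF : F ∈ P.faces) : IsFace (frontier F.1) F.1 :=
  isFace_frontier (P.isOpen F hF).1 (P.isPathConnected F hF).1

theorem isFace_snd {F : Set X × Set Y} (hF : F ∈ P.faces) : IsFace (frontier F.2) F.2 :=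
  isFace_frontier (P.isOpen F hF).2 (P.isPathConnected F hF).2

theorem exists_mem_face {x : X} (hx : x ∉ P.skel) : ∃ F ∈ P.faces, x ∈ F.1 := by
  have : x ∈ P.skelᶜ := hx
  rw [P.compl_skel] at this
  simpa using this

theorem exists_subset_face {K : Set X} (hK : IsPreconnected K) (hne : K.Nonempty)
    (hKΓ : Disjoint K P.skel) : ∃ F ∈ P.faces, K ⊆ F.1 := by
  obtain ⟨x, hx⟩ := hne
  obtain ⟨F, hF, hxF⟩ := exists_mem_face (disjoint_left.1 hKΓ hx)
  refine ⟨F, hF, hK.subset_left_of_subset_union (P.isOpen F hF).1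
    (v := ⋃ G ∈ P.faces \ {F}, G.1) (isOpen_biUnion fun G hG => (P.isOpen G hG.1).1)
    ?_ (fun z hz => ?_) ⟨x, hx, hxF⟩⟩
  · exact disjoint_iUnion₂_right.2 fun G hG => (P.disjoint F hF G hG.1 (Ne.symm hG.2)).1
  · obtain ⟨G, hG, hzG⟩ := exists_mem_face (disjoint_left.1 hKΓ hz)
    by_cases h : G = F
    · exact Or.inl (h ▸ hzG)
    · exact Or.inr (mem_biUnion ⟨hG, h⟩ hzG)

variable (P) in
/-- Exchange the roles of the two spaces. -/
noncomputable def swap [T2Space X] [T2Space Y] [Nonempty X] : CellPair Y X where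
  skel := P.map '' P.skel
  map := Function.invFunOn P.map P.skel
  faces := Prod.swap '' P.faces
  finite := P.finite.image _
  continuousOn := continuousOn_invFunOn P.isCompact_skel P.continuousOn P.injOn
  injOn := by
    rintro _ ⟨x, hx, rfl⟩ _ ⟨y, hy, rfl⟩ h
    rw [P.injOn.leftInvOn_invFunOn hx, P.injOn.leftInvOn_invFunOn hy] at h
    rw [h]
  skel_eq := by
    rw [biUnion_image]
    conv_lhs => rw [P.skel_eq, image_iUnion₂]
    exact iUnion₂_congr fun F hF => (P.frontier_snd F hF).symm
  isOpen := by
    rintro _ ⟨F, hF, rfl⟩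
    exact (P.isOpen F hF).symm
  isPathConnected := by
    rintro _ ⟨F, hF, rfl⟩
    exact (P.isPathConnected F hF).symm
  isJordanCurve := by
    rintro _ ⟨F, hF, rfl⟩
    exact isJordanCurve_snd hF
  frontier_snd := by
    rintro _ ⟨F, hF, rfl⟩
    rw [Prod.snd_swap, Prod.fst_swap, P.frontier_snd F hF,
      (P.injOn.leftInvOn_invFunOn.mono (frontier_subset hF)).image_image]
  compl_skel := by
    rw [biUnion_image]
    exact P.compl_image
  compl_image := by
    rw [biUnion_image, P.injOn.leftInvOn_invFunOn.image_image]
    exact P.compl_skel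
  disjoint := by
    rintro _ ⟨F, hF, rfl⟩ _ ⟨G, hG, rfl⟩ h
    exact (P.disjoint F hF G hG (fun h' => h (by rw [h']))).symm

/-- `P.Refines Q` means that `P` is finer than `Q`. -/
def Refines (P Q : CellPair X Y) : Prop :=
  ∀ F ∈ P.faces, ∃ G ∈ Q.faces, F.1 ⊆ G.1 ∧ F.2 ⊆ G.2

theorem Refines.refl (P : CellPair X Y) : P.Refines P :=
  fun F hF => ⟨F, hF, subset_rfl, subset_rfl⟩

theorem Refines.trans {P Q R : CellPair X Y} (h : P.Refines Q) (h' : Q.Refines R) :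
    P.Refines R := fun F hF => by
  obtain ⟨G, hG, h1, h2⟩ := h F hF
  obtain ⟨H, hH, h3, h4⟩ := h' G hG
  exact ⟨H, hH, h1.trans h3, h2.trans h4⟩

theorem Refines.skel_subset {P Q : CellPair X Y} (h : P.Refines Q) : Q.skel ⊆ P.skel := by
  rw [← compl_subset_compl, P.compl_skel]
  refine iUnion₂_subset fun F hF => ?_
  obtain ⟨G, hG, h1, -⟩ := h F hF
  exact h1.trans (subset_compl_skel hG)

theorem Refines.swap [T2Space X] [T2Space Y] [Nonempty X] [Nonempty Y] {P : CellPair X Y}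
    {Q : CellPair Y X} (h : Q.Refines P.swap) : Q.swap.Refines P := by
  rintro _ ⟨F, hF, rfl⟩
  obtain ⟨_, ⟨G, hG, rfl⟩, h1, h2⟩ := h F hF
  exact ⟨G, hG, h2, h1⟩

end Basic

end CellPair

namespace CellPair

variable {X Y : Type*} [MetricSpace X] [MooreSpace X] [MetricSpace Y] [MooreSpace Y]

theorem _root_.MooreSpace.exists_faces {J : Set X} (hJ : IsJordanCurve J) :
    ∃ C D, IsFace J C ∧ IsFace J D ∧ Disjoint C D ∧ Jᶜ = C ∪ D := by
  obtain ⟨C, hC, -⟩ := MooreSpace.exists_isFace_ne hJ ∅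
  obtain ⟨D, hD, hDC⟩ := MooreSpace.exists_isFace_ne hJ C
  refine ⟨C, D, hC, hD, hC.disjoint hD hDC.symm, subset_antisymm (fun x hx => ?_)
    (union_subset hC.subset_compl hD.subset_compl)⟩
  have hx' := mem_pathComponentIn_self hx
  rcases MooreSpace.eq_or_eq_of_isFace hJ hC hD hDC ⟨x, hx, rfl⟩ with h | h
  · exact Or.inl (h ▸ hx')
  · exact Or.inr (h ▸ hx')

variable (X Y) in
theorem nonempty : Nonempty (CellPair X Y) := by
  obtain ⟨A, B, a, b, h⟩ := MooreSpace.exists_isArcPair X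
  obtain ⟨A', B', a', b', h'⟩ := MooreSpace.exists_isArcPair Y
  obtain ⟨φ, hφ, hφi, rfl, rfl, rfl⟩ := h.left.exists_map h'.left
  obtain ⟨χ, hχ, hχi, he, rfl⟩ := exists_glue_arc h.left.isClosed hφ hφi h.right h.inter_eq
    h'.right h'.inter
  have hU : χ '' (A ∪ B) = φ '' A ∪ χ '' B := by rw [image_union, he.image_eq]
  have hJ := h.isJordanCurve
  have hJ' := h'.isJordanCurve
  obtain ⟨C, D, hC, hD, hCD, hCDU⟩ := MooreSpace.exists_faces hJ
  obtain ⟨C', D', hC', hD', hCD', hCDU'⟩ := MooreSpace.exists_faces hJ'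
  have fC := MooreSpace.frontier_eq_of_isFace hJ hC
  have fD := MooreSpace.frontier_eq_of_isFace hJ hD
  have fC' := MooreSpace.frontier_eq_of_isFace hJ' hC'
  have fD' := MooreSpace.frontier_eq_of_isFace hJ' hD'
  have hmem : ∀ {p : Set X × Set Y → Prop}, p (C, C') → p (D, D') →
      ∀ F ∈ ({(C, C'), (D, D')} : Set (Set X × Set Y)), p F := by
    rintro p h1 h2 F (rfl | rfl)
    exacts [h1, h2]
  refine ⟨{
    skel := A ∪ B, map := χ, faces := {(C, C'), (D, D')}, finite := toFinite _,
    continuousOn := hχ, injOn := hχi, skel_eq := by simp [fC, fD],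
    isOpen := hmem ⟨hC.isOpen hJ.isClosed, hC'.isOpen hJ'.isClosed⟩
      ⟨hD.isOpen hJ.isClosed, hD'.isOpen hJ'.isClosed⟩,
    isPathConnected := hmem ⟨hC.isPathConnected, hC'.isPathConnected⟩
      ⟨hD.isPathConnected, hD'.isPathConnected⟩,
    isJordanCurve := hmem (by rwa [fC]) (by rwa [fD]),
    frontier_snd := hmem (by rw [fC, fC', hU]) (by rw [fD, fD', hU]),
    compl_skel := by simp [hCDU],
    compl_image := by rw [hU, hCDU']; simp,
    disjoint := hmem (hmem (fun h => absurd rfl h) fun _ => ⟨hCD, hCD'⟩)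
      (hmem (fun _ => ⟨hCD.symm, hCD'.symm⟩) fun h => absurd rfl h) }⟩

/-- Refine a cell pair by adding a crosscut of one of the faces. -/
theorem exists_refines_of_crosscut (P : CellPair X Y) {F : Set X × Set Y} (hF : F ∈ P.faces)
    {L : Set X} {a b : X} (hL : IsArc L a b) (hLF : L ⊆ F.1 ∪ {a, b}) (ha : a ∈ frontier F.1)
    (hb : b ∈ frontier F.1) : ∃ Q : CellPair X Y, Q.Refines P ∧ Q.skel = P.skel ∪ L := by
  obtain ⟨A, B, h, hAB⟩ := (P.isJordanCurve F hF).exists_isArcPair ha hb hL.ne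
  have hfΓ := frontier_subset hF
  have hf : IsFace (A ∪ B) F.1 := hAB ▸ isFace_fst hF
  have hAΓ : A ⊆ P.skel := subset_union_left.trans (hAB.subset.trans hfΓ)
  have hBΓ : B ⊆ P.skel := subset_union_right.trans (hAB.subset.trans hfΓ)
  have h' : IsArcPair (P.map '' A) (P.map '' B) (P.map a) (P.map b) :=
    ⟨h.left.map (P.continuousOn.mono hAΓ) (P.injOn.mono hAΓ),
      h.right.map (P.continuousOn.mono hBΓ) (P.injOn.mono hBΓ), by
        rw [← P.injOn.image_inter hAΓ hBΓ, h.inter_eq, image_pair]⟩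
  have hAB' : P.map '' A ∪ P.map '' B = frontier F.2 := by
    rw [← image_union, hAB, P.frontier_snd F hF]
  have hf' : IsFace (P.map '' A ∪ P.map '' B) F.2 := hAB' ▸ isFace_snd hF
  have hcl : ∀ x ∈ frontier F.1, P.map x ∈ closure F.2 := fun x hx =>
    frontier_subset_closure (by
      rw [P.frontier_snd F hF]
      exact mem_image_of_mem _ hx)
  have hel : ∀ x ∈ frontier F.1, EndLike (P.map '' A ∪ P.map '' B) (P.map x) := fun x hx =>
    MooreSpace.endLike_of_isJordanCurve h'.isJordanCurve (by
      rw [← image_union, hAB]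
      exact mem_image_of_mem _ hx)
  obtain ⟨L', hLF', hL'⟩ := MooreSpace.exists_crosscut h'.isJordanCurve.isClosed hf' h'.left.ne
    (hel a ha) (hcl a ha) (hel b hb) (hcl b hb)
  have hΓL : P.skel ∩ L = {a, b} := subset_antisymm
    (fun z hz => (hLF hz.2).resolve_left fun h => subset_compl_skel hF h hz.1)
    (pair_subset ⟨hfΓ ha, hL.left_mem⟩ ⟨hfΓ hb, hL.right_mem⟩)
  obtain ⟨χ, hχ, hχi, he, rfl⟩ := exists_glue_arc P.isClosed_skel P.continuousOn P.injOn hL hΓL hL'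
    fun z hz => (hLF' hz.2).resolve_left fun h => subset_compl_image hF h hz.1
  obtain ⟨E₁, E₂, o₁, o₂, c₁, c₂, f₁, f₂, hd, hE⟩ :=
    MooreSpace.exists_faces_of_crosscut h hf hL hLF
  obtain ⟨E₁', E₂', o₁', o₂', c₁', c₂', f₁', f₂', hd', hE'⟩ :=
    MooreSpace.exists_faces_of_crosscut h' hf' hL' hLF'
  have s₁ : E₁ ⊆ F.1 := fun z hz => (hE.subset (Or.inl hz)).1
  have s₂ : E₂ ⊆ F.1 := fun z hz => (hE.subset (Or.inr hz)).1
  have s₁' : E₁' ⊆ F.2 := fun z hz => (hE'.subset (Or.inl hz)).1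
  have s₂' : E₂' ⊆ F.2 := fun z hz => (hE'.subset (Or.inr hz)).1
  have hmem : ∀ {p : Set X × Set Y → Prop}, p (E₁, E₁') → p (E₂, E₂') →
      (∀ G ∈ P.faces, G ≠ F → p G) →
      ∀ G ∈ insert (E₁, E₁') (insert (E₂, E₂') (P.faces \ {F})), p G := by
    rintro p h1 h2 h3 G (rfl | rfl | h)
    exacts [h1, h2, h3 G h.1 h.2]
  have hfaces : P.faces = insert F (P.faces \ {F}) := by
    rw [insert_sdiff_singleton, insert_eq_of_mem hF]
  have hunion : ∀ f : Set X × Set Y → Set X,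
      (⋃ G ∈ P.faces, f G) = f F ∪ ⋃ G ∈ P.faces \ {F}, f G := fun f => by
    rw [← biUnion_insert, ← hfaces]
  have hunion' : (⋃ G ∈ P.faces, G.2) = F.2 ∪ ⋃ G ∈ P.faces \ {F}, G.2 := by
    rw [← biUnion_insert F _ Prod.snd, ← hfaces]
  have hfr : ∀ G ∈ P.faces, χ '' frontier G.1 = frontier G.2 := fun G hG => by
    rw [P.frontier_snd G hG, (he.mono (frontier_subset hG)).image_eq]
  refine ⟨{
    skel := P.skel ∪ L, map := χ,
    faces := insert (E₁, E₁') (insert (E₂, E₂') (P.faces \ {F})),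
    finite := ((P.finite.sdiff).insert _).insert _,
    continuousOn := hχ, injOn := hχi, skel_eq := ?_,
    isOpen := hmem ⟨o₁, o₁'⟩ ⟨o₂, o₂'⟩ fun G hG _ => P.isOpen G hG,
    isPathConnected := hmem ⟨c₁, c₁'⟩ ⟨c₂, c₂'⟩ fun G hG _ => P.isPathConnected G hG,
    isJordanCurve := hmem ?_ ?_ fun G hG _ => P.isJordanCurve G hG,
    frontier_snd := hmem ?_ ?_ fun G hG _ => (hfr G hG).symm,
    compl_skel := ?_, compl_image := ?_,
    disjoint := hmem (hmem (fun h => absurd rfl h) (fun _ => ⟨hd, hd'⟩) fun G hG hGF _ => ?_)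
      (hmem (fun _ => ⟨hd.symm, hd'.symm⟩) (fun h => absurd rfl h) fun G hG hGF _ => ?_)
      fun G hG hGF => hmem (fun _ => ?_) (fun _ => ?_) fun H hH _ h => P.disjoint G hG H hH h },
    hmem ⟨F, hF, s₁, s₁'⟩ ⟨F, hF, s₂, s₂'⟩ fun G hG _ => ⟨G, hG, subset_rfl, subset_rfl⟩,
    rfl⟩
  · rw [P.skel_eq, hunion fun F => frontier F.1, biUnion_insert, biUnion_insert, f₁, f₂, ← hAB]
    ext z
    simp only [mem_union]
    tauto
  · rw [f₁]
    exact (MooreSpace.isArcPair_crosscut h hf hL hLF).isJordanCurve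
  · rw [f₂]
    exact (MooreSpace.isArcPair_crosscut h.flip (union_comm A B ▸ hf) hL hLF).isJordanCurve
  · rw [f₁, f₁', image_union, (he.mono hAΓ).image_eq]
  · rw [f₂, f₂', image_union, (he.mono hBΓ).image_eq]
  · rw [compl_union, P.compl_skel, hunion Prod.fst, biUnion_insert, biUnion_insert, ← union_assoc,
      hE, union_inter_distrib_right, sdiff_eq]
    congr 1
    refine inter_eq_left.2 (iUnion₂_subset fun G hG z hz hzL => ?_)
    rcases hLF hzL with h | h
    · exact disjoint_left.1 (P.disjoint G hG.1 F hF hG.2).1 hz h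
    · exact subset_compl_skel hG.1 hz (hΓL.symm.subset h).1
  · rw [image_union, he.image_eq, compl_union, P.compl_image, hunion', biUnion_insert,
      biUnion_insert, ← union_assoc, hE', union_inter_distrib_right, sdiff_eq]
    congr 1
    refine inter_eq_left.2 (iUnion₂_subset fun G hG z hz hzL => ?_)
    rcases hLF' hzL with h | h
    · exact disjoint_left.1 (P.disjoint G hG.1 F hF hG.2).2 hz h
    · refine subset_compl_image hG.1 hz ?_
      rw [← image_pair] at h
      exact image_mono (pair_subset (hfΓ ha) (hfΓ hb)) h
  · have := P.disjoint F hF G hG hGF.symm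
    exact ⟨this.1.mono_left s₁, this.2.mono_left s₁'⟩
  · have := P.disjoint F hF G hG hGF.symm
    exact ⟨this.1.mono_left s₂, this.2.mono_left s₂'⟩
  · have := P.disjoint G hG F hF hGF
    exact ⟨this.1.mono_right s₁, this.2.mono_right s₁'⟩
  · have := P.disjoint G hG F hF hGF
    exact ⟨this.1.mono_right s₂, this.2.mono_right s₂'⟩

/-- Refine a cell pair by adding an arc which meets the skeleton only at its end points. -/
theorem exists_refines_of_isArc (P : CellPair X Y) {L : Set X} {a b : X} (hL : IsArc L a b)
    (ha : a ∈ P.skel) (hb : b ∈ P.skel) (hLP : L ∩ P.skel ⊆ {a, b}) :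
    ∃ Q : CellPair X Y, Q.Refines P ∧ Q.skel = P.skel ∪ L := by
  have hL₀ := hL
  obtain ⟨γ, hγ, hi, rfl, rfl, rfl⟩ := hL
  have hsub : Ioo (0 : ℝ) 1 ⊆ Icc 0 1 := Ioo_subset_Icc_self
  have hd : Disjoint (γ '' Ioo 0 1) P.skel := by
    refine disjoint_left.2 ?_
    rintro _ ⟨t, ht, rfl⟩ hP
    rcases hLP ⟨mem_image_of_mem γ (hsub ht), hP⟩ with h | h
    · exact ht.1.ne' (hi (hsub ht) (by simp) h)
    · exact ht.2.ne (hi (hsub ht) (by simp) h)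
  obtain ⟨F, hF, hsF⟩ := P.exists_subset_face (isPreconnected_Ioo.image _ (hγ.mono hsub))
    ((nonempty_Ioo.2 one_pos).image γ) hd
  have hcl : γ '' Icc 0 1 ⊆ closure F.1 := by
    rw [← closure_Ioo (zero_ne_one (α := ℝ))] at hγ ⊢
    exact hγ.image_closure.trans (closure_mono hsF)
  have hfr : ∀ x ∈ γ '' Icc 0 1, x ∈ P.skel → x ∈ frontier F.1 := fun x hx hxP => by
    rw [(P.isOpen F hF).1.frontier_eq]
    exact ⟨hcl hx, fun h => subset_compl_skel hF h hxP⟩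
  refine P.exists_refines_of_crosscut hF hL₀ ?_ (hfr _ hL₀.left_mem ha) (hfr _ hL₀.right_mem hb)
  rintro _ ⟨t, ht, rfl⟩
  rcases ht.1.eq_or_lt with rfl | h0
  · exact Or.inr (Or.inl rfl)
  rcases ht.2.eq_or_lt with rfl | h1
  · exact Or.inr (Or.inr rfl)
  exact Or.inl (hsF ⟨t, ⟨h0, h1⟩, rfl⟩)

theorem exists_refines_mem (P : CellPair X Y) (p : X) :
    ∃ Q : CellPair X Y, Q.Refines P ∧ p ∈ Q.skel := by
  by_cases hp : p ∈ P.skel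
  · exact ⟨P, Refines.refl P, hp⟩
  obtain ⟨F, hF, hpF⟩ := exists_mem_face hp
  obtain ⟨L, a, b, hL, hLF, ha, hb, hpL⟩ :=
    MooreSpace.exists_crosscut_mem (P.isJordanCurve F hF) (isFace_fst hF) hpF
  obtain ⟨Q, hQ, hLQ⟩ := P.exists_refines_of_crosscut hF hL hLF ha hb
  exact ⟨Q, hQ, hLQ.superset (Or.inr hpL)⟩

theorem exists_refines_forall {ι : Type*} {s : Set ι} (hs : s.Finite)
    {p : ι → CellPair X Y → Prop} (hp : ∀ i ∈ s, ∀ P Q : CellPair X Y, Q.Refines P → p i P → p i Q)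
    (P₀ : CellPair X Y)
    (he : ∀ i ∈ s, ∀ P : CellPair X Y, P.Refines P₀ → ∃ Q, Q.Refines P ∧ p i Q) :
    ∃ Q : CellPair X Y, Q.Refines P₀ ∧ ∀ i ∈ s, p i Q := by
  induction s, hs using Set.Finite.induction_on with
  | empty => exact ⟨P₀, Refines.refl P₀, by simp⟩
  | @insert i s _ _ ih =>
    obtain ⟨Q, hQ, hQs⟩ := ih (fun j hj => hp j (mem_insert_of_mem _ hj))
      (fun j hj => he j (mem_insert_of_mem _ hj))
    obtain ⟨R, hR, hRi⟩ := he i (mem_insert _ _) Q hQ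
    exact ⟨R, hR.trans hQ, forall_mem_insert.2
      ⟨hRi, fun j hj => hp j (mem_insert_of_mem _ hj) _ _ hR (hQs j hj)⟩⟩

end CellPair

/-- The part of an arc in a compact subset of an open set `V` is covered by finitely many connected
closed subsets of the arc in `V`. -/
theorem IsArc.exists_finset {X : Type*} [TopologicalSpace X] [T2Space X] {A V R : Set X} {a b : X}
    (hA : IsArc A a b) (hV : IsOpen V) (hR : IsClosed R) (hRV : R ⊆ V) :
    ∃ 𝒦 : Finset (Set X), (∀ K ∈ 𝒦, IsClosed K ∧ IsPreconnected K ∧ K ⊆ A ∩ V) ∧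
      A ∩ R ⊆ ⋃ K ∈ 𝒦, K := by
  classical
  obtain ⟨γ, hγ, -, -, -, rfl⟩ := hA
  refine interval_induction (P := fun s u => ∃ 𝒦 : Finset (Set X), (∀ K ∈ 𝒦, IsClosed K ∧
    IsPreconnected K ∧ K ⊆ γ '' Icc 0 1 ∩ V) ∧ γ '' Icc s u ∩ R ⊆ ⋃ K ∈ 𝒦, K) ?_ ?_
  · rintro s t u - hst htu - ⟨𝒦₁, h₁, h₁'⟩ ⟨𝒦₂, h₂, h₂'⟩
    refine ⟨𝒦₁ ∪ 𝒦₂, fun K hK => (Finset.mem_union.1 hK).elim (h₁ K) (h₂ K), ?_⟩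
    rw [← Icc_union_Icc_eq_Icc hst htu, image_union, union_inter_distrib_right,
      Finset.set_biUnion_union]
    exact union_subset_union h₁' h₂'
  · intro t ht
    by_cases htV : γ t ∈ V
    · obtain ⟨W, hW, hWe⟩ := (_root_.continuousOn_iff'.1 hγ) V hV
      refine ⟨W, hW, (hWe.subset ⟨htV, ht⟩).1, fun s u hs hsu hu hsub =>
        ⟨{γ '' Icc s u}, ?_, ?_⟩⟩
      · have hI : Icc s u ⊆ Icc 0 1 := Icc_subset_Icc hs hu
        intro K hK
        rw [Finset.mem_singleton] at hK
        subst hK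
        refine ⟨(isCompact_Icc.image_of_continuousOn (hγ.mono hI)).isClosed,
          isPreconnected_Icc.image _ (hγ.mono hI), ?_⟩
        rintro _ ⟨r, hr, rfl⟩
        exact ⟨⟨r, hI hr, rfl⟩, (hWe.superset ⟨hsub hr, hI hr⟩).1⟩
      · simp
    · obtain ⟨W, hW, hWe⟩ := (_root_.continuousOn_iff'.1 hγ) _ hR.isOpen_compl
      refine ⟨W, hW, (hWe.subset ⟨fun h => htV (hRV h), ht⟩).1, fun s u hs hsu hu hsub =>
        ⟨∅, by simp, ?_⟩⟩
      rintro _ ⟨⟨r, hr, rfl⟩, hrR⟩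
      exact absurd hrR (hWe.superset ⟨hsub hr, hs.trans hr.1, hr.2.trans hu⟩).1

namespace CellPair

variable {X Y : Type*} [MetricSpace X] [MooreSpace X] [MetricSpace Y] [MooreSpace Y]

theorem exists_finset (P : CellPair X Y) {V R : Set X} (hV : IsOpen V) (hR : IsClosed R)
    (hRV : R ⊆ V) : ∃ 𝒦 : Finset (Set X), (∀ K ∈ 𝒦, IsClosed K ∧ IsPreconnected K ∧
      K ⊆ P.skel ∩ V) ∧ P.skel ∩ R ⊆ ⋃ K ∈ 𝒦, K := by
  classical
  have key : ∀ F ∈ P.faces, ∃ 𝒦 : Finset (Set X), (∀ K ∈ 𝒦, IsClosed K ∧ IsPreconnected K ∧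
      K ⊆ P.skel ∩ V) ∧ frontier F.1 ∩ R ⊆ ⋃ K ∈ 𝒦, K := fun F hF => by
    obtain ⟨A, B, a, b, h, hAB⟩ := P.isJordanCurve F hF
    have hs := hAB.subset.trans (frontier_subset hF)
    obtain ⟨𝒦₁, h₁, h₁'⟩ := h.left.exists_finset hV hR hRV
    obtain ⟨𝒦₂, h₂, h₂'⟩ := h.right.exists_finset hV hR hRV
    refine ⟨𝒦₁ ∪ 𝒦₂, fun K hK => (Finset.mem_union.1 hK).elim (fun hK => ?_) fun hK => ?_, ?_⟩
    · exact ⟨(h₁ K hK).1, (h₁ K hK).2.1, (h₁ K hK).2.2.trans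
        (inter_subset_inter_left _ (subset_union_left.trans hs))⟩
    · exact ⟨(h₂ K hK).1, (h₂ K hK).2.1, (h₂ K hK).2.2.trans
        (inter_subset_inter_left _ (subset_union_right.trans hs))⟩
    · rw [← hAB, union_inter_distrib_right, Finset.set_biUnion_union]
      exact union_subset_union h₁' h₂'
  choose! 𝒦 h𝒦 h𝒦' using key
  refine ⟨P.finite.toFinset.biUnion 𝒦, fun K hK => ?_, ?_⟩
  · obtain ⟨F, hF, hK⟩ := Finset.mem_biUnion.1 hK
    exact h𝒦 F (P.finite.mem_toFinset.1 hF) K hK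
  · rintro x ⟨hx, hxR⟩
    rw [P.skel_eq] at hx
    obtain ⟨F, hF, hxF⟩ := mem_iUnion₂.1 hx
    obtain ⟨K, hK, hxK⟩ := mem_iUnion₂.1 (h𝒦' F hF ⟨hxF, hxR⟩)
    exact mem_biUnion (Finset.mem_biUnion.2 ⟨F, P.finite.mem_toFinset.2 hF, hK⟩) hxK

theorem exists_refines_of_cover {γ : ℝ → X} (hγ : ContinuousOn γ (Icc 0 1))
    (hi : InjOn γ (Icc 0 1)) {V : Set X} (hγV : γ '' Icc 0 1 ⊆ V) (n : ℕ) (P : CellPair X Y)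
    (h0 : γ 0 ∈ P.skel) (h1 : γ 1 ∈ P.skel) (𝒦 : Finset (Set X)) (hn : 𝒦.card ≤ n)
    (h𝒦 : ∀ K ∈ 𝒦, IsClosed K ∧ IsPreconnected K ∧ K ⊆ P.skel ∩ V)
    (hcov : P.skel ∩ γ '' Icc 0 1 ⊆ ⋃ K ∈ 𝒦, K) :
    ∃ Q : CellPair X Y, Q.Refines P ∧ ∃ K ⊆ Q.skel ∩ V, IsPreconnected K ∧ γ 0 ∈ K ∧ γ 1 ∈ K := by
  classical
  induction n generalizing P 𝒦 with
  | zero =>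
    obtain ⟨K, hK, -⟩ := mem_iUnion₂.1 (hcov ⟨h0, 0, by simp, rfl⟩)
    have := Finset.card_pos.2 ⟨K, hK⟩
    omega
  | succ n ih =>
    obtain ⟨K, hK, h0K⟩ := mem_iUnion₂.1 (hcov ⟨h0, 0, by simp, rfl⟩)
    by_cases h1K : γ 1 ∈ K
    · exact ⟨P, Refines.refl P, K, (h𝒦 K hK).2.2, (h𝒦 K hK).2.1, h0K, h1K⟩
    have hpre : ∀ {C : Set X}, IsClosed C → IsCompact (Icc 0 1 ∩ γ ⁻¹' C) := fun hC =>
      isCompact_Icc.of_isClosed_subset (hγ.preimage_isClosed_of_isClosed isClosed_Icc hC)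
        inter_subset_left
    obtain ⟨s, ⟨hs, hsK⟩, hsm⟩ := (hpre (h𝒦 K hK).1).exists_isGreatest
      ⟨0, by simp, h0K⟩
    let T : Set X := ⋃ K' ∈ 𝒦.erase K, K'
    have hT : IsClosed T := (𝒦.erase K).finite_toSet.isClosed_biUnion fun K' hK' =>
      (h𝒦 K' (Finset.mem_of_mem_erase hK')).1
    have hcovT : ∀ x ∈ P.skel ∩ γ '' Icc 0 1, x ∉ K → x ∈ T := fun x hx hxK => by
      obtain ⟨K', hK', hxK'⟩ := mem_iUnion₂.1 (hcov hx)
      exact mem_biUnion (Finset.mem_erase.2 ⟨by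
        rintro rfl
        exact hxK hxK', hK'⟩) hxK'
    have h1T : γ 1 ∈ T := hcovT _ ⟨h1, 1, by simp, rfl⟩ h1K
    obtain ⟨t, ⟨⟨ht, htT⟩, hst⟩, htm⟩ := ((hpre hT).inter_right isClosed_Ici).exists_isLeast
      ⟨1, ⟨⟨by simp, h1T⟩, hs.2⟩⟩
    obtain ⟨K', hK'e, htK'⟩ := mem_iUnion₂.1 htT
    have hK' := Finset.mem_of_mem_erase hK'e
    have hst' : s ≤ t := hst
    have hsub : Icc s t ⊆ Icc 0 1 := Icc_subset_Icc hs.1 ht.2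
    obtain ⟨Q, hQ, hQst⟩ : ∃ Q : CellPair X Y, Q.Refines P ∧
        Q.skel = P.skel ∪ γ '' Icc s t := by
      rcases hst'.eq_or_lt with rfl | hlt
      · refine ⟨P, Refines.refl P, ?_⟩
        rw [Icc_self, image_singleton, union_eq_left.2]
        exact singleton_subset_iff.2 ((h𝒦 K hK).2.2 hsK).1
      · refine P.exists_refines_of_isArc
          (isArc_image_Icc hlt (hγ.mono hsub) (hi.mono hsub)) ((h𝒦 K hK).2.2 hsK).1
          ((h𝒦 K' hK').2.2 htK').1 ?_
        rintro _ ⟨⟨r, hr, rfl⟩, hrP⟩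
        by_cases hrK : γ r ∈ K
        · exact Or.inl (congrArg γ (le_antisymm (hsm ⟨hsub hr, hrK⟩) hr.1))
        · exact Or.inr (congrArg γ (le_antisymm hr.2
            (htm ⟨⟨hsub hr, hcovT _ ⟨hrP, r, hsub hr, rfl⟩ hrK⟩, hr.1⟩)))
    have hPQ : P.skel ⊆ Q.skel := hQ.skel_subset
    have hstQ : γ '' Icc s t ⊆ Q.skel := subset_union_right.trans hQst.superset
    have hsst : γ s ∈ γ '' Icc s t := ⟨s, left_mem_Icc.2 hst', rfl⟩
    have htst : γ t ∈ γ '' Icc s t := ⟨t, right_mem_Icc.2 hst', rfl⟩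
    refine (ih Q (hPQ h0) (hPQ h1) (insert (K ∪ γ '' Icc s t ∪ K') ((𝒦.erase K).erase K'))
      ?_ ?_ ?_).imp fun R hR => ⟨hR.1.trans hQ, hR.2⟩
    · have e1 := Finset.card_erase_of_mem hK
      have e2 := Finset.card_erase_of_mem hK'e
      have e3 := Finset.card_pos.2 ⟨K', hK'e⟩
      have e4 := Finset.card_insert_le (K ∪ γ '' Icc s t ∪ K') ((𝒦.erase K).erase K')
      omega
    · refine fun M hM => (Finset.mem_insert.1 hM).elim (fun h => ?_) fun h => ?_
      · subst h
        refine ⟨((h𝒦 K hK).1.union (isCompact_Icc.image_of_continuousOn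
          (hγ.mono hsub)).isClosed).union (h𝒦 K' hK').1, ?_, union_subset (union_subset ?_ ?_) ?_⟩
        · exact IsPreconnected.union (γ t) (Or.inr htst) htK' (IsPreconnected.union (γ s) hsK hsst
            (h𝒦 K hK).2.1 (isPreconnected_Icc.image _ (hγ.mono hsub))) (h𝒦 K' hK').2.1
        · exact (h𝒦 K hK).2.2.trans (inter_subset_inter_left _ hPQ)
        · exact subset_inter hstQ ((image_mono hsub).trans hγV)
        · exact (h𝒦 K' hK').2.2.trans (inter_subset_inter_left _ hPQ)
      · have := h𝒦 M (Finset.mem_of_mem_erase (Finset.mem_of_mem_erase h))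
        exact ⟨this.1, this.2.1, this.2.2.trans (inter_subset_inter_left _ hPQ)⟩
    · rintro x ⟨hxQ, hx⟩
      rw [Finset.set_biUnion_insert]
      rcases hQst.subset hxQ with h | h
      · obtain ⟨M, hM, hxM⟩ := mem_iUnion₂.1 (hcov ⟨h, hx⟩)
        by_cases e : M = K
        · exact Or.inl (Or.inl (Or.inl (e ▸ hxM)))
        by_cases e' : M = K'
        · exact Or.inl (Or.inr (e' ▸ hxM))
        exact Or.inr (mem_biUnion (Finset.mem_erase.2 ⟨e', Finset.mem_erase.2 ⟨e, hM⟩⟩) hxM)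
      · exact Or.inl (Or.inl (Or.inr h))

/-- Two points of the skeleton which can be joined in an open set can be joined, after a refinement,
by a connected subset of the skeleton in that open set. -/
theorem exists_refines_join (P : CellPair X Y) {V : Set X} (hV : IsOpen V) {p q : X}
    (hp : p ∈ P.skel) (hq : q ∈ P.skel) (hpq : JoinedIn V p q) :
    ∃ Q : CellPair X Y, Q.Refines P ∧ ∃ K ⊆ Q.skel ∩ V, IsPreconnected K ∧ p ∈ K ∧ q ∈ K := by
  rcases eq_or_ne p q with rfl | hne
  · exact ⟨P, Refines.refl P, {p}, singleton_subset_iff.2 ⟨hp, hpq.source_mem⟩,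
      isPreconnected_singleton, rfl, rfl⟩
  obtain ⟨A, hAV, hA⟩ := hpq.exists_isArc hne
  obtain ⟨𝒦, h𝒦, hcov⟩ := P.exists_finset hV hA.isClosed hAV
  obtain ⟨γ, hγ, hi, rfl, rfl, rfl⟩ := hA
  exact P.exists_refines_of_cover hγ hi hAV _ hp hq 𝒦 le_rfl h𝒦 hcov

end CellPair

/-- A connected net of a fine cover of a Moore space separates points which are far apart. -/
theorem MooreSpace.not_joinedIn_of_net {X : Type*} [MetricSpace X] [MooreSpace X] {ε δ r : ℝ}
    (hδ : ∀ v x y : X, ε ≤ dist x v → ε ≤ dist y v → JoinedIn (closedBall v δ)ᶜ x y)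
    (hrδ : 3 * r ≤ δ) (hrε : r ≤ ε) {Γ t : Set X} {V : X → Set X} (hΓ : IsClosed Γ)
    (hVo : ∀ v ∈ t, IsOpen (V v)) (hVc : ∀ v ∈ t, IsPreconnected (V v)) (hvV : ∀ v ∈ t, v ∈ V v)
    (hVr : ∀ v ∈ t, V v ⊆ ball v r) (hcov : ∀ z, ∃ v ∈ t, z ∈ V v)
    (hnet : ∀ v ∈ t, ∀ w ∈ t, (V v ∩ V w).Nonempty → ∃ p, ∃ K ⊆ Γ ∩ V v, ∃ K' ⊆ Γ ∩ V w,
      IsPreconnected K ∧ IsPreconnected K' ∧ v ∈ K ∧ p ∈ K ∧ w ∈ K' ∧ p ∈ K')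
    {x y : X} (hxy : 4 * ε ≤ dist x y) : ¬ JoinedIn Γᶜ x y := by
  intro hJ
  obtain ⟨v₀, hv₀, -⟩ := hcov x
  have hr : 0 < r := pos_of_mem_ball (hVr v₀ hv₀ (hvV v₀ hv₀))
  have hε : 0 < ε := hr.trans_le hrε
  have hne : x ≠ y := dist_pos.1 (by linarith)
  obtain ⟨π, u, hπ, hs, hpre, hcr⟩ := MooreSpace.exists_log_criterion hne
  obtain ⟨g, hg⟩ := (hcr Γ hΓ hJ.source_mem hJ.target_mem).2 hJ
  let I : Set X := {v ∈ t | ε ≤ dist x v ∧ ε ≤ dist y v}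
  have hf : ∀ v ∈ I, ∃ f, IsLogOn u f (π ⁻¹' closedBall v δ) := fun v hv => by
    have h := hδ v x y hv.2.1 hv.2.2
    exact (hcr _ isClosed_closedBall h.source_mem h.target_mem).2 h
  choose! f hf using hf
  choose σ hσ using hs
  let c : X → ℂ := fun v => f v (σ v) - g (σ v)
  have hball : ∀ v ∈ t, ∀ w ∈ t, (V v ∩ V w).Nonempty → V v ⊆ closedBall w δ := by
    rintro v hv w hw ⟨z, hzv, hzw⟩ q hq
    have h1 := mem_ball.1 (hVr v hv hzv)
    have h2 := mem_ball.1 (hVr w hw hzw)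
    have h3 := mem_ball.1 (hVr v hv hq)
    have h4 := dist_triangle4 q v z w
    rw [dist_comm v z] at h4
    exact mem_closedBall.2 (by linarith)
  have hself : ∀ v ∈ t, (V v ∩ V v).Nonempty := fun v hv => ⟨v, hvV v hv, hvV v hv⟩
  have hvΓ : ∀ v ∈ t, v ∈ Γ := fun v hv => by
    obtain ⟨p, K, hK, -, -, -, -, hvK, -⟩ := hnet v hv v hv (hself v hv)
    exact (hK hvK).1
  have hconst : ∀ v ∈ I, ∀ K ⊆ Γ ∩ V v, IsPreconnected K → v ∈ K → ∀ p ∈ K,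
      f v (σ p) - g (σ p) = c v := fun v hv K hK hKc hvK p hp => by
    refine ((hf v hv).mono (preimage_mono ?_)).sub_eq_sub (hg.mono (preimage_mono ?_)) (hpre K hKc)
      (by rwa [mem_preimage, hσ]) (by rwa [mem_preimage, hσ])
    · exact hK.trans (inter_subset_right.trans (hball v hv.1 v hv.1 (hself v hv.1)))
    · exact hK.trans inter_subset_left
  have hagree : ∀ v ∈ I, ∀ w ∈ I, ∀ z, π z ∈ V v → π z ∈ V w → f v z - c v = f w z - c w := by
    intro v hv w hw z hzv hzw
    obtain ⟨p, K, hK, K', hK', hKc, hKc', hvK, hpK, hwK, hpK'⟩ := hnet v hv.1 w hw.1 ⟨π z, hzv, hzw⟩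
    have h1 := hconst v hv K hK hKc hvK p hpK
    have h2 := hconst w hw K' hK' hKc' hwK p hpK'
    have h3 := ((hf v hv).mono (preimage_mono (hball v hv.1 v hv.1 (hself v hv.1)))).sub_eq_sub
      ((hf w hw).mono (preimage_mono (hball v hv.1 w hw.1 ⟨π z, hzv, hzw⟩)))
      (hpre _ (hVc v hv.1)) (a := z) (b := σ p) hzv (by
        rw [mem_preimage, hσ]
        exact (hK hpK).2)
    linear_combination h3 + h1 - h2
  have hexp : ∀ v ∈ I, Complex.exp (c v) = 1 := fun v hv => by
    have h1 : σ v ∈ π ⁻¹' Γ := by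
      rw [mem_preimage, hσ]
      exact hvΓ v hv.1
    have h2 : σ v ∈ π ⁻¹' closedBall v δ := by
      rw [mem_preimage, hσ]
      exact hball v hv.1 v hv.1 (hself v hv.1) (hvV v hv.1)
    rw [Complex.exp_sub, (hf v hv).2 _ h2, hg.2 _ h1, div_self]
    rw [← hg.2 _ h1]
    exact Complex.exp_ne_zero _
  let S : Set X := {z | 2 * ε ≤ dist z x ∧ 2 * ε ≤ dist z y}
  have hS : IsClosed S :=
    (isClosed_le continuous_const (continuous_id.dist continuous_const)).inter
      (isClosed_le continuous_const (continuous_id.dist continuous_const))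
  have hSI : ∀ z, π z ∈ S → ∃ v ∈ I, π z ∈ V v := fun z hz => by
    obtain ⟨v, hv, hzv⟩ := hcov (π z)
    have h1 := mem_ball.1 (hVr v hv hzv)
    have h2 := dist_triangle_right (π z) x v
    have h3 := dist_triangle_right (π z) y v
    have h4 := hz.1
    have h5 := hz.2
    exact ⟨v, ⟨hv, by linarith, by linarith⟩, hzv⟩
  choose! m hmI hmV using hSI
  have hlog : IsLogOn u (fun z => f (m z) z - c (m z)) (π ⁻¹' S) := by
    refine ⟨fun z hz => ?_, fun z hz => ?_⟩
    · have hv := hmI z hz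
      have hzv := hmV z hz
      have hVn : π ⁻¹' V (m z) ∈ 𝓝 z := ((hVo _ hv.1).preimage hπ).mem_nhds hzv
      have h1 : ContinuousAt (fun z' => f (m z) z' - c (m z)) z :=
        (((hf _ hv).1.mono (preimage_mono (hball _ hv.1 _ hv.1 (hself _ hv.1)))).continuousAt
          hVn).sub continuousAt_const
      refine h1.continuousWithinAt.congr_of_eventuallyEq ?_ rfl
      filter_upwards [self_mem_nhdsWithin, mem_nhdsWithin_of_mem_nhds hVn] with z' hz' hz'V
      exact hagree _ (hmI z' hz') _ hv z' (hmV z' hz') hz'V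
    · have hv := hmI z hz
      rw [Complex.exp_sub, hexp _ hv, div_one]
      exact (hf _ hv).2 z (hball _ hv.1 _ hv.1 (hself _ hv.1) (hmV z hz))
  have hx : x ∉ S := fun h => by
    have := h.1
    rw [dist_self] at this
    linarith
  have hy : y ∉ S := fun h => by
    have := h.2
    rw [dist_self] at this
    linarith
  have h := ((hcr S hS hx hy).1 ⟨_, hlog⟩).mem_of_frontier isOpen_ball
    (disjoint_left.2 fun z hz hz' => hz ?_) (mem_ball_self (x := x) (by linarith : 0 < 2 * ε))
  · rw [mem_ball, dist_comm] at h
    linarith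
  · have h6 := mem_sphere.1 (frontier_ball_subset_sphere hz')
    have h7 := dist_triangle_left x y z
    have h8 : 2 * ε ≤ dist z y := by linarith
    exact ⟨h6.ge, h8⟩

namespace CellPair

variable {X Y : Type*} [MetricSpace X] [MooreSpace X] [MetricSpace Y] [MooreSpace Y]

theorem exists_refines_mesh (P : CellPair X Y) {ε : ℝ} (hε : 0 < ε) :
    ∃ Q : CellPair X Y, Q.Refines P ∧ ∀ F ∈ Q.faces, ∀ x ∈ F.1, ∀ y ∈ F.1, dist x y < ε := by
  obtain ⟨δ, hδ, hsep⟩ := MooreSpace.exists_closedBall_not_separating X (by positivity : 0 < ε / 4)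
  have hr : 0 < min δ (ε / 4) / 3 := by positivity
  set r := min δ (ε / 4) / 3 with hrdef
  have h1 : 3 * r ≤ δ := by linarith [min_le_left δ (ε / 4)]
  have h2 : r ≤ ε / 4 := by linarith [min_le_right δ (ε / 4)]
  choose V hVo hVc hvV hVr using fun v : X =>
    exists_isOpen_isPathConnected_subset (isOpen_ball (x := v) (ε := r)) (mem_ball_self hr)
  obtain ⟨t, ht⟩ := isCompact_univ.elim_finite_subcover V hVo
    fun v _ => mem_iUnion.2 ⟨v, hvV v⟩
  obtain ⟨Q, hQ, hQt⟩ := exists_refines_forall (X := X) (Y := Y) (s := (t ×ˢ t : Set (X × X)))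
    (t.finite_toSet.prod t.finite_toSet)
    (p := fun i P => (V i.1 ∩ V i.2).Nonempty → ∃ p, ∃ K ⊆ P.skel ∩ V i.1, ∃ K' ⊆ P.skel ∩ V i.2,
      IsPreconnected K ∧ IsPreconnected K' ∧ i.1 ∈ K ∧ p ∈ K ∧ i.2 ∈ K' ∧ p ∈ K')
    (fun i _ P Q hQ h hi => by
      obtain ⟨p, K, hK, K', hK', h⟩ := h hi
      exact ⟨p, K, hK.trans (inter_subset_inter_left _ hQ.skel_subset), K',
        hK'.trans (inter_subset_inter_left _ hQ.skel_subset), h⟩) P (by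
      rintro ⟨v, w⟩ - P -
      by_cases hi : (V v ∩ V w).Nonempty
      · obtain ⟨p, hpv, hpw⟩ := hi
        obtain ⟨P₁, r₁, m₁⟩ := P.exists_refines_mem v
        obtain ⟨P₂, r₂, m₂⟩ := P₁.exists_refines_mem w
        obtain ⟨P₃, r₃, m₃⟩ := P₂.exists_refines_mem p
        obtain ⟨P₄, r₄, K, hK, hKc, hvK, hpK⟩ := P₃.exists_refines_join (hVo v)
          (r₃.skel_subset (r₂.skel_subset m₁)) m₃ ((hVc v).joinedIn v (hvV v) p hpv)
        obtain ⟨P₅, r₅, K', hK', hKc', hwK, hpK'⟩ := P₄.exists_refines_join (hVo w)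
          (r₄.skel_subset (r₃.skel_subset m₂)) (r₄.skel_subset m₃)
          ((hVc w).joinedIn w (hvV w) p hpw)
        exact ⟨P₅, r₅.trans (r₄.trans (r₃.trans (r₂.trans r₁))), fun _ => ⟨p, K,
          hK.trans (inter_subset_inter_left _ r₅.skel_subset), K', hK', hKc, hKc', hvK, hpK, hwK,
          hpK'⟩⟩
      · exact ⟨P, Refines.refl P, fun h => absurd h hi⟩)
  refine ⟨Q, hQ, fun F hF x hx y hy => ?_⟩
  by_contra! hxy
  refine MooreSpace.not_joinedIn_of_net hsep h1 h2 (t := (t : Set X)) Q.isClosed_skel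
    (fun v _ => hVo v) (fun v _ => (hVc v).isConnected.isPreconnected) (fun v _ => hvV v)
    (fun v _ => hVr v) (fun z => by simpa using ht (mem_univ z))
    (fun v hv w hw => hQt (v, w) ⟨hv, hw⟩) (x := x) (y := y) (by linarith) ?_
  exact ((Q.isPathConnected F hF).1.joinedIn x hx y hy).mono (subset_compl_skel hF)

end CellPair

namespace CellPair

section Basic

variable {X Y : Type*} [TopologicalSpace X] [TopologicalSpace Y]

/-- The closed relation between two spaces given by the closed cells of a cell pair. -/
def rel (P : CellPair X Y) : Set (X × Y) :=
  ⋃ F ∈ P.faces, closure F.1 ×ˢ closure F.2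

variable (P : CellPair X Y)

theorem isClosed_rel : IsClosed P.rel :=
  P.finite.isClosed_biUnion fun _ _ => isClosed_closure.prod isClosed_closure

variable {P}

theorem mem_rel {z : X × Y} : z ∈ P.rel ↔ ∃ F ∈ P.faces, z.1 ∈ closure F.1 ∧ z.2 ∈ closure F.2 := by
  simp only [rel, mem_iUnion₂, mem_prod, exists_prop]

theorem Refines.rel_subset {Q : CellPair X Y} (h : Q.Refines P) : Q.rel ⊆ P.rel := fun z hz => by
  obtain ⟨F, hF, h1, h2⟩ := mem_rel.1 hz
  obtain ⟨G, hG, hFG, hFG'⟩ := h F hF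
  exact mem_rel.2 ⟨G, hG, closure_mono hFG h1, closure_mono hFG' h2⟩

variable (P) in
theorem exists_mem_rel (x : X) : ∃ y, (x, y) ∈ P.rel := by
  obtain ⟨F, hF, hx⟩ : ∃ F ∈ P.faces, x ∈ closure F.1 := by
    by_cases hx : x ∈ P.skel
    · rw [P.skel_eq] at hx
      obtain ⟨F, hF, hxF⟩ := mem_iUnion₂.1 hx
      exact ⟨F, hF, frontier_subset_closure hxF⟩
    · obtain ⟨F, hF, hxF⟩ := exists_mem_face hx
      exact ⟨F, hF, subset_closure hxF⟩
  obtain ⟨y, hy⟩ := (P.isPathConnected F hF).2.nonempty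
  exact ⟨y, mem_rel.2 ⟨F, hF, hx, subset_closure hy⟩⟩

theorem closure_snd_inter_nonempty {F G : Set X × Set Y} (hF : F ∈ P.faces) (hG : G ∈ P.faces)
    (h : (closure F.1 ∩ closure G.1).Nonempty) : (closure F.2 ∩ closure G.2).Nonempty := by
  by_cases hFG : F = G
  · rw [hFG, inter_self]
    exact (P.isPathConnected G hG).2.nonempty.closure
  obtain ⟨z, hzF, hzG⟩ := h
  have hd := (P.disjoint F hF G hG hFG).1
  have h1 : z ∈ frontier F.1 := by
    rw [(P.isOpen F hF).1.frontier_eq]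
    exact ⟨hzF, fun h => disjoint_left.1 (hd.closure_right (P.isOpen F hF).1) h hzG⟩
  have h2 : z ∈ frontier G.1 := by
    rw [(P.isOpen G hG).1.frontier_eq]
    exact ⟨hzG, fun h => disjoint_left.1 (hd.closure_left (P.isOpen G hG).1) hzF h⟩
  refine ⟨P.map z, frontier_subset_closure ?_, frontier_subset_closure ?_⟩
  · rw [P.frontier_snd F hF]
    exact mem_image_of_mem _ h1
  · rw [P.frontier_snd G hG]
    exact mem_image_of_mem _ h2

theorem mem_rel_swap [T2Space X] [T2Space Y] [Nonempty X] {x : X} {y : Y} :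
    (y, x) ∈ P.swap.rel ↔ (x, y) ∈ P.rel := by
  simp only [mem_rel]
  constructor
  · rintro ⟨_, ⟨F, hF, rfl⟩, h1, h2⟩
    exact ⟨F, hF, h2, h1⟩
  · rintro ⟨F, hF, h1, h2⟩
    exact ⟨_, ⟨F, hF, rfl⟩, h2, h1⟩

end Basic

section Metric

variable {X Y : Type*} [MetricSpace X] [MetricSpace Y]

/-- The faces of the cell pair have diameter less than `ε` on both sides. -/
def IsFine (P : CellPair X Y) (ε : ℝ) : Prop :=
  ∀ F ∈ P.faces, (∀ x ∈ F.1, ∀ y ∈ F.1, dist x y < ε) ∧ ∀ x ∈ F.2, ∀ y ∈ F.2, dist x y < ε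

theorem IsFine.swap [Nonempty X] {P : CellPair X Y} {ε : ℝ} (h : P.IsFine ε) :
    P.swap.IsFine ε := by
  rintro _ ⟨F, hF, rfl⟩
  exact (h F hF).symm

theorem exists_refines_isFine [MooreSpace X] [MooreSpace Y] (P : CellPair X Y) {ε : ℝ}
    (hε : 0 < ε) : ∃ Q : CellPair X Y, Q.Refines P ∧ Q.IsFine ε := by
  obtain ⟨Q, hQ, h1⟩ := P.exists_refines_mesh hε
  obtain ⟨R, hR, h2⟩ := Q.swap.exists_refines_mesh hε
  refine ⟨R.swap, hR.swap.trans hQ, ?_⟩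
  rintro F hF
  refine ⟨?_, ?_⟩
  · obtain ⟨G, hG, hFG, -⟩ := hR.swap F hF
    exact fun x hx y hy => h1 G hG x (hFG hx) y (hFG hy)
  · obtain ⟨G, hG, rfl⟩ := hF
    exact h2 G hG

theorem dist_le_of_mem_rel {P : CellPair X Y} {ε : ℝ} (h : P.IsFine ε) {x : X} {y y' : Y}
    (hy : (x, y) ∈ P.rel) (hy' : (x, y') ∈ P.rel) : dist y y' ≤ 2 * ε := by
  obtain ⟨F, hF, hxF, hyF⟩ := mem_rel.1 hy
  obtain ⟨G, hG, hxG, hyG⟩ := mem_rel.1 hy'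
  obtain ⟨z, hzF, hzG⟩ := closure_snd_inter_nonempty hF hG ⟨x, hxF, hxG⟩
  have key : ∀ F ∈ P.faces, ∀ a ∈ closure F.2, ∀ b ∈ closure F.2, dist a b ≤ ε :=
    fun F hF a ha b hb => by
      have : (a, b) ∈ closure (F.2 ×ˢ F.2) := by
        rw [closure_prod_eq]
        exact ⟨ha, hb⟩
      exact closure_minimal (fun z hz => ((h F hF).2 z.1 hz.1 z.2 hz.2).le)
        (isClosed_le continuous_dist continuous_const) this
  have h1 := key F hF y hyF z hzF
  have h2 := key G hG z hzG y' hyG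
  linarith [dist_triangle y z y']

theorem exists_seq [MooreSpace X] [MooreSpace Y] : ∃ P : ℕ → CellPair X Y,
    (∀ n, (P (n + 1)).Refines (P n)) ∧ ∀ n : ℕ, (P (n + 1)).IsFine (1 / (n + 1)) := by
  obtain ⟨P₀⟩ := CellPair.nonempty X Y
  choose next h1 h2 using fun (n : ℕ) (P : CellPair X Y) =>
    P.exists_refines_isFine (ε := 1 / (n + 1)) (by positivity)
  exact ⟨fun n => Nat.rec P₀ next n, fun n => h1 n _, fun n => h2 n _⟩

theorem exists_forall_mem_rel [CompactSpace Y] {P : ℕ → CellPair X Y}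
    (hP : ∀ n, (P (n + 1)).Refines (P n)) (x : X) : ∃ y, ∀ n, (x, y) ∈ (P n).rel := by
  have hcl : ∀ n, IsClosed {y | (x, y) ∈ (P n).rel} := fun n =>
    (P n).isClosed_rel.preimage (Continuous.prodMk_right x)
  obtain ⟨y, hy⟩ := IsCompact.nonempty_iInter_of_sequence_nonempty_isCompact_isClosed
    (fun n => {y | (x, y) ∈ (P n).rel}) (fun n y hy => (hP n).rel_subset hy)
    (fun n => (P n).exists_mem_rel x) (hcl 0).isCompact hcl
  exact ⟨y, fun n => mem_iInter.1 hy n⟩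

theorem eq_of_forall_mem_rel {P : ℕ → CellPair X Y}
    (hP : ∀ n : ℕ, (P (n + 1)).IsFine (1 / (n + 1))) {x : X} {y y' : Y}
    (hy : ∀ n, (x, y) ∈ (P n).rel) (hy' : ∀ n, (x, y') ∈ (P n).rel) : y = y' := by
  have h : ∀ n : ℕ, dist y y' ≤ 2 * (1 / ((n : ℝ) + 1)) := fun n =>
    dist_le_of_mem_rel (hP n) (hy _) (hy' _)
  have ht := (tendsto_one_div_add_atTop_nhds_zero_nat (𝕜 := ℝ)).const_mul 2
  rw [mul_zero] at ht
  exact dist_le_zero.1 (ge_of_tendsto' ht h)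

end Metric

end CellPair

theorem continuous_of_isClosed_graph {X Y : Type*} [TopologicalSpace X] [TopologicalSpace Y]
    [CompactSpace Y] {f : X → Y} (h : IsClosed {z : X × Y | z.2 = f z.1}) : Continuous f := by
  refine continuous_iff_isClosed.2 fun C hC => ?_
  convert isClosedMap_fst_of_compactSpace _ (h.inter (hC.preimage continuous_snd))
  ext x
  simp

/-- Any two Moore spaces are homeomorphic. -/
theorem MooreSpace.nonempty_homeomorph (X Y : Type*) [MetricSpace X] [MooreSpace X]
    [MetricSpace Y] [MooreSpace Y] : Nonempty (X ≃ₜ Y) := by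
  obtain ⟨P, hP, hPf⟩ := CellPair.exists_seq (X := X) (Y := Y)
  choose f hf using CellPair.exists_forall_mem_rel hP
  have hf' : ∀ {x y}, (∀ n, (x, y) ∈ (P n).rel) ↔ y = f x := by
    refine fun {x y} => ⟨fun h => CellPair.eq_of_forall_mem_rel hPf h (hf x), ?_⟩
    rintro rfl
    exact hf x
  have hswap : ∀ n, (P (n + 1)).swap.Refines (P n).swap := fun n => by
    rintro _ ⟨F, hF, rfl⟩
    obtain ⟨G, hG, h1, h2⟩ := hP n F hF
    exact ⟨_, ⟨G, hG, rfl⟩, h2, h1⟩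
  choose g hg using CellPair.exists_forall_mem_rel (P := fun n => (P n).swap) hswap
  have hfg : ∀ y, f (g y) = y := fun y => (hf'.1 fun n => CellPair.mem_rel_swap.1 (hg y n)).symm
  have hgf : ∀ x, g (f x) = x := fun x => CellPair.eq_of_forall_mem_rel (fun n => (hPf n).swap)
    (hg (f x)) fun n => CellPair.mem_rel_swap.2 (hf x n)
  have hcont : Continuous f := by
    refine continuous_of_isClosed_graph ?_
    have : {z : X × Y | z.2 = f z.1} = ⋂ n, (P n).rel := by
      ext z
      rw [mem_iInter]
      exact hf'.symm
    rw [this]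
    exact isClosed_iInter fun n => (P n).isClosed_rel
  exact ⟨Continuous.homeoOfEquivCompactToT2 (f := ⟨f, g, hgf, hfg⟩) hcont⟩

section ClosedMap

variable {T X : Type*} [TopologicalSpace T] [TopologicalSpace X] {π : T → X}

theorem IsClosedMap.t2Space [NormalSpace T] (hcl : IsClosedMap π) (hs : Function.Surjective π)
    (hf : ∀ x, IsClosed (π ⁻¹' {x})) : T2Space X := by
  refine ⟨fun x y hxy => ?_⟩
  obtain ⟨U, V, hU, hV, hxU, hyV, hUV⟩ := normal_separation (hf x) (hf y)
    ((disjoint_singleton.2 hxy).preimage π)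
  refine ⟨kernImage π U, kernImage π V, isClosedMap_iff_kernImage.1 hcl hU,
    isClosedMap_iff_kernImage.1 hcl hV, fun z hz => hxU hz, fun z hz => hyV hz,
    disjoint_left.2 fun z hzU hzV => ?_⟩
  obtain ⟨t, rfl⟩ := hs z
  exact disjoint_left.1 hUV (hzU rfl) (hzV rfl)

theorem IsClosedMap.secondCountableTopology [SecondCountableTopology T] (hcl : IsClosedMap π)
    (hc : Continuous π) (hs : Function.Surjective π) (hf : ∀ x, IsCompact (π ⁻¹' {x})) :
    SecondCountableTopology X := by
  have hB := TopologicalSpace.isBasis_countableBasis T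
  refine (TopologicalSpace.isTopologicalBasis_of_isOpen_of_nhds
    (s := (fun 𝒰 : Set (Set T) => kernImage π (⋃₀ 𝒰)) ''
      {𝒰 | 𝒰.Finite ∧ 𝒰 ⊆ TopologicalSpace.countableBasis T}) ?_ ?_).secondCountableTopology
      ((countable_ofPred_finite_subset (TopologicalSpace.countable_countableBasis T)).image _)
  · rintro _ ⟨𝒰, h𝒰, rfl⟩
    exact isClosedMap_iff_kernImage.1 hcl (isOpen_sUnion fun U hU => hB.isOpen (h𝒰.2 hU))
  · intro x O hx hO
    have hfO : ∀ t ∈ π ⁻¹' {x}, ∃ U ∈ TopologicalSpace.countableBasis T, t ∈ U ∧ U ⊆ π ⁻¹' O :=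
      fun t ht => hB.exists_subset_of_mem_open (by rwa [mem_preimage, ht]) (hO.preimage hc)
    choose! U hUB htU hUO using hfO
    obtain ⟨s, hsx, hsU⟩ := (hf x).elim_nhds_subcover U
      fun t ht => (hB.isOpen (hUB t ht)).mem_nhds (htU t ht)
    refine ⟨_, ⟨U '' s, ⟨s.finite_toSet.image U, ?_⟩, rfl⟩, ?_, ?_⟩
    · rintro _ ⟨t, ht, rfl⟩
      exact hUB t (hsx t ht)
    · intro t ht
      obtain ⟨q, hq, htq⟩ := mem_iUnion₂.1 (hsU ht)
      exact ⟨U q, ⟨q, hq, rfl⟩, htq⟩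
    · intro z hz
      obtain ⟨t, rfl⟩ := hs z
      obtain ⟨_, ⟨q, hq, rfl⟩, htq⟩ := hz rfl
      exact hUO q (hsx q hq) htq

theorem Setoid.isClosedMap_mk [CompactSpace T] {r : Setoid T}
    (h : IsClosed {p : T × T | r.r p.1 p.2}) : IsClosedMap (Quotient.mk r) := fun C hC => by
  rw [← isQuotientMap_quotient_mk'.isClosed_preimage]
  convert isClosedMap_snd_of_compactSpace _ ((hC.preimage continuous_fst).inter h)
  ext y
  constructor
  · rintro ⟨x, hx, hxy⟩
    exact ⟨(x, y), ⟨hx, Quotient.exact hxy⟩, rfl⟩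
  · rintro ⟨⟨x, y⟩, ⟨hx, hxy⟩, rfl⟩
    exact ⟨x, hx, Quotient.sound hxy⟩

end ClosedMap

theorem TwoSphere.isConnected_compl_singleton (y : TwoSphere) :
    IsConnected ({y}ᶜ : Set TwoSphere) := by
  obtain ⟨e, σ, h⟩ := exists_isPuncturedChart y
  have : range σ = {y}ᶜ := by
    ext z
    exact ⟨by rintro ⟨w, rfl⟩; exact h.ne w, fun hz => ⟨e z, h.right_inv z hz⟩⟩
  exact this ▸ isConnected_range h.cont

instance : Nontrivial TwoSphere := by
  obtain ⟨y⟩ : Nonempty TwoSphere := (NormedSpace.sphere_nonempty.2 zero_le_one).to_subtype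
  obtain ⟨z, hz⟩ := (TwoSphere.isConnected_compl_singleton y).nonempty
  exact ⟨z, y, hz⟩

instance : MooreSpace TwoSphere where
  exists_map := ⟨id, continuous_id, Function.surjective_id, fun _ => isConnected_singleton,
    TwoSphere.isConnected_compl_singleton⟩

/-- Moore's theorem (Proposition 3.4): for a topologically closed equivalence
relation on the 2-sphere whose classes are connected and proper, the quotient
is homeomorphic to the sphere if and only if no class separates the sphere,
i.e. every class has connected complement. -/
theorem moore_quotient_homeomorphic_sphere_iff
    (r : Setoid (Metric.sphere (0 : EuclideanSpace ℝ (Fin 3)) 1))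
    (hclosed : IsClosed {p : (Metric.sphere (0 : EuclideanSpace ℝ (Fin 3)) 1) ×
        (Metric.sphere (0 : EuclideanSpace ℝ (Fin 3)) 1) | r.r p.1 p.2})
    (hconn : ∀ x : Metric.sphere (0 : EuclideanSpace ℝ (Fin 3)) 1,
      IsConnected {y | r.r x y})
    (hproper : ∀ x : Metric.sphere (0 : EuclideanSpace ℝ (Fin 3)) 1,
      {y | r.r x y} ≠ Set.univ) :
    Nonempty (Quotient r ≃ₜ Metric.sphere (0 : EuclideanSpace ℝ (Fin 3)) 1) ↔
      (∀ x : Metric.sphere (0 : EuclideanSpace ℝ (Fin 3)) 1,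
        IsConnected ({y | r.r x y}ᶜ)) := by
  have hpre : ∀ x, Quotient.mk r ⁻¹' {Quotient.mk r x} = {y | r.r x y} := fun x => by
    ext y
    exact ⟨fun h => Quotient.exact (Eq.symm h), fun h => (Quotient.sound h).symm⟩
  have hcl := Setoid.isClosedMap_mk hclosed
  have hc : Continuous (Quotient.mk r) := continuous_quotient_mk'
  have hs : Function.Surjective (Quotient.mk r) := Quotient.mk_surjective
  have hfc : ∀ z, IsConnected (Quotient.mk r ⁻¹' {z}) := fun z => by
    obtain ⟨x, rfl⟩ := hs z
    exact (hpre x).symm ▸ hconn x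
  constructor
  · rintro ⟨φ⟩ x
    refine ⟨nonempty_compl.2 (hproper x), ?_⟩
    have h := (φ.isClosedMap.comp hcl).isPreconnected_preimage (φ.continuous.comp hc)
      (φ.surjective.comp hs) (fun y => ?_)
      (TwoSphere.isConnected_compl_singleton (φ (Quotient.mk r x))).isPreconnected
    · rwa [← hpre, ← preimage_compl, ← φ.injective.preimage_image {Quotient.mk r x}ᶜ,
        image_compl_eq φ.bijective, image_singleton]
    · obtain ⟨z, rfl⟩ := φ.surjective y
      rw [preimage_comp, ← image_singleton, φ.injective.preimage_image]
      exact hfc z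
  · intro h
    have hfcl : ∀ z, IsClosed (Quotient.mk r ⁻¹' {z}) := fun z => by
      obtain ⟨x, rfl⟩ := hs z
      rw [hpre]
      exact hclosed.preimage (Continuous.prodMk_right x)
    have := hcl.t2Space hs hfcl
    have := hcl.secondCountableTopology hc hs fun z => (hfcl z).isCompact
    have : Nontrivial (Quotient r) := by
      obtain ⟨x⟩ : Nonempty TwoSphere := inferInstance
      obtain ⟨y, hy⟩ := nonempty_compl.2 (hproper x)
      exact ⟨Quotient.mk r x, Quotient.mk r y, fun he => hy (Quotient.exact he)⟩
    let m : MetricSpace (Quotient r) := TopologicalSpace.metrizableSpaceMetric (Quotient r)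
    have : MooreSpace (Quotient r) :=
      { exists_map := ⟨Quotient.mk r, hc, hs, hfc, fun z => by
          obtain ⟨x, rfl⟩ := hs z
          exact (hpre x).symm ▸ h x⟩ }
    exact MooreSpace.nonempty_homeomorph (Quotient r) TwoSphere
end

section
/- In the Gromov–Hausdorff space 𝒳 of isometry classes of nonempty compact metric spaces, equipped with the Borel σ-algebra of the Gromov–Hausdorff distance, the set of isometry classes whose representative (S,d) is a geodesic metric space homeomorphic to the 2-sphere is a Borel-measurable set. -/
open MeasureTheory
/-- A metric space is geodesic if any two points are joined by an isometric path. -/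
def IsGeodesicSpace (S : Type*) [MetricSpace S] : Prop :=
  ∀ x y : S, ∃ γ : ℝ → S, γ 0 = x ∧ γ (dist x y) = y ∧
    ∀ s ∈ Set.Icc (0 : ℝ) (dist x y), ∀ t ∈ Set.Icc (0 : ℝ) (dist x y),
      dist (γ s) (γ t) = |s - t|

open Set Topology Filter TopologicalSpace

/-- A Gδ subset of a Polish space is Polish. -/
theorem IsGδ.polishSpace {X : Type*} [TopologicalSpace X] [PolishSpace X] {s : Set X}
    (hs : IsGδ s) : PolishSpace s := by
  obtain ⟨U, hU, rfl⟩ := hs.eq_iInter_nat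
  have (n : ℕ) : PolishSpace (U n) := (hU n).polishSpace
  let f : (⋂ n, U n) → ∀ n, U n := fun x n ↦ ⟨x, mem_iInter.1 x.2 n⟩
  have hf : Continuous f := by fun_prop
  have hrange : range f = ⋂ n, {g | (g n : X) = g 0} := by
    ext g
    simp only [mem_range, mem_iInter, mem_ofPred_eq]
    constructor
    · rintro ⟨x, rfl⟩ n
      rfl
    · intro h
      refine ⟨⟨g 0, mem_iInter.2 fun n ↦ h n ▸ (g n).2⟩, ?_⟩
      ext n
      exact (h n).symm
  refine IsClosedEmbedding.polishSpace (f := f) ⟨⟨?_, ?_⟩, ?_⟩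
  · refine .of_comp hf (g := fun g : ∀ n, U n ↦ (g 0 : X)) (by fun_prop) ?_
    exact IsInducing.subtypeVal
  · intro x y h
    exact Subtype.ext (congrArg (fun g : ∀ n, U n ↦ (g 0 : X)) h)
  · rw [hrange]
    exact isClosed_iInter fun n ↦ isClosed_eq (by fun_prop) (by fun_prop)

/-- If `q` is a continuous map from a Polish space to a metric space and the saturation of every
open set is open, then the range of `q` is Borel. -/
theorem Continuous.measurableSet_range_of_isOpen_preimage_image {E Y : Type*} [TopologicalSpace E]
    [PolishSpace E] [MetricSpace Y] [MeasurableSpace Y] [BorelSpace Y] {q : E → Y}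
    (hq : Continuous q) (hsat : ∀ U, IsOpen U → IsOpen (q ⁻¹' (q '' U))) :
    MeasurableSet (range q) := by
  let _ := upgradeIsCompletelyMetrizable E
  have hsep (U : Set E) (hU : IsOpen U) : ∃ B : Set Y, MeasurableSet B ∧
      B ⊆ closure (q '' U) ∧ ∀ x, q x ∈ B ↔ q x ∈ q '' U := by
    obtain ⟨B, hUB, hB, hBm⟩ := AnalyticSet.measurablySeparable
      (hU.analyticSet_image hq) ((hsat U hU).isClosed_compl.analyticSet.image_of_continuous hq)
      (by
        rw [Set.disjoint_left]
        rintro _ hy ⟨x, hx, rfl⟩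
        exact hx hy)
    refine ⟨B ∩ closure (q '' U), hBm.inter isClosed_closure.measurableSet,
      inter_subset_right, fun x ↦ ⟨fun hx ↦ ?_, fun hx ↦ ⟨hUB hx, subset_closure hx⟩⟩⟩
    by_contra h
    exact Set.disjoint_left.1 hB ⟨x, h, rfl⟩ hx.1
  choose! B hBm hBcl hBq using hsep
  have hb := isBasis_countableBasis E
  have hbo {U : Set E} (hU : U ∈ countableBasis E) : IsOpen U := hb.isOpen hU
  have hrange : range q = (⋃ U ∈ countableBasis E, B U) ∩
      ⋂ U ∈ countableBasis E, ⋂ k : ℕ, ((B U)ᶜ ∪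
        ⋃ V ∈ {V ∈ countableBasis E | V ⊆ U ∧
          ∀ x ∈ V, ∀ y ∈ V, dist x y ≤ (1 / 2) ^ k}, B V) := by
    ext y
    simp only [mem_inter_iff, mem_iUnion, mem_iInter, mem_union, mem_compl_iff, exists_prop,
      ← imp_iff_not_or]
    constructor
    · rintro ⟨x, rfl⟩
      constructor
      · obtain ⟨U, hU, hxU, -⟩ := hb.exists_subset_of_mem_open (mem_univ x) isOpen_univ
        exact ⟨U, hU, (hBq U (hbo hU) x).2 ⟨x, hxU, rfl⟩⟩
      · intro U hU k hx
        obtain ⟨x', hx', hxx'⟩ := (hBq U (hbo hU) x).1 hx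
        obtain ⟨V, hV, hxV, hVU⟩ := hb.exists_subset_of_mem_open
          (u := U ∩ Metric.ball x' ((1 / 2) ^ k / 2)) ⟨hx', Metric.mem_ball_self (by positivity)⟩
          ((hbo hU).inter Metric.isOpen_ball)
        refine ⟨V, ⟨hV, fun z hz ↦ (hVU hz).1, fun a ha c hc ↦ ?_⟩,
          (hBq V (hbo hV) x).2 ⟨x', hxV, hxx'⟩⟩
        have h1 := Metric.mem_ball.1 (hVU ha).2
        have h2 := Metric.mem_ball.1 (hVU hc).2
        linarith [dist_triangle_right a c x']
    · rintro ⟨⟨U₀, hU₀, hyU₀⟩, hstep⟩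
      choose! F hF hFB using hstep
      let W : ℕ → Set E := fun n ↦ Nat.rec U₀ (fun k U ↦ F U k) n
      have hW (n : ℕ) : W n ∈ countableBasis E ∧ y ∈ B (W n) := by
        induction n with
        | zero => exact ⟨hU₀, hyU₀⟩
        | succ k ih => exact ⟨(hF (W k) ih.1 k ih.2).1, hFB (W k) ih.1 k ih.2⟩
      have hWF (n : ℕ) := hF (W n) (hW n).1 n (hW n).2
      have hanti : Antitone W := antitone_nat_of_succ_le fun n ↦ (hWF n).2.1
      have hx (n : ℕ) : ∃ x ∈ W (n + 1), dist y (q x) < (1 / 2) ^ n := by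
        obtain ⟨_, ⟨x, hx, rfl⟩, h⟩ := Metric.mem_closure_iff.1
          (hBcl _ (hbo (hW (n + 1)).1) (hW (n + 1)).2) ((1 / 2) ^ n) (by positivity)
        exact ⟨x, hx, h⟩
      choose x hxW hxq using hx
      have hpow : Tendsto (fun n : ℕ ↦ (1 / 2 : ℝ) ^ n) atTop (𝓝 0) :=
        tendsto_pow_atTop_nhds_zero_of_lt_one (by norm_num) (by norm_num)
      have hcauchy : CauchySeq x := cauchySeq_of_le_tendsto_0 _
        (fun n m N hn hm ↦ (hWF N).2.2 _ (hanti (Nat.succ_le_succ hn) (hxW n)) _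
          (hanti (Nat.succ_le_succ hm) (hxW m))) hpow
      obtain ⟨z, hz⟩ := cauchySeq_tendsto_of_complete hcauchy
      refine ⟨z, tendsto_nhds_unique ((hq.tendsto z).comp hz) ?_⟩
      rw [tendsto_iff_dist_tendsto_zero]
      exact squeeze_zero (fun _ ↦ dist_nonneg)
        (fun n ↦ (dist_comm _ _).trans_le (hxq n).le) hpow
  rw [hrange]
  have hc := countable_countableBasis E
  exact (MeasurableSet.biUnion hc fun U hU ↦ hBm U (hbo hU)).inter
    (MeasurableSet.biInter hc fun U hU ↦ MeasurableSet.iInter fun k ↦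
      (hBm U (hbo hU)).compl.union
        (MeasurableSet.biUnion (hc.mono fun V hV ↦ hV.1) fun V hV ↦ hBm V (hbo hV.1)))

section CompatibleMetric

variable {K : Type*} [TopologicalSpace K]

/-- A continuous function on `K × K` satisfying the axioms of a metric. -/
structure IsContinuousMetric (d : C(K × K, ℝ)) : Prop where
  self (x : K) : d (x, x) = 0
  comm (x y : K) : d (x, y) = d (y, x)
  triangle (x y z : K) : d (x, z) ≤ d (x, y) + d (y, z)
  pos (x y : K) : x ≠ y → 0 < d (x, y)

/-- Any two points are joined by a path along which `d` is proportional to the parameter. -/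
def HasUnitGeodesics (d : C(K × K, ℝ)) : Prop :=
  ∀ x y : K, ∃ γ : ℝ → K, γ 0 = x ∧ γ 1 = y ∧
    ∀ s ∈ Icc (0 : ℝ) 1, ∀ t ∈ Icc (0 : ℝ) 1, d (γ s, γ t) = |s - t| * d (x, y)

/-- A metric which is continuous on a compact space induces its topology. -/
@[reducible]
def IsContinuousMetric.metricSpace [CompactSpace K] {d : C(K × K, ℝ)}
    (h : IsContinuousMetric d) : MetricSpace K :=
  MetricSpace.ofDistTopology (fun x y ↦ d (x, y)) h.self h.comm h.triangle
    (fun s ↦ by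
      constructor
      · intro hs x hx
        rcases sᶜ.eq_empty_or_nonempty with he | hne
        · exact ⟨1, one_pos, fun y _ ↦ by simp [compl_empty_iff.1 he]⟩
        · obtain ⟨z, hz, hmin⟩ := hs.isClosed_compl.isCompact.exists_isMinOn hne
            (f := fun y ↦ d (x, y)) (by fun_prop)
          refine ⟨d (x, z), h.pos x z fun hxz ↦ hz (hxz ▸ hx), fun y hy ↦ ?_⟩
          by_contra hys
          exact (hmin hys).not_gt hy
      · intro hs
        refine isOpen_iff_mem_nhds.2 fun x hx ↦ ?_
        obtain ⟨ε, hε, hsub⟩ := hs x hx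
        refine mem_of_superset ((isOpen_lt (f := fun y ↦ d (x, y)) (g := fun _ ↦ ε)
          (by fun_prop) (by fun_prop)).mem_nhds ?_) hsub
        simpa [h.self x] using hε)
    (fun x y hxy ↦ by
      by_contra hne
      exact (h.pos x y hne).ne' hxy)

theorem IsContinuousMetric.comp {L : Type*} [TopologicalSpace L] {d : C(K × K, ℝ)}
    (h : IsContinuousMetric d) (φ : L ≃ₜ K) :
    IsContinuousMetric (d.comp ((φ : C(L, K)).prodMap φ)) where
  self _ := h.self _
  comm _ _ := h.comm _ _
  triangle _ _ _ := h.triangle _ _ _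
  pos _ _ hxy := h.pos _ _ (φ.injective.ne hxy)

theorem HasUnitGeodesics.comp {L : Type*} [TopologicalSpace L] {d : C(K × K, ℝ)}
    (h : HasUnitGeodesics d) (φ : L ≃ₜ K) :
    HasUnitGeodesics (d.comp ((φ : C(L, K)).prodMap φ)) := by
  intro x y
  obtain ⟨γ, h0, h1, hγ⟩ := h (φ x) (φ y)
  refine ⟨φ.symm ∘ γ, by simp [h0], by simp [h1], fun s hs t ht ↦ ?_⟩
  simpa using hγ s hs t ht

variable (K) in
theorem isClosed_setOf_hasUnitGeodesics [CompactSpace K] [T2Space K] :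
    IsClosed {d : C(K × K, ℝ) | HasUnitGeodesics d} := by
  simp only [HasUnitGeodesics, ofPred_forall]
  refine isClosed_iInter fun x ↦ isClosed_iInter fun y ↦ ?_
  have hcl : IsClosed {p : C(K × K, ℝ) × (ℝ → K) | p.2 0 = x ∧ p.2 1 = y ∧
      ∀ s ∈ Icc (0 : ℝ) 1, ∀ t ∈ Icc (0 : ℝ) 1,
        p.1 (p.2 s, p.2 t) = |s - t| * p.1 (x, y)} := by
    simp only [ofPred_and, ofPred_forall]
    refine (isClosed_eq (by fun_prop) (by fun_prop)).inter
      ((isClosed_eq (by fun_prop) (by fun_prop)).inter ?_)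
    exact isClosed_iInter fun s ↦ isClosed_iInter fun _ ↦ isClosed_iInter fun t ↦
      isClosed_iInter fun _ ↦ isClosed_eq (by fun_prop) (by fun_prop)
  convert isClosedMap_fst_of_compactSpace _ hcl using 1
  ext d
  simp

variable (K) in
theorem isGδ_setOf_isContinuousMetric [CompactSpace K] [MetrizableSpace K] :
    IsGδ {d : C(K × K, ℝ) | IsContinuousMetric d} := by
  let _ := metrizableSpaceMetric K
  have hset : {d : C(K × K, ℝ) | IsContinuousMetric d} =
      ((⋂ x : K, {d : C(K × K, ℝ) | d (x, x) = 0}) ∩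
          (⋂ x : K, ⋂ y : K, {d : C(K × K, ℝ) | d (x, y) = d (y, x)}) ∩
        ⋂ x : K, ⋂ y : K, ⋂ z : K, {d : C(K × K, ℝ) | d (x, z) ≤ d (x, y) + d (y, z)}) ∩
      ⋂ n : ℕ, {d : C(K × K, ℝ) |
        MapsTo d {p : K × K | 1 / ((n : ℝ) + 1) ≤ dist p.1 p.2} (Ioi 0)} := by
    ext d
    simp only [mem_inter_iff, mem_iInter, mem_ofPred_eq]
    constructor
    · refine fun h ↦ ⟨⟨⟨h.self, h.comm⟩, h.triangle⟩, fun n p hp ↦ h.pos p.1 p.2 fun he ↦ ?_⟩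
      rw [mem_ofPred_eq, he, dist_self] at hp
      exact hp.not_gt (by positivity)
    · rintro ⟨⟨⟨h1, h2⟩, h3⟩, h4⟩
      refine ⟨h1, h2, h3, fun x y hxy ↦ ?_⟩
      obtain ⟨n, hn⟩ := exists_nat_one_div_lt (dist_pos.2 hxy)
      exact h4 n (x := (x, y)) hn.le
  rw [hset]
  refine IsGδ.inter (IsClosed.isGδ ?_) (.iInter_of_isOpen fun n ↦ ?_)
  · refine ((isClosed_iInter fun x ↦ ?_).inter
      (isClosed_iInter fun x ↦ isClosed_iInter fun y ↦ ?_)).inter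
      (isClosed_iInter fun x ↦ isClosed_iInter fun y ↦ isClosed_iInter fun z ↦ ?_)
    · exact isClosed_eq (by fun_prop) (by fun_prop)
    · exact isClosed_eq (by fun_prop) (by fun_prop)
    · exact isClosed_le (by fun_prop) (by fun_prop)
  · exact ContinuousMap.isOpen_setOfPred_mapsTo
      (isClosed_le (by fun_prop) (by fun_prop)).isCompact isOpen_Ioi

/-- The class in the Gromov–Hausdorff space of a compact space with a continuous metric. -/
noncomputable def IsContinuousMetric.toGHSpace [CompactSpace K] [Nonempty K] {d : C(K × K, ℝ)}
    (h : IsContinuousMetric d) : GromovHausdorff.GHSpace :=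
  letI := h.metricSpace
  GromovHausdorff.toGHSpace K

theorem IsContinuousMetric.toGHSpace_eq_iff [CompactSpace K] [Nonempty K] {d : C(K × K, ℝ)}
    (h : IsContinuousMetric d) {X : Type*} [MetricSpace X] [CompactSpace X] [Nonempty X] :
    h.toGHSpace = GromovHausdorff.toGHSpace X ↔
      ∃ φ : K ≃ₜ X, ∀ x y, dist (φ x) (φ y) = d (x, y) := by
  let _ := h.metricSpace
  refine GromovHausdorff.toGHSpace_eq_toGHSpace_iff_isometryEquiv.trans ⟨?_, ?_⟩
  · rintro ⟨φ⟩
    exact ⟨φ.toHomeomorph, φ.isometry.dist_eq⟩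
  · rintro ⟨φ, hφ⟩
    exact ⟨⟨φ.toEquiv, Isometry.of_dist_eq hφ⟩⟩

theorem IsContinuousMetric.toGHSpace_eq_toGHSpace_iff [CompactSpace K] [Nonempty K]
    {d d' : C(K × K, ℝ)} (h : IsContinuousMetric d) (h' : IsContinuousMetric d') :
    h.toGHSpace = h'.toGHSpace ↔ ∃ φ : K ≃ₜ K, d = d'.comp ((φ : C(K, K)).prodMap φ) := by
  let _ := h'.metricSpace
  refine h.toGHSpace_eq_iff.trans (exists_congr fun φ ↦ ⟨fun hφ ↦ ?_, ?_⟩)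
  · ext ⟨x, y⟩
    exact (hφ x y).symm
  · rintro rfl x y
    rfl

theorem IsContinuousMetric.dist_toGHSpace_le [CompactSpace K] [Nonempty K]
    {d d' : C(K × K, ℝ)} (h : IsContinuousMetric d) (h' : IsContinuousMetric d') :
    dist h.toGHSpace h'.toGHSpace ≤ dist d d' / 2 := by
  have := @GromovHausdorff.ghDist_le_of_approx_subsets K h.metricSpace _ _ K h'.metricSpace _ _
    univ (fun x ↦ x) 0 (dist d d') 0 (fun x ↦ ⟨x, mem_univ x, (h.self x).le⟩)
    (fun x ↦ ⟨⟨x, mem_univ x⟩, (h'.self x).le⟩)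
    (fun x y ↦ ContinuousMap.dist_apply_le_dist (f := d) (g := d') (x.1, y.1))
  rw [zero_add, add_zero] at this
  exact this

theorem isGeodesicSpace_iff_hasUnitGeodesics {X : Type*} [MetricSpace X] {d : C(K × K, ℝ)}
    (φ : K ≃ₜ X) (hφ : ∀ x y, dist (φ x) (φ y) = d (x, y)) :
    IsGeodesicSpace X ↔ HasUnitGeodesics d := by
  constructor
  · intro h x y
    obtain ⟨γ, h0, h1, hγ⟩ := h (φ x) (φ y)
    have hmem {s : ℝ} (hs : s ∈ Icc (0 : ℝ) 1) :
        s * dist (φ x) (φ y) ∈ Icc 0 (dist (φ x) (φ y)) :=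
      ⟨mul_nonneg hs.1 dist_nonneg, mul_le_of_le_one_left dist_nonneg hs.2⟩
    refine ⟨fun s ↦ φ.symm (γ (s * dist (φ x) (φ y))), by simp [h0], by simp [h1],
      fun s hs t ht ↦ ?_⟩
    rw [← hφ, ← hφ, φ.apply_symm_apply, φ.apply_symm_apply, hγ _ (hmem hs) _ (hmem ht),
      ← sub_mul, abs_mul, abs_of_nonneg dist_nonneg]
  · intro h x y
    obtain ⟨γ, h0, h1, hγ⟩ := h (φ.symm x) (φ.symm y)
    rcases eq_or_ne x y with rfl | hxy
    · refine ⟨fun _ ↦ x, rfl, rfl, fun s hs t ht ↦ ?_⟩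
      rw [dist_self, Icc_self, mem_singleton_iff] at hs ht
      simp [hs, ht]
    · have hpos := dist_pos.2 hxy
      have hmem {s : ℝ} (hs : s ∈ Icc 0 (dist x y)) : s / dist x y ∈ Icc (0 : ℝ) 1 :=
        ⟨div_nonneg hs.1 hpos.le, div_le_one_of_le₀ hs.2 hpos.le⟩
      refine ⟨fun s ↦ φ (γ (s / dist x y)), by simp [h0], by simp [h1, hpos.ne'],
        fun s hs t ht ↦ ?_⟩
      rw [hφ, hγ _ (hmem hs) _ (hmem ht), ← hφ, φ.apply_symm_apply, φ.apply_symm_apply,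
        ← sub_div, abs_div, abs_of_pos hpos, div_mul_cancel₀ _ hpos.ne']

variable (K) in
/-- The geodesic spaces homeomorphic to a given compact metrizable space form a Borel subset of the
Gromov–Hausdorff space. -/
theorem measurableSet_setOf_isGeodesicSpace_and_homeomorph [CompactSpace K] [MetrizableSpace K]
    [Nonempty K] :
    MeasurableSet[borel GromovHausdorff.GHSpace]
      {p : GromovHausdorff.GHSpace | IsGeodesicSpace p.Rep ∧ Nonempty (p.Rep ≃ₜ K)} := by
  borelize GromovHausdorff.GHSpace
  let E := {d : C(K × K, ℝ) | IsContinuousMetric d} ∩ {d | HasUnitGeodesics d}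
  have : PolishSpace E := by
    have : SecondCountableTopology K := by
      let _ := metrizableSpaceMetric K
      infer_instance
    exact ((isGδ_setOf_isContinuousMetric K).inter
      (isClosed_setOf_hasUnitGeodesics K).isGδ).polishSpace
  let q : E → GromovHausdorff.GHSpace := fun d ↦ d.2.1.toGHSpace
  have hq : Continuous q :=
    (LipschitzWith.of_dist_le_mul (K := 1) fun d d' ↦
      (d.2.1.dist_toGHSpace_le d'.2.1).trans (by
        rw [NNReal.coe_one, one_mul]
        exact half_le_self dist_nonneg)).continuous
  have hsat (U : Set E) (hU : IsOpen U) : IsOpen (q ⁻¹' (q '' U)) := by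
    let pullback (φ : K ≃ₜ K) (d : E) : E :=
      ⟨d.1.comp ((φ : C(K, K)).prodMap φ), d.2.1.comp φ, d.2.2.comp φ⟩
    have hpullback (φ : K ≃ₜ K) : Continuous (pullback φ) :=
      ((ContinuousMap.continuous_precomp _).comp continuous_subtype_val).subtype_mk _
    have heq (d e : E) : q d = q e ↔ ∃ φ, d = pullback φ e :=
      (d.2.1.toGHSpace_eq_toGHSpace_iff e.2.1).trans
        (exists_congr fun φ ↦ by rw [Subtype.ext_iff])
    have : q ⁻¹' (q '' U) = ⋃ φ, pullback φ ⁻¹' U := by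
      ext d
      simp only [mem_preimage, mem_image, mem_iUnion]
      constructor
      · rintro ⟨e, he, hed⟩
        obtain ⟨φ, rfl⟩ := (heq e d).1 hed
        exact ⟨φ, he⟩
      · rintro ⟨φ, hφ⟩
        exact ⟨pullback φ d, hφ, (heq _ d).2 ⟨φ, rfl⟩⟩
    rw [this]
    exact isOpen_iUnion fun φ ↦ hU.preimage (hpullback φ)
  convert hq.measurableSet_range_of_isOpen_preimage_image hsat using 1
  ext p
  simp only [mem_ofPred_eq, mem_range]
  constructor
  · rintro ⟨hp, ⟨φ⟩⟩
    let d : C(K × K, ℝ) := ⟨fun z ↦ dist (φ.symm z.1) (φ.symm z.2), by fun_prop⟩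
    have hd : IsContinuousMetric d :=
      ⟨fun x ↦ dist_self (φ.symm x), fun x y ↦ dist_comm (φ.symm x) (φ.symm y),
        fun x y z ↦ dist_triangle (φ.symm x) (φ.symm y) (φ.symm z),
        fun _ _ hxy ↦ dist_pos.2 (φ.symm.injective.ne hxy)⟩
    have hφ : ∀ x y, dist (φ.symm x) (φ.symm y) = d (x, y) := fun _ _ ↦ rfl
    refine ⟨⟨d, hd, (isGeodesicSpace_iff_hasUnitGeodesics φ.symm hφ).1 hp⟩, ?_⟩
    exact (hd.toGHSpace_eq_iff.2 ⟨φ.symm, hφ⟩).trans p.toGHSpace_rep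
  · rintro ⟨d, hd⟩
    obtain ⟨φ, hφ⟩ := d.2.1.toGHSpace_eq_iff.1 (hd.trans p.toGHSpace_rep.symm)
    exact ⟨(isGeodesicSpace_iff_hasUnitGeodesics φ hφ).2 d.2.2, ⟨φ.symm⟩⟩

end CompatibleMetric

/-- Proposition 2.15: in the Gromov–Hausdorff space of isometry classes of
nonempty compact metric spaces (with the Borel σ-algebra of the
Gromov–Hausdorff distance), the set of classes whose representative is a
geodesic metric space homeomorphic to the 2-sphere is Borel measurable. -/
theorem geodesic_spheres_measurable_in_GHSpace :
    MeasurableSet[borel GromovHausdorff.GHSpace]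
      {p : GromovHausdorff.GHSpace |
        IsGeodesicSpace p.Rep ∧
        Nonempty (p.Rep ≃ₜ Metric.sphere (0 : EuclideanSpace ℝ (Fin 3)) 1)} := by
  have : Nonempty (Metric.sphere (0 : EuclideanSpace ℝ (Fin 3)) 1) :=
    (NormedSpace.sphere_nonempty.2 zero_le_one).to_subtype
  exact measurableSet_setOf_isGeodesicSpace_and_homeomorph _
end
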